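/- Let K be a subfield of ℂ, q an indeterminate over K, and ξ a K[q,q^{-1}]-point of M_q such that the centralizer of η(ξ) in M(N,K) has dimension N (i.e. the classical adjoint orbit of η(ξ) is of maximal dimension). Then the kernel of the co-orbit map β^ξ_{K(q)} : O_{K(q)}(M_q) → O_{K(q)}(GL_q) coincides with the right ideal Σ_{i=1}^N (τ_i − τ_i(ξ))·O_{K(q)}(M_q). -/

import Mathlib

open TensorProduct

set_option maxHeartbeats 1000000
set_option synthInstance.maxHeartbeats 400000

noncomputable section

/-- Number of inversions (the length) of a permutation of `Fin t`. -/
def invCount {t : ℕ} (σ : Equiv.Perm (Fin t)) : ℕ :=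
  (Finset.univ.filter fun p : Fin t × Fin t => p.1 < p.2 ∧ σ p.2 < σ p.1).card

/-- The principal quantum minor `[I|I]` of the matrix of generators `x`. -/
def qMinor {A : Type} [CommRing A] {M : Type} [Ring M] [Algebra A M] {N : ℕ}
    (q : A) (x : Fin N → Fin N → M) (I : Finset (Fin N)) : M :=
  ∑ σ : Equiv.Perm (Fin I.card),
    ((-q) ^ invCount σ) •
      ((List.finRange I.card).map fun k =>
        x ((I.orderIsoOfFin rfl) k).1 ((I.orderIsoOfFin rfl) (σ k)).1).prod

/-- The quantum determinant. -/
def qdet {A : Type} [CommRing A] {M : Type} [Ring M] [Algebra A M] {N : ℕ}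
    (q : A) (x : Fin N → Fin N → M) : M :=
  qMinor q x Finset.univ

/-- `w(I)`: the sum of the elements of `I` (with `{1, …, N}` indexing). -/
def wtSet {N : ℕ} (I : Finset (Fin N)) : ℕ := ∑ j ∈ I, (j.1 + 1)

/-- The weighted sum `τ_i` of principal quantum minors of size `i`. -/
def tauCoinv {A : Type} [CommRing A] {M : Type} [Ring M] [Algebra A M] {N : ℕ}
    (q qinv : A) (x : Fin N → Fin N → M) (i : ℕ) : M :=
  ∑ I ∈ Finset.univ.filter (fun I : Finset (Fin N) => I.card = i),
    qinv ^ (2 * wtSet I) • qMinor q x I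

/-- The sum `σ_i` of all principal quantum minors of size `i`. -/
def sigmaCoinv {A : Type} [CommRing A] {M : Type} [Ring M] [Algebra A M] {N : ℕ}
    (q : A) (x : Fin N → Fin N → M) (i : ℕ) : M :=
  ∑ I ∈ Finset.univ.filter (fun I : Finset (Fin N) => I.card = i), qMinor q x I

/-- The right adjoint coaction `β(h) = Σ h₂ ⊗ S(h₁)h₃`. -/
def adjBeta {A : Type} [CommRing A] {M G : Type} [Ring M] [Algebra A M] [Ring G] [Algebra A G]
    (ΔM : M →ₐ[A] M ⊗[A] M) (ι : M →ₐ[A] G) (St : G →ₗ[A] G) : M →ₗ[A] M ⊗[A] G :=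
  TensorProduct.map LinearMap.id (LinearMap.mul' A G) ∘ₗ
  (TensorProduct.assoc A M G G).toLinearMap ∘ₗ
  TensorProduct.map
    ((TensorProduct.comm A G M).toLinearMap ∘ₗ
      TensorProduct.map (St ∘ₗ ι.toLinearMap) LinearMap.id)
    ι.toLinearMap ∘ₗ
  TensorProduct.map ΔM.toLinearMap LinearMap.id ∘ₗ ΔM.toLinearMap

/-- The right coaction `α(h) = Σ h₂ ⊗ h₃S(h₁)`. -/
def adjAlpha {A : Type} [CommRing A] {M G : Type} [Ring M] [Algebra A M] [Ring G] [Algebra A G]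
    (ΔM : M →ₐ[A] M ⊗[A] M) (ι : M →ₐ[A] G) (St : G →ₗ[A] G) : M →ₗ[A] M ⊗[A] G :=
  TensorProduct.map LinearMap.id (LinearMap.mul' A G) ∘ₗ
  TensorProduct.map LinearMap.id (TensorProduct.comm A G G).toLinearMap ∘ₗ
  (TensorProduct.assoc A M G G).toLinearMap ∘ₗ
  TensorProduct.map
    ((TensorProduct.comm A G M).toLinearMap ∘ₗ
      TensorProduct.map (St ∘ₗ ι.toLinearMap) LinearMap.id)
    ι.toLinearMap ∘ₗ
  TensorProduct.map ΔM.toLinearMap LinearMap.id ∘ₗ ΔM.toLinearMap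

/-- The co-orbit map associated to a point `e = ev_ξ` and a coaction `b`. -/
def coorbit {A : Type} [CommRing A] {M G : Type} [Ring M] [Algebra A M] [Ring G] [Algebra A G]
    (e : M →ₐ[A] A) (b : M →ₗ[A] M ⊗[A] G) : M →ₗ[A] G :=
  (TensorProduct.lid A G).toLinearMap ∘ₗ TensorProduct.map e.toLinearMap LinearMap.id ∘ₗ b

/-- The left coaction `λ_D = (π_D ⊗ id) ∘ Δ` of a quotient Hopf algebra. -/
def leftCoact {A : Type} [CommRing A] {G D : Type} [Ring G] [Algebra A G]
    [CommRing D] [Algebra A D]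
    (πD : G →ₐ[A] D) (ΔG : G →ₐ[A] G ⊗[A] G) : G →ₗ[A] D ⊗[A] G :=
  TensorProduct.map πD.toLinearMap LinearMap.id ∘ₗ ΔG.toLinearMap

/-- Coinvariants of the left coaction `λ_D`. -/
def dCoinv {A : Type} [CommRing A] {G D : Type} [Ring G] [Algebra A G]
    [CommRing D] [Algebra A D]
    (πD : G →ₐ[A] D) (ΔG : G →ₐ[A] G ⊗[A] G) : Set G :=
  {f : G | leftCoact πD ΔG f = (1 : D) ⊗ₜ[A] f}

/-- The right coaction `ρ_D = (id ⊗ π_D) ∘ Δ`. -/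
def rightCoact {A : Type} [CommRing A] {G D : Type} [Ring G] [Algebra A G]
    [CommRing D] [Algebra A D]
    (πD : G →ₐ[A] D) (ΔG : G →ₐ[A] G ⊗[A] G) : G →ₗ[A] G ⊗[A] D :=
  TensorProduct.map LinearMap.id πD.toLinearMap ∘ₗ ΔG.toLinearMap

/-- The weight space of weight `ta : D` for the grading induced by `ρ_D`. -/
def weightSpace' {A : Type} [CommRing A] {G D : Type} [Ring G] [Algebra A G]
    [CommRing D] [Algebra A D]
    (πD : G →ₐ[A] D) (ΔG : G →ₐ[A] G ⊗[A] G) (ta : D) : Submodule A G :=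
  LinearMap.ker (rightCoact πD ΔG - (TensorProduct.mk A G D).flip ta)

/-- The subcomodule generated by a subset `s` of the comodule `(M, b)`. -/
def comodGen {A : Type} [CommRing A] {M G : Type} [Ring M] [Algebra A M] [Ring G] [Algebra A G]
    (b : M →ₗ[A] M ⊗[A] G) (s : Set M) : Submodule A M :=
  sInf {W : Submodule A M | s ⊆ W ∧
    ∀ w ∈ W, b w ∈ LinearMap.range (TensorProduct.map W.subtype (LinearMap.id : G →ₗ[A] G))}

namespace QuantumOrbit

section LeadingTerms

/-- The `k`-th smallest element of `I`. -/
def nthElt {N : ℕ} (I : Finset (Fin N)) (k : Fin I.card) : Fin N := ((I.orderIsoOfFin rfl) k).1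

/-- Weights on the matrix entries for which antidiagonals of initial minors are leading terms. -/
def cellWt {N : ℕ} (p : Fin N × Fin N) : ℕ := 4 * N ^ 2 + 1 - (p.1.1 + p.2.1) ^ 2

/-- The additive weight of an exponent vector. -/
def monWt {N : ℕ} : (Fin N × Fin N →₀ ℕ) →+ ℕ := Finsupp.weight cellWt

/-- Cells of the antidiagonal of the initial `t × t` block. -/
def antiDiag (N t : ℕ) : Finset (Fin N × Fin N) :=
  Finset.univ.filter fun p => p.1.1 + p.2.1 + 1 = t

/-- The squarefree monomial supported on the antidiagonal of the initial `t × t` block. -/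
def antiMon (N t : ℕ) : Fin N × Fin N →₀ ℕ := ∑ p ∈ antiDiag N t, Finsupp.single p 1

/-- The exponent vector of the term of the principal minor on `I` indexed by `σ`. -/
def minorMon {N : ℕ} (I : Finset (Fin N)) (σ : Equiv.Perm (Fin I.card)) : Fin N × Fin N →₀ ℕ :=
  ∑ k, Finsupp.single (nthElt I k, nthElt I (σ k)) 1

/-- Exponent vectors not divisible by any of the antidiagonal monomials. -/
def stdMon (N : ℕ) : Set (Fin N × Fin N →₀ ℕ) :=
  {s | ∀ t, 1 ≤ t → t ≤ N → ¬ antiMon N t ≤ s}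

variable {N : ℕ}

lemma cellWt_cast (p : Fin N × Fin N) :
    (cellWt p : ℤ) = 4 * N ^ 2 + 1 - (p.1.1 + p.2.1 : ℤ) ^ 2 := by
  unfold cellWt
  have h1 := p.1.2
  have h2 := p.2.2
  have : (p.1.1 + p.2.1) ^ 2 ≤ 4 * N ^ 2 + 1 := by nlinarith
  push_cast [Nat.cast_sub this]
  ring

lemma cellWt_pos (p : Fin N × Fin N) : 0 < cellWt p := by
  unfold cellWt
  have h1 := p.1.2
  have h2 := p.2.2
  have : (p.1.1 + p.2.1) ^ 2 ≤ 4 * N ^ 2 := by nlinarith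
  omega

lemma nthElt_mem (I : Finset (Fin N)) (k : Fin I.card) : nthElt I k ∈ I :=
  ((I.orderIsoOfFin rfl) k).2

lemma nthElt_strictMono (I : Finset (Fin N)) : StrictMono (nthElt I) := fun _ _ h =>
  (I.orderIsoOfFin rfl).strictMono h

lemma exists_nthElt {I : Finset (Fin N)} {x : Fin N} (hx : x ∈ I) : ∃ k, nthElt I k = x :=
  ⟨(I.orderIsoOfFin rfl).symm ⟨x, hx⟩, by simp [nthElt]⟩

lemma le_nthElt (I : Finset (Fin N)) (k : Fin I.card) : k.1 ≤ (nthElt I k).1 := by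
  obtain ⟨k, hk⟩ := k
  induction k with
  | zero => exact Nat.zero_le _
  | succ n ih =>
    have h1 := ih (by omega)
    have h2 : nthElt I ⟨n, by omega⟩ < nthElt I ⟨n + 1, hk⟩ :=
      nthElt_strictMono I (by simp [Fin.lt_def])
    rw [Fin.lt_def] at h2
    simp only at h1 ⊢
    omega

lemma monWt_minorMon (I : Finset (Fin N)) (σ : Equiv.Perm (Fin I.card)) :
    (monWt (minorMon I σ) : ℤ) = I.card * (4 * N ^ 2 + 1)
      - ∑ k, ((nthElt I k).1 + (nthElt I (σ k)).1 : ℤ) ^ 2 := by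
  simp only [minorMon, monWt, map_sum, Finsupp.weight_single, one_smul, Nat.cast_sum, cellWt_cast]
  simp [Finset.sum_sub_distrib]

lemma sum_shift_sq (I : Finset (Fin N)) (σ : Equiv.Perm (Fin I.card)) :
    (I.card * (I.card - 1) ^ 2 : ℤ)
      + ∑ k, ((nthElt I k).1 + (nthElt I (σ k)).1 - (I.card - 1) : ℤ) ^ 2
      ≤ ∑ k, ((nthElt I k).1 + (nthElt I (σ k)).1 : ℤ) ^ 2 := by
  have h1 : ∑ k, ((nthElt I (σ k)).1 : ℤ) = ∑ k, ((nthElt I k).1 : ℤ) :=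
    Equiv.sum_comp σ (fun k => ((nthElt I k).1 : ℤ))
  have h2 : ∑ k : Fin I.card, (k.1 : ℤ) ≤ ∑ k, ((nthElt I k).1 : ℤ) :=
    Finset.sum_le_sum fun k _ => by exact_mod_cast le_nthElt I k
  have h3 : (2 * ∑ k : Fin I.card, (k.1 : ℤ)) = I.card * (I.card - 1) := by
    rw [Fin.sum_univ_eq_sum_range (fun k => (k : ℤ))]
    induction I.card with
    | zero => simp
    | succ n ih => rw [Finset.sum_range_succ, mul_add, ih]; push_cast; ring
  have h4 : ∑ k, ((nthElt I k).1 + (nthElt I (σ k)).1 - (I.card - 1) : ℤ) ^ 2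
      = ∑ k, ((nthElt I k).1 + (nthElt I (σ k)).1 : ℤ) ^ 2
        - 2 * (I.card - 1) * (∑ k, ((nthElt I k).1 : ℤ) + ∑ k, ((nthElt I (σ k)).1 : ℤ))
        + I.card * (I.card - 1) ^ 2 := by
    rw [← Finset.sum_add_distrib, Finset.mul_sum, ← Finset.sum_sub_distrib]
    have : (I.card * (I.card - 1) ^ 2 : ℤ) = ∑ _k : Fin I.card, (I.card - 1 : ℤ) ^ 2 := by simp
    rw [this, ← Finset.sum_add_distrib]
    exact Finset.sum_congr rfl fun k _ => by ring
  rw [h4, h1]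
  rcases Nat.eq_zero_or_pos I.card with h0 | h0
  · have : IsEmpty (Fin I.card) := by rw [h0]; infer_instance
    simp [h0]
  · have h5 : (1 : ℤ) ≤ I.card := by exact_mod_cast h0
    nlinarith

/-- The `t`-th sum of principal minors has a unique term of maximal weight. -/
lemma exists_leading_term {t : ℕ} (ht : t ≤ N) :
    ∃ (I₀ : Finset (Fin N)) (σ₀ : Equiv.Perm (Fin I₀.card)), I₀.card = t ∧
      minorMon I₀ σ₀ = antiMon N t ∧
      ∀ (I : Finset (Fin N)) (σ : Equiv.Perm (Fin I.card)), I.card = t →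
        (⟨I, σ⟩ : Σ I : Finset (Fin N), Equiv.Perm (Fin I.card)) ≠ ⟨I₀, σ₀⟩ →
        monWt (minorMon I σ) < monWt (antiMon N t) := by
  let I₀ : Finset (Fin N) := Finset.univ.filter fun i => i.1 < t
  have hI₀ : I₀.card = t := by
    rw [← Finset.card_map Fin.valEmbedding]
    have : I₀.map Fin.valEmbedding = Finset.range t := by
      ext a
      simp only [Finset.mem_map, I₀, Finset.mem_filter, Finset.mem_univ, true_and,
        Fin.valEmbedding_apply, Finset.mem_range]
      constructor
      · rintro ⟨b, hb, rfl⟩; exact hb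
      · intro h; exact ⟨⟨a, by omega⟩, h, rfl⟩
    rw [this, Finset.card_range]
  have hmem : ∀ x : Fin N, x ∈ I₀ ↔ x.1 < t := by intro x; simp [I₀]
  let r : I₀ ≃ I₀ := 
    { toFun := fun x => ⟨⟨t - 1 - x.1.1, by have := x.1.2; omega⟩, by
        have := (hmem _).1 x.2; rw [hmem]; simp only; omega⟩
      invFun := fun x => ⟨⟨t - 1 - x.1.1, by have := x.1.2; omega⟩, by
        have := (hmem _).1 x.2; rw [hmem]; simp only; omega⟩
      left_inv := fun x => by
        have := (hmem _).1 x.2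
        apply Subtype.ext; apply Fin.ext; simp only; omega
      right_inv := fun x => by
        have := (hmem _).1 x.2
        apply Subtype.ext; apply Fin.ext; simp only; omega }
  let e := (I₀.orderIsoOfFin rfl).toEquiv
  let σ₀ : Equiv.Perm (Fin I₀.card) := (e.trans r).trans e.symm
  have hσ₀ : ∀ k, (nthElt I₀ (σ₀ k)).1 + (nthElt I₀ k).1 + 1 = t := by
    intro k
    have h1 : nthElt I₀ (σ₀ k) = (r (e k)).1 := by
      simp only [nthElt, σ₀, Equiv.trans_apply]
      exact congrArg Subtype.val (e.apply_symm_apply (r (e k)))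
    have h2 := (hmem _).1 (nthElt_mem I₀ k)
    rw [h1]
    have h3 : ((r (e k)).1).1 = t - 1 - (nthElt I₀ k).1 := rfl
    omega
  have hmon : minorMon I₀ σ₀ = antiMon N t := by
    unfold minorMon antiMon
    refine Finset.sum_bij (fun k _ => (nthElt I₀ k, nthElt I₀ (σ₀ k))) ?_ ?_ ?_ ?_
    · intro k _
      have := hσ₀ k
      simp only [antiDiag, Finset.mem_filter, Finset.mem_univ, true_and]
      omega
    · intro a _ b _ h
      exact (nthElt_strictMono I₀).injective (Prod.ext_iff.1 h).1
    · intro p hp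
      simp only [antiDiag, Finset.mem_filter, Finset.mem_univ, true_and] at hp
      obtain ⟨k, hk⟩ := exists_nthElt ((hmem p.1).2 (by omega))
      refine ⟨k, Finset.mem_univ _, ?_⟩
      have := hσ₀ k
      refine Prod.ext hk (Fin.ext ?_)
      simp only
      rw [hk] at this
      omega
    · intro k _; rfl
  refine ⟨I₀, σ₀, hI₀, hmon, ?_⟩
  intro I σ hI hne
  by_contra hlt
  push Not at hlt
  have hw₀ := monWt_minorMon I₀ σ₀
  have hw := monWt_minorMon I σ
  have hs := sum_shift_sq I σ
  have hlt' : (monWt (minorMon I₀ σ₀) : ℤ) ≤ monWt (minorMon I σ) := by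
    rw [hmon]; exact_mod_cast hlt
  have hs₀ : ∑ k, ((nthElt I₀ k).1 + (nthElt I₀ (σ₀ k)).1 : ℤ) ^ 2 = t * (t - 1) ^ 2 := by
    have : ∀ k, ((nthElt I₀ k).1 + (nthElt I₀ (σ₀ k)).1 : ℤ) = t - 1 := by
      intro k
      have := hσ₀ k
      omega
    simp [this, hI₀]
  have hIz : (I.card : ℤ) = t := by exact_mod_cast hI
  rw [hw, hw₀, hs₀, hI₀, hIz] at hlt'
  simp only [hIz] at hs
  have hz : ∑ k, ((nthElt I k).1 + (nthElt I (σ k)).1 - (t - 1) : ℤ) ^ 2 = 0 :=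
    le_antisymm (by linarith) (Finset.sum_nonneg fun k _ => sq_nonneg _)
  rw [Finset.sum_eq_zero_iff_of_nonneg (fun k _ => sq_nonneg _)] at hz
  have hz' : ∀ k, (nthElt I k).1 + (nthElt I (σ k)).1 + 1 = t := by
    intro k
    have := hz k (Finset.mem_univ _)
    rw [sq_eq_zero_iff] at this
    omega
  have hII : I = I₀ := by
    refine Finset.eq_of_subset_of_card_le (fun x hx => ?_) (by omega)
    obtain ⟨k, rfl⟩ := exists_nthElt hx
    rw [hmem]
    have := hz' k
    omega
  subst hII
  apply hne
  congr 1
  ext k : 1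
  apply (nthElt_strictMono I₀).injective
  apply Fin.ext
  have := hz' k
  have := hσ₀ k
  omega

lemma antiMon_apply (t : ℕ) (p : Fin N × Fin N) :
    antiMon N t p = if p.1.1 + p.2.1 + 1 = t then 1 else 0 := by
  classical
  simp [antiMon, antiDiag, Finsupp.finsetSum_apply, Finsupp.single_apply]

lemma antiMon_le_iff (t : ℕ) (s : Fin N × Fin N →₀ ℕ) :
    antiMon N t ≤ s ↔ ∀ p : Fin N × Fin N, p.1.1 + p.2.1 + 1 = t → 1 ≤ s p := by
  rw [Finsupp.le_def]
  refine forall_congr' fun p => ?_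
  rw [antiMon_apply]
  split_ifs with h <;> simp [h]

lemma monWt_pos {s : Fin N × Fin N →₀ ℕ} (hs : s ≠ 0) : 0 < monWt s := by
  obtain ⟨p, hp⟩ := Finsupp.ne_iff.1 hs
  exact lt_of_lt_of_le (cellWt_pos p) (Finsupp.le_weight_of_ne_zero' cellWt hp)

lemma antiMon_ne_zero {t : ℕ} (h1 : 1 ≤ t) (ht : t ≤ N) : antiMon N t ≠ 0 := by
  intro h
  have := DFunLike.congr_fun h ((⟨t - 1, by omega⟩, ⟨0, by omega⟩) : Fin N × Fin N)
  rw [antiMon_apply, if_pos (by simp only; omega)] at this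
  simp at this

end LeadingTerms

section TriangularElimination

variable {N : ℕ}

/-- A synonym for exponent vectors, carrying a weighted lexicographic order. -/
def WtMon (N : ℕ) : Type := Fin N × Fin N →₀ ℕ

instance : AddCommMonoid (WtMon N) := inferInstanceAs (AddCommMonoid (Fin N × Fin N →₀ ℕ))

/-- The lexicographic monomial order on the matrix entries. -/
def lexEntries (N : ℕ) : MonomialOrder (Fin N × Fin N) :=
  let o : LinearOrder (Fin N × Fin N) := LinearOrder.lift' toLex toLex.injective
  @MonomialOrder.lex _ o (@Finite.to_wellFoundedGT _ _ o.toPreorder)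

instance : LinearOrder (WtMon N) :=
  LinearOrder.lift'
    (fun f : WtMon N => toLex (monWt (N := N) f, (lexEntries N).toSyn f)) (fun f g h => by
      have h1 := (Prod.ext_iff.1 (toLex.injective h)).2
      exact (lexEntries N).toSyn.injective h1)

lemma WtMon.lt_iff {a b : WtMon N} : a < b ↔ monWt (N := N) a < monWt (N := N) b ∨
    (monWt (N := N) a = monWt (N := N) b ∧ (lexEntries N).toSyn a < (lexEntries N).toSyn b) :=
  Prod.Lex.toLex_lt_toLex

lemma WtMon.le_iff {a b : WtMon N} : a ≤ b ↔ monWt (N := N) a < monWt (N := N) b ∨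
    (monWt (N := N) a = monWt (N := N) b ∧ (lexEntries N).toSyn a ≤ (lexEntries N).toSyn b) :=
  Prod.Lex.toLex_le_toLex

lemma WtMon.lex_add (a b : WtMon N) : (lexEntries N).toSyn (a + b : WtMon N)
    = (lexEntries N).toSyn a + (lexEntries N).toSyn b := map_add (lexEntries N).toSyn _ _

lemma WtMon.monWt_add (a b : WtMon N) : monWt (N := N) (a + b : WtMon N)
    = monWt (N := N) a + monWt (N := N) b := map_add monWt _ _

instance : IsOrderedAddMonoid (WtMon N) where
  add_le_add_left a b h c := by
    rw [WtMon.le_iff] at h ⊢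
    simp only [WtMon.lex_add, WtMon.monWt_add]
    rcases h with h | ⟨h, h'⟩
    · left; omega
    · right; exact ⟨by omega, add_le_add_left h' _⟩

instance : WellFoundedLT (WtMon N) where
  wf := by
    have h : WellFounded (fun a b : ℕ ×ₗ (lexEntries N).syn => a < b) := wellFounded_lt
    exact InvImage.wf
      (fun f : WtMon N => toLex (monWt (N := N) f, (lexEntries N).toSyn f)) h

/-- A monomial order refining the weight. -/
def wtOrder (N : ℕ) : MonomialOrder (Fin N × Fin N) where
  syn := WtMon N
  toSyn := AddEquiv.refl _
  toSyn_monotone := fun a b h => by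
    obtain ⟨c, rfl⟩ := exists_add_of_le h
    have h1 : monWt (a + c) = monWt a + monWt c := map_add _ _ _
    refine WtMon.le_iff.2 ?_
    change monWt a < monWt (a + c) ∨ (monWt a = monWt (a + c) ∧
      (lexEntries N).toSyn a ≤ (lexEntries N).toSyn (a + c))
    rcases Nat.eq_zero_or_pos (monWt c) with h0 | h0
    · right
      exact ⟨by omega, (lexEntries N).toSyn_monotone le_self_add⟩
    · left; omega

lemma wtOrder_lt_of_monWt_lt {a b : Fin N × Fin N →₀ ℕ} (h : monWt a < monWt b) :
    (wtOrder N).toSyn a < (wtOrder N).toSyn b := WtMon.lt_iff.2 (Or.inl h)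

lemma antiDiag_nonempty (i : Fin N) : (antiDiag N (i.1 + 1)).Nonempty :=
  ⟨(i, ⟨0, by have := i.2; omega⟩), by simp [antiDiag]⟩

/-- The multiplicity of the `i`-th antidiagonal monomial in a monomial. -/
def antiMult (m : Fin N × Fin N →₀ ℕ) (i : Fin N) : ℕ :=
  (antiDiag N (i.1 + 1)).inf' (antiDiag_nonempty i) m

/-- The product of the antidiagonal monomials dividing `m`, with multiplicity. -/
def antiPart (m : Fin N × Fin N →₀ ℕ) : Fin N × Fin N →₀ ℕ :=
  ∑ i : Fin N, antiMult m i • antiMon N (i.1 + 1)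

lemma antiPart_le (m : Fin N × Fin N →₀ ℕ) : antiPart m ≤ m := by
  intro p
  simp only [antiPart, Finsupp.finsetSum_apply, Finsupp.smul_apply, antiMon_apply, smul_eq_mul,
    mul_ite, mul_one, mul_zero]
  by_cases hp : p.1.1 + p.2.1 < N
  · rw [Finset.sum_eq_single ⟨p.1.1 + p.2.1, hp⟩]
    · rw [if_pos rfl]
      exact Finset.inf'_le _ (by simp [antiDiag])
    · intro j _ hj
      rw [if_neg]
      intro h
      apply hj
      apply Fin.ext
      simp only
      omega
    · simp
  · rw [Finset.sum_eq_zero]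
    · exact Nat.zero_le _
    · intro j _
      rw [if_neg]
      have := j.2
      omega

lemma antiMult_add (m : Fin N × Fin N →₀ ℕ) (i j : Fin N) :
    antiMult (m + antiMon N (i.1 + 1)) j = antiMult m j + if i = j then 1 else 0 := by
  unfold antiMult
  have h : ∀ p ∈ antiDiag N (j.1 + 1),
      (m + antiMon N (i.1 + 1)) p = m p + if i = j then 1 else 0 := by
    intro p hp
    simp only [antiDiag, Finset.mem_filter, Finset.mem_univ, true_and] at hp
    simp only [Finsupp.add_apply, antiMon_apply, hp, Fin.ext_iff, add_left_inj,
      eq_comm (a := j.1)]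
  apply le_antisymm
  · obtain ⟨p, hp, h1⟩ := Finset.exists_mem_eq_inf' (antiDiag_nonempty j) m
    rw [h1, ← h p hp]
    exact Finset.inf'_le _ hp
  · refine Finset.le_inf' _ _ fun p hp => ?_
    rw [h p hp]
    exact Nat.add_le_add_right (Finset.inf'_le _ hp) _

lemma antiPart_add (m : Fin N × Fin N →₀ ℕ) (i : Fin N) :
    antiPart (m + antiMon N (i.1 + 1)) = antiPart m + antiMon N (i.1 + 1) := by
  simp only [antiPart, antiMult_add, add_smul, Finset.sum_add_distrib]
  congr 1
  rw [Finset.sum_eq_single i] <;> simp +contextual [eq_comm]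

open MvPolynomial

variable {k : Type} [Field k]

/-- Replace antidiagonal monomials by polynomials having them as leading terms. -/
def triSubst (c : Fin N → MvPolynomial (Fin N × Fin N) k) (m : Fin N × Fin N →₀ ℕ) :
    MvPolynomial (Fin N × Fin N) k :=
  monomial (m - antiPart m) 1 * ∏ i, c i ^ antiMult m i

lemma mul_triSubst (c : Fin N → MvPolynomial (Fin N × Fin N) k) (m : Fin N × Fin N →₀ ℕ)
    (i : Fin N) : c i * triSubst c m = triSubst c (m + antiMon N (i.1 + 1)) := by
  simp only [triSubst, antiPart_add, antiMult_add, pow_add, Finset.prod_mul_distrib,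
    add_tsub_add_eq_tsub_right]
  rw [Finset.prod_eq_single (s := Finset.univ) (f := fun j => c j ^ if i = j then 1 else 0) i]
  · simp; ring
  · intro j _ hj
    simp [Ne.symm hj]
  · simp

section
variable {c : Fin N → MvPolynomial (Fin N × Fin N) k}

lemma triSubst_ne_zero (hc0 : ∀ i, c i ≠ 0) (m : Fin N × Fin N →₀ ℕ) :
    triSubst c m ≠ 0 :=
  mul_ne_zero (by simp) (Finset.prod_ne_zero_iff.2 fun i _ => pow_ne_zero _ (hc0 i))

lemma degree_triSubst (hc0 : ∀ i, c i ≠ 0)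
    (hdeg : ∀ i : Fin N, (wtOrder N).degree (c i) = antiMon N (i.1 + 1))
    (m : Fin N × Fin N →₀ ℕ) : (wtOrder N).degree (triSubst c m) = m := by
  classical
  rw [triSubst, (wtOrder N).degree_mul (by simp)
    (Finset.prod_ne_zero_iff.2 fun i _ => pow_ne_zero _ (hc0 i)),
    (wtOrder N).degree_prod fun i _ => pow_ne_zero _ (hc0 i)]
  simp only [(wtOrder N).degree_pow, hdeg, (wtOrder N).degree_monomial]
  simp only [one_ne_zero, if_false]
  exact tsub_add_cancel_of_le (antiPart_le m)

lemma mem_span_triSubst (hc0 : ∀ i, c i ≠ 0)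
    (hdeg : ∀ i : Fin N, (wtOrder N).degree (c i) = antiMon N (i.1 + 1))
    (f : MvPolynomial (Fin N × Fin N) k) :
    f ∈ Submodule.span k (Set.range (triSubst c)) := by
  classical
  have key : ∀ (d : (wtOrder N).syn) (f : MvPolynomial (Fin N × Fin N) k),
      (wtOrder N).toSyn ((wtOrder N).degree f) = d →
      f ∈ Submodule.span k (Set.range (triSubst c)) := by
    intro d
    induction d using WellFoundedLT.induction with
    | ind d ih =>
    intro f hf
    by_cases hf0 : f = 0
    · rw [hf0]; exact zero_mem _
    set m := (wtOrder N).degree f with hm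
    have hl := (wtOrder N).leadingCoeff_ne_zero_iff.2 (triSubst_ne_zero hc0 m)
    set a := (wtOrder N).leadingCoeff f / (wtOrder N).leadingCoeff (triSubst c m) with ha
    have hmem : a • triSubst c m ∈ Submodule.span k (Set.range (triSubst c)) :=
      Submodule.smul_mem _ _ (Submodule.subset_span ⟨m, rfl⟩)
    have hsub : f - a • triSubst c m ∈ Submodule.span k (Set.range (triSubst c)) := by
      by_cases h0 : f - a • triSubst c m = 0
      · rw [h0]; exact zero_mem _
      refine ih _ ?_ _ rfl
      rw [← hf]
      refine lt_of_le_of_ne ?_ ?_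
      · refine ((wtOrder N).degree_sub_le).trans (sup_le le_rfl ?_)
        refine ((wtOrder N).degree_smul_le).trans ?_
        rw [degree_triSubst hc0 hdeg]
      · intro he
        have he' := (wtOrder N).toSyn.injective he
        have h1 := (wtOrder N).coeff_degree_ne_zero_iff.2 h0
        rw [he', coeff_sub, coeff_smul] at h1
        apply h1
        have h2 : coeff m (triSubst c m) = (wtOrder N).leadingCoeff (triSubst c m) := by
          rw [MonomialOrder.leadingCoeff, degree_triSubst hc0 hdeg]
        rw [h2, ha, smul_eq_mul, div_mul_cancel₀ _ hl]
        exact sub_self _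
    have := add_mem hsub hmem
    rwa [sub_add_cancel] at this
  exact key _ f rfl

lemma degree_sum_triSubst (hc0 : ∀ i, c i ≠ 0)
    (hdeg : ∀ i : Fin N, (wtOrder N).degree (c i) = antiMon N (i.1 + 1))
    (g : (Fin N × Fin N →₀ ℕ) →₀ k) (hg : g ≠ 0) :
    ∃ m ∈ g.support, (wtOrder N).degree (g.sum fun m a => a • triSubst c m) = m := by
  classical
  obtain ⟨m, hm, hmax⟩ := g.support.exists_max_image (fun m => (wtOrder N).toSyn m)
    (Finsupp.support_nonempty_iff.2 hg)
  refine ⟨m, hm, ?_⟩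
  have hcoef : coeff m (g.sum fun m a => a • triSubst c m) ≠ 0 := by
    rw [Finsupp.sum, coeff_sum, Finset.sum_eq_single m]
    · rw [coeff_smul, smul_eq_mul]
      refine mul_ne_zero (Finsupp.mem_support_iff.1 hm) ?_
      have := (wtOrder N).leadingCoeff_ne_zero_iff.2 (triSubst_ne_zero hc0 m)
      rwa [MonomialOrder.leadingCoeff, degree_triSubst hc0 hdeg] at this
    · intro m' hm' hne
      rw [coeff_smul, (wtOrder N).coeff_eq_zero_of_lt, smul_zero]
      rw [degree_triSubst hc0 hdeg]
      exact lt_of_le_of_ne (hmax m' hm') fun h => hne ((wtOrder N).toSyn.injective h)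
    · intro h; exact absurd hm h
  apply (wtOrder N).toSyn.injective
  apply le_antisymm
  · refine ((wtOrder N).degree_sum_le).trans (Finset.sup_le fun m' hm' => ?_)
    refine ((wtOrder N).degree_smul_le).trans ?_
    rw [degree_triSubst hc0 hdeg]
    exact hmax m' hm'
  · exact (wtOrder N).le_degree (mem_support_iff.2 hcoef)

/-- The leading monomial of a nonzero element of the ideal generated by `c` is divisible by an
antidiagonal monomial. -/
lemma degree_notMem_stdMon (hc0 : ∀ i, c i ≠ 0)
    (hdeg : ∀ i : Fin N, (wtOrder N).degree (c i) = antiMon N (i.1 + 1))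
    {f : MvPolynomial (Fin N × Fin N) k} (hf : f ≠ 0)
    (hmem : f ∈ Ideal.span (Set.range c)) : (wtOrder N).degree f ∉ stdMon N := by
  have h1 : f ∈ Submodule.span k (triSubst c '' (stdMon N)ᶜ) := by
    have h2 : ∀ (i : Fin N) (a : MvPolynomial (Fin N × Fin N) k),
        a * c i ∈ Submodule.span k (triSubst c '' (stdMon N)ᶜ) := by
      intro i a
      induction mem_span_triSubst hc0 hdeg a using Submodule.span_induction with
      | mem x hx =>
        obtain ⟨m, rfl⟩ := hx
        rw [mul_comm, mul_triSubst]
        exact Submodule.subset_span ⟨_, fun h => h (i.1 + 1) (by omega) i.2 le_add_self, rfl⟩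
      | zero => simp
      | add x y _ _ hx hy => rw [add_mul]; exact add_mem hx hy
      | smul r x _ hx => rw [smul_mul_assoc]; exact Submodule.smul_mem _ _ hx
    obtain ⟨a, rfl⟩ := Submodule.mem_span_range_iff_exists_fun _ |>.1 hmem
    exact sum_mem fun i _ => h2 i (a i)
  rw [Finsupp.mem_span_image_iff_linearCombination] at h1
  obtain ⟨g, hg, rfl⟩ := h1
  have hg0 : g ≠ 0 := by
    rintro rfl
    simp at hf
  obtain ⟨m, hm, hd⟩ := degree_sum_triSubst hc0 hdeg g hg0
  rw [Finsupp.linearCombination_apply, hd]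
  exact hg hm

/-- A polynomial supported on `stdMon` which is nilpotent modulo the ideal vanishes. -/
lemma eq_zero_of_pow_mem (hc0 : ∀ i, c i ≠ 0)
    (hdeg : ∀ i : Fin N, (wtOrder N).degree (c i) = antiMon N (i.1 + 1))
    {f : MvPolynomial (Fin N × Fin N) k}
    (hs : ∀ m ∈ f.support, m ∈ stdMon N) {n : ℕ}
    (hmem : f ^ n ∈ Ideal.span (Set.range c)) : f = 0 := by
  by_contra hf
  apply degree_notMem_stdMon hc0 hdeg (pow_ne_zero n hf) hmem
  rw [(wtOrder N).degree_pow]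
  intro t h1 h2 hle
  refine hs _ ((wtOrder N).degree_mem_support hf) t h1 h2 ?_
  rw [antiMon_le_iff] at hle ⊢
  intro p hp
  have := hle p hp
  rw [Finsupp.smul_apply, smul_eq_mul] at this
  exact Nat.pos_of_ne_zero fun h => by rw [h] at this; omega

end

end TriangularElimination

section CoefficientPolynomials

variable {N : ℕ}

lemma sign_eq_invCount {t : ℕ} (σ : Equiv.Perm (Fin t)) :
    Equiv.Perm.sign σ = (-1) ^ invCount σ := by
  rw [Equiv.Perm.sign_eq_prod_prod_Iio, invCount, ← Finset.prod_const, Finset.prod_filter,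
    ← Finset.univ_product_univ, Finset.prod_product_right]
  refine Finset.prod_congr rfl fun j _ => ?_
  rw [← Finset.filter_gt_eq_Iio, Finset.prod_filter]
  refine Finset.prod_congr rfl fun i _ => ?_
  by_cases h : i < j
  · simp only [h, if_true, true_and]
    rcases lt_trichotomy (σ i) (σ j) with h1 | h1 | h1
    · simp [h1, h1.not_gt]
    · exact absurd (σ.injective h1) h.ne
    · simp [h1, h1.not_gt]
  · simp [h]

/-- The ordered product of entries in the term of the principal minor on `I` indexed by `σ`. -/
def minorProd {M : Type} [Ring M] (x : Fin N → Fin N → M) (I : Finset (Fin N))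
    (σ : Equiv.Perm (Fin I.card)) : M :=
  ((List.finRange I.card).map fun k => x (nthElt I k) (nthElt I (σ k))).prod

/-- Index set of the terms of `τ_t`. -/
def minorTerms (N t : ℕ) : Finset (Σ I : Finset (Fin N), Equiv.Perm (Fin I.card)) :=
  (Finset.univ.filter fun I : Finset (Fin N) => I.card = t).sigma fun _ => Finset.univ

lemma mem_minorTerms {t : ℕ} {P : Σ I : Finset (Fin N), Equiv.Perm (Fin I.card)} :
    P ∈ minorTerms N t ↔ P.1.card = t := by
  simp [minorTerms]

lemma tauCoinv_eq_sum {A : Type} [CommRing A] {M : Type} [Ring M] [Algebra A M]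
    (q qinv : A) (x : Fin N → Fin N → M) (t : ℕ) :
    tauCoinv q qinv x t = ∑ P ∈ minorTerms N t,
      (qinv ^ (2 * wtSet P.1) * (-q) ^ invCount P.2) • minorProd x P.1 P.2 := by
  rw [minorTerms, Finset.sum_sigma]
  unfold tauCoinv qMinor
  refine Finset.sum_congr rfl fun I _ => ?_
  rw [Finset.smul_sum]
  refine Finset.sum_congr rfl fun σ _ => ?_
  rw [smul_smul]
  rfl

/-- At `q = 1` and for commuting entries, `τ_t` is the sum of the principal minors. -/
lemma tauCoinv_one_eq {k L : Type} [CommRing k] [CommRing L] [Algebra k L]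
    (B : Matrix (Fin N) (Fin N) L) (t : ℕ) :
    tauCoinv (1 : k) (1 : k) (fun i j => B i j) t = ∑ s ∈ Finset.univ.powersetCard t,
      (B.submatrix (Subtype.val : s → Fin N) (Subtype.val : s → Fin N)).det := by
  rw [tauCoinv_eq_sum, minorTerms, Finset.sum_sigma,
    Finset.powersetCard_eq_filter, Finset.powerset_univ]
  refine Finset.sum_congr rfl fun I _ => ?_
  rw [← Matrix.det_submatrix_equiv_self (I.orderIsoOfFin rfl).toEquiv, ← Matrix.det_transpose,
    Matrix.det_apply]
  refine Finset.sum_congr rfl fun σ _ => ?_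
  rw [sign_eq_invCount, minorProd, ← Fin.prod_univ_def]
  simp [nthElt, Units.smul_def, Algebra.smul_def]

lemma charpoly_eq_of_tauCoinv_eq {k L : Type} [CommRing k] [CommRing L] [Algebra k L]
    {A B : Matrix (Fin N) (Fin N) L}
    (h : ∀ i : Fin N, tauCoinv (1 : k) (1 : k) (fun i j => A i j) (i.1 + 1)
      = tauCoinv (1 : k) (1 : k) (fun i j => B i j) (i.1 + 1)) : A.charpoly = B.charpoly := by
  nontriviality L
  ext n
  by_cases hn : n ≤ N
  · have h1 := A.charpoly_coeff_eq_sum_minors (N - n) (by simp)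
    have h2 := B.charpoly_coeff_eq_sum_minors (N - n) (by simp)
    rw [Fintype.card_fin, Nat.sub_sub_self hn, ← tauCoinv_one_eq (k := k)] at h1 h2
    rw [h1, h2]
    rcases Nat.eq_zero_or_pos (N - n) with h0 | h0
    · rw [h0, tauCoinv_one_eq, tauCoinv_one_eq]
      simp
    · have := h ⟨N - n - 1, by omega⟩
      simp only [Nat.sub_add_cancel h0] at this
      rw [this]
  · rw [Polynomial.coeff_eq_zero_of_natDegree_lt, Polynomial.coeff_eq_zero_of_natDegree_lt]
    · rw [Matrix.charpoly_natDegree_eq_dim, Fintype.card_fin]; omega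
    · rw [Matrix.charpoly_natDegree_eq_dim, Fintype.card_fin]; omega

open MvPolynomial

lemma map_minorProd {M M' G : Type} [Ring M] [Ring M'] [FunLike G M M'] [MonoidHomClass G M M']
    (f : G) (x : Fin N → Fin N → M) (I : Finset (Fin N)) (σ : Equiv.Perm (Fin I.card)) :
    f (minorProd x I σ) = minorProd (fun i j => f (x i j)) I σ := by
  simp [minorProd, map_list_prod, Function.comp_def]

lemma minorProd_X {k : Type} [Field k] (I : Finset (Fin N)) (σ : Equiv.Perm (Fin I.card)) :
    minorProd (fun i j => (X (i, j) : MvPolynomial (Fin N × Fin N) k)) I σ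
      = monomial (minorMon I σ) 1 := by
  rw [minorProd, ← Fin.prod_univ_def, minorMon]
  simp only [X]
  rw [monomial_sum_one]

lemma degree_tau_sub_C {k : Type} [Field k] (a : k) (i : Fin N) :
    tauCoinv (1 : k) (1 : k) (fun i j => (X (i, j) : MvPolynomial (Fin N × Fin N) k)) (i.1 + 1)
      - C a ≠ 0 ∧
    (wtOrder N).degree (tauCoinv (1 : k) (1 : k)
      (fun i j => (X (i, j) : MvPolynomial (Fin N × Fin N) k)) (i.1 + 1) - C a)
      = antiMon N (i.1 + 1) := by
  classical
  obtain ⟨I₀, σ₀, hI₀, hm, hlt⟩ := exists_leading_term (N := N) (t := i.1 + 1) i.2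
  set f := tauCoinv (1 : k) (1 : k) (fun i j => (X (i, j) : MvPolynomial (Fin N × Fin N) k))
    (i.1 + 1) - C a with hf
  have hcoef : coeff (antiMon N (i.1 + 1)) f ≠ 0 := by
    rw [hf, coeff_sub, coeff_C, if_neg (antiMon_ne_zero (by omega) i.2).symm, sub_zero,
      tauCoinv_eq_sum, coeff_sum, Finset.sum_eq_single ⟨I₀, σ₀⟩]
    · rw [minorProd_X, hm]
      simp
    · intro P hP hne
      rw [minorProd_X, coeff_smul, coeff_monomial, if_neg, smul_zero]
      intro h
      have := hlt P.1 P.2 (mem_minorTerms.1 hP) hne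
      rw [h] at this
      exact lt_irrefl _ this
    · intro h
      exact absurd (mem_minorTerms.2 hI₀) h
  have hf0 : f ≠ 0 := by
    intro h; rw [h] at hcoef; simp at hcoef
  refine ⟨hf0, ?_⟩
  apply (wtOrder N).toSyn.injective
  apply le_antisymm
  · rw [hf]
    refine ((wtOrder N).degree_sub_le).trans (sup_le ?_ ?_)
    · rw [tauCoinv_eq_sum]
      refine ((wtOrder N).degree_sum_le).trans (Finset.sup_le fun P hP => ?_)
      refine ((wtOrder N).degree_smul_le).trans ?_
      rw [minorProd_X]
      refine ((wtOrder N).degree_monomial_le _).trans ?_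
      by_cases hne : P = ⟨I₀, σ₀⟩
      · subst hne
        rw [hm]
      · exact (wtOrder_lt_of_monWt_lt (hlt P.1 P.2 (mem_minorTerms.1 hP) hne)).le
    · rw [(wtOrder N).degree_C, map_zero]
      exact (wtOrder N).zero_le _
  · exact (wtOrder N).le_degree (mem_support_iff.2 hcoef)

end CoefficientPolynomials

section Krylov

variable {N : ℕ} {R : Type} [CommRing R]

/-- The matrix whose columns are `v, Av, A²v, …`. -/
def krylov (A : Matrix (Fin N) (Fin N) R) (v : Fin N → R) : Matrix (Fin N) (Fin N) R :=
  Matrix.of fun i j => ((A ^ j.1).mulVec v) i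

/-- The companion matrix of a polynomial of degree `N`. -/
def compMat (N : ℕ) (p : Polynomial R) : Matrix (Fin N) (Fin N) R :=
  Matrix.of fun i j => if j.1 + 1 = N then -p.coeff i.1 else if i.1 = j.1 + 1 then 1 else 0

lemma mul_krylov (A : Matrix (Fin N) (Fin N) R) (v : Fin N → R) :
    A * krylov A v = krylov A v * compMat N A.charpoly := by
  nontriviality R
  have hcol : ∀ i j, (A * krylov A v) i j = ((A ^ (j.1 + 1)).mulVec v) i := by
    intro i j
    rw [pow_succ', ← Matrix.mulVec_mulVec]
    rfl
  ext i j
  rw [hcol, Matrix.mul_apply]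
  by_cases hj : j.1 + 1 = N
  · have h0 := A.aeval_self_charpoly
    rw [Polynomial.aeval_eq_sum_range, A.charpoly_natDegree_eq_dim, Fintype.card_fin,
      Finset.sum_range_succ] at h0
    have h1 : A.charpoly.coeff N = 1 := by
      have := A.charpoly_monic
      rwa [Polynomial.Monic, Polynomial.leadingCoeff, A.charpoly_natDegree_eq_dim,
        Fintype.card_fin] at this
    rw [h1, one_smul] at h0
    rw [hj, eq_neg_of_add_eq_zero_right h0, Matrix.neg_mulVec, Matrix.sum_mulVec]
    simp only [compMat, krylov, Matrix.of_apply, hj, if_true, Pi.neg_apply, Finset.sum_apply,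
      Matrix.smul_mulVec, Pi.smul_apply, smul_eq_mul]
    rw [← Finset.sum_neg_distrib, Finset.sum_range]
    exact Finset.sum_congr rfl fun k _ => by ring
  · have hj' : j.1 + 1 < N := by omega
    rw [Finset.sum_eq_single ⟨j.1 + 1, hj'⟩]
    · simp [compMat, krylov, hj]
    · intro k _ hk
      have : k.1 ≠ j.1 + 1 := fun h => hk (Fin.ext h)
      simp [compMat, hj, this]
    · simp

lemma map_krylov {S : Type} [CommRing S] (f : R →+* S) (A : Matrix (Fin N) (Fin N) R)
    (v : Fin N → R) : (krylov A v).map f = krylov (A.map f) (f ∘ v) := by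
  ext i j
  simp only [krylov, Matrix.map_apply, Matrix.of_apply, Matrix.mulVec, dotProduct, map_sum,
    map_mul, Function.comp_apply]
  have h : (A.map f) ^ j.1 = (A ^ j.1).map f := ((f.mapMatrix).map_pow A j.1).symm
  rw [h]
  simp

variable {L : Type} [Field L]

/-- Two matrices with cyclic vectors and the same characteristic polynomial are conjugate. -/
lemma exists_conj_of_krylov {A B : Matrix (Fin N) (Fin N) L} {v w : Fin N → L}
    (hA : (krylov A v).det ≠ 0) (hB : (krylov B w).det ≠ 0) (h : A.charpoly = B.charpoly) :
    ∃ g : Matrix (Fin N) (Fin N) L, g.det ≠ 0 ∧ B = g⁻¹ * A * g := by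
  set P := krylov A v
  set Q := krylov B w
  have h1 : A * P = P * compMat N A.charpoly := mul_krylov A v
  have h2 : B * Q = Q * compMat N A.charpoly := by rw [h]; exact mul_krylov B w
  have hP : IsUnit P.det := isUnit_iff_ne_zero.2 hA
  have hQ : IsUnit Q.det := isUnit_iff_ne_zero.2 hB
  refine ⟨P * Q⁻¹, ?_, ?_⟩
  · rw [Matrix.det_mul, Matrix.det_nonsing_inv]
    exact mul_ne_zero hA (by simpa using hB)
  · rw [Matrix.mul_inv_rev, Matrix.nonsing_inv_nonsing_inv _ hQ]
    have h3 : compMat N A.charpoly = P⁻¹ * (A * P) := by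
      rw [h1, Matrix.nonsing_inv_mul_cancel_left _ _ hP]
    calc B = B * Q * Q⁻¹ := by rw [Matrix.mul_nonsing_inv_cancel_right _ _ hQ]
      _ = Q * P⁻¹ * A * (P * Q⁻¹) := by rw [h2, h3]; simp only [Matrix.mul_assoc]

/-- Every endomorphism over an algebraically closed field is triangularizable. -/
lemma exists_triangular_basis [IsAlgClosed L] (n : ℕ) :
    ∀ (V : Type) [AddCommGroup V] [Module L V] [FiniteDimensional L V] (f : V →ₗ[L] V),
      Module.finrank L V = n → ∃ b : Module.Basis (Fin n) L V, ∀ i j, i < j →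
        b.repr (f (b j)) i = 0 := by
  induction n with
  | zero =>
    intro V _ _ _ f h
    exact ⟨Module.finBasisOfFinrankEq L V h, fun i => i.elim0⟩
  | succ n ih =>
    intro V _ _ _ f h
    have hnt : Nontrivial V := Module.nontrivial_of_finrank_pos (R := L) (by omega)
    have hnt' : Nontrivial (Module.Dual L V) := inferInstance
    obtain ⟨μ, hμ⟩ := Module.End.exists_eigenvalue (K := L) (V := Module.Dual L V) f.dualMap
    obtain ⟨φ, hφ⟩ := hμ.exists_hasEigenvector
    have hφ0 : φ ≠ 0 := hφ.2
    have hφf : ∀ x, φ (f x) = μ * φ x := fun x => by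
      have := hφ.apply_eq_smul
      exact DFunLike.congr_fun this x
    obtain ⟨y, hy⟩ : ∃ y, φ y ≠ 0 := by
      by_contra hcon
      push Not at hcon
      exact hφ0 (LinearMap.ext hcon)
    have hinv : ∀ x ∈ LinearMap.ker φ, f x ∈ LinearMap.ker φ := fun x hx => by
      rw [LinearMap.mem_ker] at hx ⊢
      rw [hφf, hx, mul_zero]
    have hdim : Module.finrank L (LinearMap.ker φ) = n := by
      have h1 := φ.finrank_range_add_finrank_ker
      have h2 : LinearMap.range φ = ⊤ := LinearMap.range_eq_top.2 (LinearMap.surjective hφ0)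
      rw [h2, finrank_top, Module.finrank_self, h] at h1
      omega
    obtain ⟨b, hb⟩ := ih (LinearMap.ker φ) (f.restrict hinv) hdim
    let b' := Module.Basis.mkFinCons (N := LinearMap.ker φ) y b
      (fun c x hx hc => by
        have := congrArg φ hc
        rw [map_add, map_smul, LinearMap.mem_ker.1 hx, add_zero, map_zero, smul_eq_mul] at this
        exact (mul_eq_zero.1 this).resolve_right hy)
      (fun z => ⟨-(φ z / φ y), by
        rw [LinearMap.mem_ker, map_add, map_smul, smul_eq_mul]
        field_simp
        ring⟩)
    have hb0 : b' 0 = y := by simp [b', Module.Basis.coe_mkFinCons]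
    have hbs : ∀ i, b' (Fin.succ i) = b i := fun i => by simp [b', Module.Basis.coe_mkFinCons]
    have hrepr : ∀ x : LinearMap.ker φ, b'.repr x = 
        Finsupp.mapDomain Fin.succ (b.repr x) := by
      intro x
      apply b'.repr.symm.injective
      rw [LinearEquiv.symm_apply_apply, Module.Basis.repr_symm_apply,
        Finsupp.linearCombination_mapDomain]
      conv_lhs => rw [← b.linearCombination_repr x]
      rw [Finsupp.linearCombination_apply, Finsupp.linearCombination_apply, Finsupp.sum,
        Finsupp.sum, Submodule.coe_sum]
      exact Finset.sum_congr rfl fun i _ => by simp [hbs]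
    refine ⟨b', fun i j hij => ?_⟩
    obtain ⟨j, rfl⟩ := Fin.exists_succ_eq.2 (Fin.ne_zero_of_lt hij)
    have h3 : f (b' j.succ) = (f.restrict hinv (b j) : LinearMap.ker φ) := by
      rw [hbs]; rfl
    rw [h3, hrepr]
    rcases Fin.eq_zero_or_eq_succ i with rfl | ⟨i, rfl⟩
    · exact Finsupp.mapDomain_of_notMem_range _ _ (by rintro ⟨k, hk⟩; exact Fin.succ_ne_zero k hk)
    · rw [Finsupp.mapDomain_apply (Fin.succ_injective n)]
      exact hb i j (Fin.succ_lt_succ_iff.1 hij)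

lemma exists_conj_triangular [IsAlgClosed L] (B : Matrix (Fin N) (Fin N) L) :
    ∃ U T : Matrix (Fin N) (Fin N) L, U.det ≠ 0 ∧ B = U⁻¹ * T * U ∧ ∀ i j, i < j → T i j = 0 := by
  obtain ⟨b, hb⟩ := exists_triangular_basis N (Fin N → L) (Matrix.toLin' B) (by simp)
  refine ⟨b.toMatrix (Pi.basisFun L (Fin N)), LinearMap.toMatrix b b (Matrix.toLin' B), ?_, ?_, ?_⟩
  · intro h0
    have := congrArg Matrix.det (b.toMatrix_mul_toMatrix_flip (Pi.basisFun L (Fin N)))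
    rw [Matrix.det_mul, h0, zero_mul, Matrix.det_one] at this
    exact zero_ne_one this
  · rw [Matrix.inv_eq_left_inv ((Pi.basisFun L (Fin N)).toMatrix_mul_toMatrix_flip b),
      basis_toMatrix_mul_linearMap_toMatrix_mul_basis_toMatrix]
    exact (LinearMap.toMatrix'_toLin' B).symm
  · intro i j hij
    rw [LinearMap.toMatrix_apply]
    exact hb i j hij

lemma charpoly_of_lowerTriangular {T : Matrix (Fin N) (Fin N) R} (h : ∀ i j, i < j → T i j = 0) :
    T.charpoly = ∏ i, (Polynomial.X - Polynomial.C (T i i)) := by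
  rw [← Matrix.charpoly_transpose, Matrix.charpoly_of_isUpperTriangular]
  · rfl
  · intro i j hij
    exact h j i hij

end Krylov

section Cyclic

open Polynomial

variable {K : Type} [Field K] {V : Type} [AddCommGroup V] [Module K V]

/-- The linear map sending coefficients to the combination of `w, fw, f²w, …`. -/
def iterComb (f : Module.End K V) (n : ℕ) (w : V) : (Fin n → K) →ₗ[K] V :=
  ∑ i : Fin n, (LinearMap.proj i : (Fin n → K) →ₗ[K] K).smulRight ((f ^ i.1) w)

/-- The polynomial with given low-degree coefficients. -/
def coefPoly {n : ℕ} (c : Fin n → K) : K[X] := ∑ i : Fin n, C (c i) * X ^ i.1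

lemma iterComb_apply (f : Module.End K V) (n : ℕ) (w : V) (c : Fin n → K) :
    iterComb f n w c = aeval f (coefPoly c) w := by
  simp [iterComb, coefPoly, LinearMap.sum_apply]

variable [FiniteDimensional K V]

lemma coeff_coefPoly {n : ℕ} (c : Fin n → K) (i : Fin n) : (coefPoly c).coeff i.1 = c i := by
  simp only [coefPoly, finsetSum_coeff, coeff_C_mul, coeff_X_pow]
  rw [Finset.sum_eq_single i]
  · simp
  · intro j _ hj
    rw [if_neg (fun h => hj (Fin.ext h.symm)), mul_zero]
  · simp

lemma degree_coefPoly_lt {n : ℕ} (c : Fin n → K) : (coefPoly c).degree < n := by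
  refine lt_of_le_of_lt (degree_sum_le _ _) ((Finset.sup_lt_iff (WithBot.bot_lt_coe n)).2 ?_)
  intro i _
  exact lt_of_le_of_lt (degree_C_mul_X_pow_le _ _) (Nat.cast_lt.2 i.2)

/-- Some vector has the same annihilating polynomials as the whole space. -/
lemma exists_vector_annihilator (f : Module.End K V) :
    ∃ v : V, ∀ r : K[X], aeval f r v = 0 → aeval f r = 0 := by
  obtain ⟨x, hx⟩ := Module.exists_ker_toSpanSingleton_eq_annihilator (R := K[X])
    (M := Module.AEval' f)
  refine ⟨(Module.AEval'.of f).symm x, fun r hr => ?_⟩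
  have h1 : r ∈ LinearMap.ker (LinearMap.toSpanSingleton K[X] (Module.AEval' f) x) := by
    rw [LinearMap.mem_ker, LinearMap.toSpanSingleton_apply]
    apply (Module.AEval'.of f).symm.injective
    rw [map_zero]
    exact hr
  rw [hx, Module.mem_annihilator] at h1
  ext w
  have := h1 (Module.AEval'.of f w)
  apply (Module.AEval'.of f).injective
  rw [LinearMap.zero_apply, map_zero]
  exact this

lemma eq_zero_of_degree_lt_minpoly {f : Module.End K V} {r : K[X]}
    (hr : r.degree < (minpoly K f).natDegree) (h : aeval f r = 0) : r = 0 := by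
  by_contra h0
  have := minpoly.degree_le_of_ne_zero K f h0 h
  rw [degree_eq_natDegree (minpoly.ne_zero_of_finite K f)] at this
  exact absurd hr this.not_gt

lemma iterComb_injective {f : Module.End K V} {v : V}
    (hv : ∀ r : K[X], aeval f r v = 0 → aeval f r = 0) :
    Function.Injective (iterComb f (minpoly K f).natDegree v) := by
  rw [injective_iff_map_eq_zero]
  intro c hc
  rw [iterComb_apply] at hc
  have h := eq_zero_of_degree_lt_minpoly (degree_coefPoly_lt c) (hv _ hc)
  ext i
  rw [← coeff_coefPoly c i, h]
  simp

/-- If the minimal polynomial has degree less than the dimension, the centralizer is large. -/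
lemma exists_injective_commuting (f : Module.End K V) [Nontrivial V]
    (hn : (minpoly K f).natDegree < Module.finrank K V) :
    ∃ T : (V × K) →ₗ[K] Module.End K V, Function.Injective T ∧ ∀ x, f * T x = T x * f := by
  obtain ⟨v, hv⟩ := exists_vector_annihilator f
  set n := (minpoly K f).natDegree with hn_def
  have hn0 : 0 < n := minpoly.natDegree_pos (Algebra.IsIntegral.isIntegral f)
  have hinj := iterComb_injective hv
  rw [← hn_def] at hinj
  obtain ⟨g, hg⟩ := LinearMap.exists_leftInverse_of_injective _ (LinearMap.ker_eq_bot.2 hinj)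
  let φ : V →ₗ[K] K := LinearMap.proj ⟨n - 1, by omega⟩ ∘ₗ g
  have hφ : ∀ r : K[X], r.degree < n → φ (aeval f r v) = r.coeff (n - 1) := by
    intro r hr
    have h1 : r = coefPoly (fun i : Fin n => r.coeff i.1) := by
      have hrn : r.natDegree < n := by
        by_cases hr0 : r = 0
        · rwa [hr0, natDegree_zero]
        · exact (natDegree_lt_iff_degree_lt hr0).2 hr
      conv_lhs => rw [as_sum_range' r n hrn]
      rw [coefPoly, Finset.sum_range]
      simp [C_mul_X_pow_eq_monomial]
    have h2 := LinearMap.congr_fun hg (fun i : Fin n => r.coeff i.1)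
    rw [LinearMap.comp_apply, iterComb_apply, ← h1] at h2
    simp [φ, h2]
  let h : V →ₗ[K] (Fin n → K) := LinearMap.pi fun j => φ ∘ₗ (f ^ j.1)
  have hmu : aeval f (minpoly K f) = 0 := minpoly.aeval K f
  have hmonic : (minpoly K f).Monic := minpoly.monic (Algebra.IsIntegral.isIntegral f)
  have hred : ∀ r : K[X], aeval f (r %ₘ minpoly K f) = aeval f r := fun r => by
    conv_rhs => rw [← modByMonic_add_div r (minpoly K f)]
    rw [map_add, map_mul, hmu, zero_mul, add_zero]
  have hdeg : ∀ r : K[X], (r %ₘ minpoly K f).degree < n := fun r => by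
    rw [hn_def, ← degree_eq_natDegree hmonic.ne_zero]
    exact degree_modByMonic_lt _ hmonic
  have hND : ∀ r : K[X], h (aeval f r v) = 0 → aeval f r = 0 := by
    intro r hr
    rw [← hred] at hr ⊢
    set r' := r %ₘ minpoly K f
    by_contra hne
    have hr0 : r' ≠ 0 := fun h0 => hne (by rw [h0, map_zero])
    have hd : r'.natDegree < n := (natDegree_lt_iff_degree_lt hr0).2 (hdeg r)
    have h1 := congrFun hr ⟨n - 1 - r'.natDegree, by omega⟩
    have h2 : φ (aeval f (X ^ (n - 1 - r'.natDegree) * r') v) = 0 := by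
      rw [map_mul, map_pow, aeval_X]
      exact h1
    rw [hφ] at h2
    · rw [coeff_X_pow_mul', if_pos (by omega)] at h2
      have h3 : n - 1 - (n - 1 - r'.natDegree) = r'.natDegree := by omega
      rw [h3, coeff_natDegree, leadingCoeff_eq_zero] at h2
      exact hr0 h2
    · rw [degree_mul, degree_X_pow, degree_eq_natDegree hr0]
      norm_cast
      omega
  have hfh : ∀ y, h y = 0 → h (f y) = 0 := by
    intro y hy
    ext j
    change φ ((f ^ j.1) (f y)) = 0
    rw [← Module.End.mul_apply, ← pow_succ]
    by_cases hj : j.1 + 1 = n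
    · rw [hj]
      have h0 := hmu
      rw [aeval_eq_sum_range, ← hn_def, Finset.sum_range_succ] at h0
      have h1 : (minpoly K f).coeff n = 1 := hmonic
      rw [h1, one_smul] at h0
      rw [eq_neg_of_add_eq_zero_right h0, LinearMap.neg_apply, LinearMap.sum_apply, map_neg,
        map_sum, Finset.sum_eq_zero, neg_zero]
      intro i hi
      rw [LinearMap.smul_apply, map_smul]
      have := congrFun hy ⟨i, Finset.mem_range.1 hi⟩
      change φ ((f ^ i) y) = 0 at this
      rw [this, smul_zero]
    · exact congrFun hy ⟨j.1 + 1, by omega⟩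
  have hΘ : Function.Injective (h ∘ₗ iterComb f n v) := by
    rw [injective_iff_map_eq_zero]
    intro c hc
    rw [LinearMap.comp_apply, iterComb_apply] at hc
    apply hinj
    rw [iterComb_apply, hND _ hc, map_zero, LinearMap.zero_apply]
  let Θ := LinearEquiv.ofInjectiveEndo _ hΘ
  let c : V →ₗ[K] (Fin n → K) := Θ.symm.toLinearMap ∘ₗ h
  have hc : ∀ y, h (iterComb f n v (c y)) = h y := fun y => Θ.apply_symm_apply (h y)
  have hc' : ∀ a, c (iterComb f n v a) = a := fun a => Θ.symm_apply_apply a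
  have hcomm : ∀ w x, f (iterComb f n w (c x)) = iterComb f n w (c (f x)) := by
    intro w x
    have h1 : ∀ w, f (iterComb f n w (c x)) - iterComb f n w (c (f x))
        = aeval f (X * coefPoly (c x) - coefPoly (c (f x))) w := by
      intro w
      rw [iterComb_apply, iterComb_apply, map_sub, map_mul, aeval_X]
      rfl
    have h2 : aeval f (X * coefPoly (c x) - coefPoly (c (f x))) = 0 := by
      apply hND
      rw [← h1, map_sub, hc, ← map_sub, ← map_sub]
      apply hfh
      rw [map_sub, hc, sub_self]
    have := h1 w
    rw [h2, LinearMap.zero_apply, sub_eq_zero] at this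
    exact this
  have hv1 : iterComb f n v (Pi.single ⟨0, hn0⟩ 1) = v := by
    rw [iterComb_apply]
    have : coefPoly (Pi.single (M := fun _ => K) (⟨0, hn0⟩ : Fin n) 1) = 1 := by
      rw [coefPoly, Finset.sum_eq_single ⟨0, hn0⟩]
      · simp
      · intro j _ hj
        simp [Pi.single_eq_of_ne hj]
      · simp
    rw [this, map_one]
    rfl
  have hcv : c v = Pi.single ⟨0, hn0⟩ 1 := by
    have := hc' (Pi.single ⟨0, hn0⟩ 1)
    rwa [hv1] at this
  let Tw : V →ₗ[K] Module.End K V :=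
    { toFun := fun w => iterComb f n w ∘ₗ c
      map_add' := fun w w' => by ext x; simp [iterComb_apply]
      map_smul' := fun a w => by ext x; simp [iterComb_apply] }
  have hTwv : ∀ w, Tw w v = w := by
    intro w
    change iterComb f n w (c v) = w
    rw [hcv, iterComb, LinearMap.sum_apply, Finset.sum_eq_single ⟨0, hn0⟩]
    · simp
    · intro j _ hj
      simp [Pi.single_eq_of_ne hj]
    · simp
  have hTwc : ∀ w, f * Tw w = Tw w * f := fun w => LinearMap.ext fun x => hcomm w x
  refine ⟨LinearMap.coprod Tw (LinearMap.toSpanSingleton K _ (1 - Tw v)), ?_, ?_⟩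
  · rw [injective_iff_map_eq_zero]
    rintro ⟨w, a⟩ hwa
    rw [LinearMap.coprod_apply, LinearMap.toSpanSingleton_apply] at hwa
    have h1 := LinearMap.congr_fun hwa v
    simp only [LinearMap.add_apply, LinearMap.smul_apply, LinearMap.sub_apply, hTwv,
      Module.End.one_apply, sub_self, smul_zero, add_zero, LinearMap.zero_apply] at h1
    subst h1
    rw [map_zero, zero_add, smul_eq_zero] at hwa
    rcases hwa with rfl | hwa
    · rfl
    · exfalso
      have hsurj : Function.Surjective (iterComb f n v) := fun x => ⟨c x, by
        have h : x - iterComb f n v (c x) = 0 := LinearMap.congr_fun hwa x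
        exact (sub_eq_zero.1 h).symm⟩
      have := LinearMap.finrank_le_finrank_of_surjective hsurj
      rw [Module.finrank_fin_fun] at this
      omega
  · rintro ⟨w, a⟩
    rw [LinearMap.coprod_apply, LinearMap.toSpanSingleton_apply, mul_add, add_mul, hTwc,
      mul_smul_comm, smul_mul_assoc, mul_sub, sub_mul, mul_one, one_mul, hTwc]

/-- A matrix whose centralizer has minimal dimension has a cyclic vector. -/
lemma exists_krylov_det_ne_zero {N : ℕ} (A : Matrix (Fin N) (Fin N) K)
    (hA : Module.finrank K (LinearMap.ker (LinearMap.mulLeft K A - LinearMap.mulRight K A)) = N) :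
    ∃ v, (krylov A v).det ≠ 0 := by
  rcases Nat.eq_zero_or_pos N with rfl | hN
  · exact ⟨0, by simp⟩
  have : Nontrivial (Fin N → K) := by
    have : Nonempty (Fin N) := ⟨⟨0, hN⟩⟩
    infer_instance
  set f : Module.End K (Fin N → K) := Matrix.toLin' A with hf
  have hle : (minpoly K f).natDegree ≤ N := by
    have := natDegree_le_of_dvd (LinearMap.minpoly_dvd_charpoly f) f.charpoly_monic.ne_zero
    rwa [LinearMap.charpoly_natDegree, Module.finrank_fin_fun] at this
  have hge : N ≤ (minpoly K f).natDegree := by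
    by_contra hlt
    push Not at hlt
    obtain ⟨T, hT, hTc⟩ := exists_injective_commuting f (by rwa [Module.finrank_fin_fun])
    let T' : ((Fin N → K) × K) →ₗ[K]
        LinearMap.ker (LinearMap.mulLeft K A - LinearMap.mulRight K A) :=
      LinearMap.codRestrict _ (LinearMap.toMatrix'.toLinearMap ∘ₗ T) fun x => by
        rw [LinearMap.mem_ker, LinearMap.sub_apply, LinearMap.mulLeft_apply,
          LinearMap.mulRight_apply, sub_eq_zero]
        apply Matrix.toLin'.injective
        have := hTc x
        simp only [LinearMap.comp_apply, LinearEquiv.coe_coe, Matrix.toLin'_mul,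
          Matrix.toLin'_toMatrix']
        exact this
    have hT' : Function.Injective T' := by
      intro x y hxy
      apply hT
      apply LinearMap.toMatrix'.injective
      exact congrArg Subtype.val hxy
    have := LinearMap.finrank_le_finrank_of_injective hT'
    rw [hA, Module.finrank_prod, Module.finrank_fin_fun, Module.finrank_self] at this
    omega
  have hNn := le_antisymm hge hle
  obtain ⟨v, hv⟩ := exists_vector_annihilator f
  have hinj := iterComb_injective hv
  rw [← hNn] at hinj
  refine ⟨v, fun h0 => ?_⟩
  obtain ⟨c, hc0, hc⟩ := Matrix.exists_mulVec_eq_zero_iff.2 h0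
  apply hc0
  apply hinj
  rw [map_zero, ← hc]
  ext i
  rw [iterComb, LinearMap.sum_apply, Finset.sum_apply, Matrix.mulVec, dotProduct]
  refine Finset.sum_congr rfl fun j _ => ?_
  have h1 : (f ^ j.1) v = (A ^ j.1).mulVec v := by
    rw [hf, ← Matrix.toLin'_pow, Matrix.toLin'_apply]
  simp [h1, krylov, mul_comm]

end Cyclic

section ClassicalOrbit

/-- A Hessenberg matrix with unit subdiagonal has the first basis vector as cyclic vector. -/
lemma det_krylov_hessenberg {R : Type} [Field R] {N : ℕ} (T : Matrix (Fin N) (Fin N) R)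
    (h0 : ∀ i j : Fin N, j.1 + 1 < i.1 → T i j = 0)
    (h1 : ∀ i j : Fin N, i.1 = j.1 + 1 → T i j = 1) :
    (krylov T (fun i => if i.1 = 0 then 1 else 0)).det = 1 := by
  set e : Fin N → R := fun i => if i.1 = 0 then 1 else 0 with he
  have key : ∀ (n : ℕ) (i : Fin N), (n < i.1 → (T ^ n).mulVec e i = 0) ∧
      (i.1 = n → (T ^ n).mulVec e i = 1) := by
    intro n
    induction n with
    | zero =>
      intro i
      rw [pow_zero, Matrix.one_mulVec, he]
      exact ⟨fun h => if_neg (by omega), fun h => if_pos h⟩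
    | succ n ih =>
      intro i
      rw [pow_succ', ← Matrix.mulVec_mulVec]
      simp only [Matrix.mulVec, dotProduct]
      constructor
      · intro hi
        refine Finset.sum_eq_zero fun j _ => ?_
        rcases lt_or_ge n j.1 with hj | hj
        · rw [show ∑ x, (T ^ n) j x * e x = 0 from (ih j).1 hj, mul_zero]
        · rw [h0 i j (by omega), zero_mul]
      · intro hi
        rw [Finset.sum_eq_single ⟨n, by omega⟩]
        · rw [h1 _ _ hi, one_mul]
          exact (ih ⟨n, by omega⟩).2 rfl
        · intro j _ hj
          have hj' : j.1 ≠ n := fun h => hj (Fin.ext h)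
          rcases lt_or_ge n j.1 with hj2 | hj2
          · rw [show ∑ x, (T ^ n) j x * e x = 0 from (ih j).1 hj2, mul_zero]
          · rw [h0 i j (by omega), zero_mul]
        · simp
  rw [Matrix.det_of_isUpperTriangular]
  · refine Finset.prod_eq_one fun i _ => ?_
    exact (key i.1 i).2 rfl
  · intro i j hij
    exact (key j.1 i).1 hij

/-- A polynomial function vanishing on the conjugacy class of a matrix with a cyclic vector
vanishes on all matrices with the same characteristic polynomial. -/
lemma aeval_eq_zero_of_charpoly_eq {L : Type} [Field L] [IsAlgClosed L] {N : ℕ}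
    (f : MvPolynomial (Fin N × Fin N) L) (A : Matrix (Fin N) (Fin N) L) {v : Fin N → L}
    (hA : (krylov A v).det ≠ 0)
    (hf : ∀ g : Matrix (Fin N) (Fin N) L, g.det ≠ 0 →
      MvPolynomial.aeval (fun p => (g⁻¹ * A * g) p.1 p.2) f = 0)
    (B : Matrix (Fin N) (Fin N) L) (hB : A.charpoly = B.charpoly) :
    MvPolynomial.aeval (fun p => B p.1 p.2) f = 0 := by
  obtain ⟨U, T, hU, hBU, hT⟩ := exists_conj_triangular B
  let M : L → Matrix (Fin N) (Fin N) L := fun s i j =>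
    if i = j then T i j else if j < i then s * T i j + (1 - s) * (if i.1 = j.1 + 1 then 1 else 0)
    else 0
  let P : Matrix (Fin N) (Fin N) (Polynomial L) := fun i j =>
    if i = j then Polynomial.C (T i j) else if j < i then Polynomial.X * Polynomial.C (T i j) +
      (1 - Polynomial.X) * (if i.1 = j.1 + 1 then 1 else 0) else 0
  have hPM : ∀ s, P.map (Polynomial.evalRingHom s) = M s := by
    intro s
    ext i j
    change Polynomial.eval s (P i j) = M s i j
    simp only [P, M]
    split_ifs <;> simp <;> ring
  have hM1 : M 1 = T := by
    ext i j
    simp only [M]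
    split_ifs with h1 h2
    · rfl
    · simp
    · simp
    · exact (hT i j (lt_of_le_of_ne (not_lt.1 h2) h1)).symm
  have hMtri : ∀ s i j, i < j → M s i j = 0 := by
    intro s i j hij
    simp only [M, if_neg hij.ne, if_neg hij.not_gt]
  have hMdiag : ∀ s i, M s i i = T i i := by
    intro s i
    simp only [M, if_true]
  have hchar : ∀ s, A.charpoly = (M s).charpoly := by
    intro s
    have hUu : IsUnit U.det := hU.isUnit
    have h1 : B.charpoly = T.charpoly := by
      rw [hBU, mul_assoc, Matrix.charpoly_mul_comm, mul_assoc, Matrix.mul_nonsing_inv _ hUu,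
        mul_one]
    rw [hB, h1, charpoly_of_lowerTriangular hT, charpoly_of_lowerTriangular (hMtri s)]
    simp only [hMdiag]
  let eP : Fin N → Polynomial L := fun i => if i.1 = 0 then 1 else 0
  let e : Fin N → L := fun i => if i.1 = 0 then 1 else 0
  have hD : ∀ s, (krylov P eP).det.eval s = (krylov (M s) e).det := by
    intro s
    have h := map_krylov (Polynomial.evalRingHom s) P eP
    rw [hPM] at h
    have he : (Polynomial.evalRingHom s) ∘ eP = e := by
      ext i
      simp only [Function.comp_apply, eP, e]
      split_ifs <;> simp
    rw [he] at h
    rw [← h, ← Polynomial.coe_evalRingHom, RingHom.map_det]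
    rfl
  have hD0 : (krylov P eP).det ≠ 0 := by
    intro h0
    have h := hD 0
    rw [h0, Polynomial.eval_zero, det_krylov_hessenberg] at h
    · exact zero_ne_one h
    · intro i j hij
      simp only [M]
      rw [if_neg (fun h => by rw [h] at hij; omega), if_pos (Fin.lt_def.2 (by omega)),
        if_neg (by omega)]
      simp
    · intro i j hij
      simp only [M]
      rw [if_neg (fun h => by rw [h] at hij; omega), if_pos (Fin.lt_def.2 (by omega)),
        if_pos (by omega)]
      simp
  let pf : Polynomial L := MvPolynomial.aeval
    (fun p : Fin N × Fin N => (U⁻¹.map Polynomial.C * P * U.map Polynomial.C) p.1 p.2) f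
  have hpf : ∀ s, pf.eval s = MvPolynomial.aeval (fun p => (U⁻¹ * M s * U) p.1 p.2) f := by
    intro s
    rw [← Polynomial.coe_aeval_eq_eval, ← AlgHom.comp_apply, MvPolynomial.comp_aeval]
    congr 2
    ext p
    have h : (U⁻¹.map Polynomial.C * P * U.map Polynomial.C).map (Polynomial.evalRingHom s)
        = U⁻¹ * M s * U := by
      rw [Matrix.map_mul, Matrix.map_mul, hPM]
      congr 1
      · congr 1
        ext i j
        simp
      · ext i j
        simp
    rw [← h]
    simp [Polynomial.coe_aeval_eq_eval]
  have hzero : pf * (krylov P eP).det = 0 := by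
    apply Polynomial.funext
    intro s
    rw [Polynomial.eval_mul, Polynomial.eval_zero, hD, hpf, mul_eq_zero]
    by_cases h : (krylov (M s) e).det = 0
    · exact Or.inr h
    · left
      obtain ⟨g, hg, hMg⟩ := exists_conj_of_krylov hA h (hchar s)
      have := hf (g * U) (by rw [Matrix.det_mul]; exact mul_ne_zero hg hU)
      rw [Matrix.mul_inv_rev] at this
      rw [hMg]
      simpa only [mul_assoc] using this
  have h1 := hpf 1
  rw [(mul_eq_zero.1 hzero).resolve_right hD0, Polynomial.eval_zero, hM1, ← hBU] at h1
  exact h1.symm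

/-- Vanishing on a conjugacy class is a polynomial condition on the conjugating matrix. -/
lemma exists_conj_polynomial {k : Type} [Field k] {N : ℕ} (A : Matrix (Fin N) (Fin N) k)
    (f : MvPolynomial (Fin N × Fin N) k) :
    ∃ (n : ℕ) (h : MvPolynomial (Fin N × Fin N) k), ∀ (L : Type) [Field L] [Algebra k L]
      (g : Matrix (Fin N) (Fin N) L), g.det ≠ 0 →
      MvPolynomial.aeval (fun p => g p.1 p.2) h = g.det ^ n *
        MvPolynomial.aeval (fun p => (g⁻¹ * A.map (algebraMap k L) * g) p.1 p.2) f := by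
  have hdet : ∀ (L : Type) [Field L] [Algebra k L] (g : Matrix (Fin N) (Fin N) L),
      MvPolynomial.aeval (fun p => g p.1 p.2)
        (Matrix.mvPolynomialX (Fin N) (Fin N) k).det = g.det := by
    intro L _ _ g
    rw [AlgHom.map_det]
    congr 1
    ext i j
    simp
  induction f using MvPolynomial.induction_on with
  | C a =>
    refine ⟨0, MvPolynomial.C a, fun L _ _ g _ => ?_⟩
    simp
  | add f₁ f₂ h₁ h₂ =>
    obtain ⟨n₁, p₁, hp₁⟩ := h₁
    obtain ⟨n₂, p₂, hp₂⟩ := h₂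
    refine ⟨n₁ + n₂, p₁ * (Matrix.mvPolynomialX (Fin N) (Fin N) k).det ^ n₂ +
      p₂ * (Matrix.mvPolynomialX (Fin N) (Fin N) k).det ^ n₁, fun L _ _ g hg => ?_⟩
    rw [map_add, map_mul, map_mul, map_pow, map_pow, hdet, hp₁ L g hg, hp₂ L g hg, map_add]
    ring
  | mul_X f p h =>
    obtain ⟨n, q, hq⟩ := h
    let Y : Matrix (Fin N) (Fin N) (MvPolynomial (Fin N × Fin N) k) :=
      (Matrix.mvPolynomialX (Fin N) (Fin N) k).adjugate *
        A.map (MvPolynomial.C (σ := Fin N × Fin N)) * Matrix.mvPolynomialX (Fin N) (Fin N) k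
    refine ⟨n + 1, q * Y p.1 p.2, fun L _ _ g hg => ?_⟩
    have hadj : MvPolynomial.aeval (fun p : Fin N × Fin N => g p.1 p.2) (Y p.1 p.2) =
        (g.adjugate * A.map (algebraMap k L) * g) p.1 p.2 := by
      have hX : (Matrix.mvPolynomialX (Fin N) (Fin N) k).map
          (MvPolynomial.aeval (fun p : Fin N × Fin N => g p.1 p.2)) = g := by
        ext i j
        simp
      have h1 : Y.map (MvPolynomial.aeval (fun p : Fin N × Fin N => g p.1 p.2)) =
          g.adjugate * A.map (algebraMap k L) * g := by
        rw [Matrix.map_mul, Matrix.map_mul, hX]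
        congr 2
        · have := AlgHom.map_adjugate (MvPolynomial.aeval (fun p : Fin N × Fin N => g p.1 p.2))
            (Matrix.mvPolynomialX (Fin N) (Fin N) k)
          rw [AlgHom.mapMatrix_apply, AlgHom.mapMatrix_apply, hX] at this
          exact this
        · ext i j
          simp
      rw [← h1]
      rfl
    have hinv : g.adjugate = g.det • g⁻¹ := by
      rw [Matrix.inv_def, smul_smul, Ring.mul_inverse_cancel _ hg.isUnit, one_smul]
    rw [map_mul, hq L g hg, hadj, map_mul, MvPolynomial.aeval_X, hinv]
    simp only [Matrix.smul_mul, Matrix.smul_apply, smul_eq_mul]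
    ring

/-- Standard polynomials are determined by their restriction to a maximal conjugacy class. -/
lemma eq_zero_of_vanishing_on_orbit (K : Subfield ℂ) {N : ℕ} (A : Matrix (Fin N) (Fin N) K)
    (hA : Module.finrank K (LinearMap.ker (LinearMap.mulLeft K A - LinearMap.mulRight K A)) = N)
    (f : MvPolynomial (Fin N × Fin N) K) (hs : ∀ m ∈ f.support, m ∈ stdMon N)
    (hf : ∀ g : Matrix (Fin N) (Fin N) K, g.det ≠ 0 →
      MvPolynomial.aeval (fun p => (g⁻¹ * A * g) p.1 p.2) f = 0) : f = 0 := by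
  obtain ⟨v, hv⟩ := exists_krylov_det_ne_zero A hA
  obtain ⟨n, h, hh⟩ := exists_conj_polynomial A f
  have hinf : Infinite K := Infinite.of_injective (fun n : ℕ => (n : K)) Nat.cast_injective
  have hh0 : h = 0 := by
    have : h * (Matrix.mvPolynomialX (Fin N) (Fin N) K).det = 0 := by
      apply MvPolynomial.funext
      intro x
      rw [map_mul, map_zero, mul_eq_zero]
      let g : Matrix (Fin N) (Fin N) K := fun i j => x (i, j)
      have hdet : MvPolynomial.eval x (Matrix.mvPolynomialX (Fin N) (Fin N) K).det = g.det := by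
        rw [RingHom.map_det]
        congr 1
        ext i j
        simp [g]
      rw [hdet]
      by_cases hg : g.det = 0
      · exact Or.inr hg
      · left
        have h1 := hh K g hg
        have h2 := hf g hg
        have hAid : A.map (algebraMap K K) = A := by ext i j; rfl
        rw [hAid, h2, mul_zero] at h1
        exact h1
    exact (mul_eq_zero.1 this).resolve_right (Matrix.det_mvPolynomialX_ne_zero _ _)
  set AC : Matrix (Fin N) (Fin N) ℂ := A.map (algebraMap K ℂ) with hAC
  set fC : MvPolynomial (Fin N × Fin N) ℂ := MvPolynomial.map (algebraMap K ℂ) f with hfC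
  have hfC0 : ∀ g : Matrix (Fin N) (Fin N) ℂ, g.det ≠ 0 →
      MvPolynomial.aeval (fun p => (g⁻¹ * AC * g) p.1 p.2) fC = 0 := by
    intro g hg
    have h1 := hh ℂ g hg
    rw [hh0, map_zero] at h1
    have h2 := (mul_eq_zero.1 h1.symm).resolve_left (pow_ne_zero _ hg)
    rw [hfC, MvPolynomial.aeval_map_algebraMap]
    exact h2
  have hvC : (krylov AC ((algebraMap K ℂ) ∘ v)).det ≠ 0 := by
    rw [hAC, ← map_krylov, ← RingHom.mapMatrix_apply, ← RingHom.map_det]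
    exact (map_ne_zero_iff _ (algebraMap K ℂ).injective).2 hv
  let c : Fin N → MvPolynomial (Fin N × Fin N) ℂ := fun i =>
    tauCoinv (1 : ℂ) 1 (fun i j => MvPolynomial.X (i, j)) (i.1 + 1) -
      MvPolynomial.C (tauCoinv (1 : ℂ) 1 (fun i j => AC i j) (i.1 + 1))
  have hrad : fC ∈ (Ideal.span (Set.range c)).radical := by
    rw [← MvPolynomial.vanishingIdeal_zeroLocus_eq_radical (K := ℂ),
      MvPolynomial.mem_vanishingIdeal_iff]
    intro x hx
    rw [MvPolynomial.mem_zeroLocus_iff] at hx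
    let B : Matrix (Fin N) (Fin N) ℂ := fun i j => x (i, j)
    have hB : AC.charpoly = B.charpoly := by
      refine charpoly_eq_of_tauCoinv_eq (k := ℂ) fun i => ?_
      have h1 := hx (c i) (Ideal.subset_span ⟨i, rfl⟩)
      rw [map_sub, sub_eq_zero, MvPolynomial.aeval_C, tauCoinv_eq_sum, map_sum] at h1
      rw [tauCoinv_eq_sum (x := fun i j => B i j)]
      refine Eq.trans h1.symm ?_
      refine Finset.sum_congr rfl fun P _ => ?_
      rw [map_smul, map_minorProd]
      simp [B]
    exact aeval_eq_zero_of_charpoly_eq fC AC hvC hfC0 B hB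
  obtain ⟨m, hm⟩ := hrad
  have hfin : fC = 0 := by
    refine eq_zero_of_pow_mem (c := c) (fun i => (degree_tau_sub_C _ i).1)
      (fun i => (degree_tau_sub_C _ i).2) (fun s hsm => hs s ?_) hm
    exact MvPolynomial.support_map_subset _ _ hsm
  exact MvPolynomial.map_injective _ (algebraMap K ℂ).injective (by rw [map_zero]; exact hfin)

end ClassicalOrbit

section Antisymmetry

variable {t N : ℕ}

/-- Number of inversions of a sequence. -/
def invSeq {M : ℕ} (b : Fin t → Fin M) : ℕ :=
  (Finset.univ.filter fun p : Fin t × Fin t => p.1 < p.2 ∧ b p.2 < b p.1).card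

lemma invSeq_swap {M : ℕ} (b : Fin t → Fin M) {k k' : Fin t} (hk : k.1 + 1 = k'.1)
    (hd : b k' < b k) : invSeq (b ∘ Equiv.swap k k') + 1 = invSeq b := by
  have hkk : k ≠ k' := fun h => by rw [h] at hk; omega
  let e : Fin t × Fin t ↪ Fin t × Fin t :=
    (Equiv.prodCongr (Equiv.swap k k') (Equiv.swap k k')).toEmbedding
  have hS : (Finset.univ.filter fun p : Fin t × Fin t => p.1 < p.2 ∧ b p.2 < b p.1) =
      insert (k, k') ((Finset.univ.filter fun p : Fin t × Fin t => p.1 < p.2 ∧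
        (b ∘ Equiv.swap k k') p.2 < (b ∘ Equiv.swap k k') p.1).map e) := by
    ext ⟨i, j⟩
    rw [Finset.mem_insert]
    have h1 : (i, j) ∈ ((Finset.univ.filter fun p : Fin t × Fin t => p.1 < p.2 ∧
        (b ∘ Equiv.swap k k') p.2 < (b ∘ Equiv.swap k k') p.1).map e) ↔
        Equiv.swap k k' i < Equiv.swap k k' j ∧ b j < b i := by
      rw [Finset.mem_map_equiv]
      simp
    rw [h1]
    simp only [Finset.mem_filter, Finset.mem_univ, true_and, Prod.mk.injEq]
    by_cases hb : b j < b i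
    · have hij : i ≠ j := fun h => by rw [h] at hb; exact lt_irrefl _ hb
      simp only [hb, and_true]
      by_cases hik : i = k
      · subst hik
        by_cases hjk : j = k'
        · subst hjk
          simp only [Fin.lt_def, and_self, true_or, iff_true]
          omega
        · rw [Equiv.swap_apply_left, Equiv.swap_apply_of_ne_of_ne hij.symm hjk]
          have : j.1 ≠ k'.1 := fun h => hjk (Fin.ext h)
          simp only [Fin.ext_iff, Fin.lt_def]
          omega
      · have hik1 : i.1 ≠ k.1 := fun h => hik (Fin.ext h)
        by_cases hik' : i = k'
        · subst hik'
          by_cases hjk : j = k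
          · subst hjk
            exact absurd hb hd.not_gt
          · rw [Equiv.swap_apply_right, Equiv.swap_apply_of_ne_of_ne hjk hij.symm]
            have : j.1 ≠ k.1 := fun h => hjk (Fin.ext h)
            simp only [Fin.ext_iff, Fin.lt_def]
            omega
        · have hik2 : i.1 ≠ k'.1 := fun h => hik' (Fin.ext h)
          rw [Equiv.swap_apply_of_ne_of_ne hik hik', Equiv.swap_apply_def]
          split_ifs with h1 h2
          · subst h1
            simp only [Fin.ext_iff, Fin.lt_def]
            omega
          · subst h2
            simp only [Fin.ext_iff, Fin.lt_def]
            omega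
          · simp only [Fin.ext_iff, Fin.lt_def]
            omega
    · simp only [hb, and_false, or_false, false_iff]
      rintro ⟨rfl, rfl⟩
      exact hb hd
  rw [invSeq, invSeq, hS, Finset.card_insert_of_notMem, Finset.card_map]
  rw [Finset.mem_map_equiv]
  simp only [Finset.mem_filter, Equiv.prodCongr_symm, Equiv.symm_swap, Equiv.prodCongr_apply,
    Prod.map_apply, Equiv.swap_apply_left, Equiv.swap_apply_right, Fin.lt_def]
  omega

lemma strictMono_of_adjacent {M : ℕ} {b : Fin t → Fin M}
    (h : ∀ k k' : Fin t, k.1 + 1 = k'.1 → b k < b k') : StrictMono b := by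
  cases t with
  | zero => exact fun i => i.elim0
  | succ n => exact Fin.strictMono_iff_lt_succ.2 fun i => h _ _ (by simp)

lemma perm_eq_one_of_strictMono {σ : Equiv.Perm (Fin t)} (h : StrictMono σ) : σ = 1 := by
  have := (StrictMono.range_inj h strictMono_id).1
    (by rw [Set.range_id, σ.surjective.range_eq])
  exact Equiv.ext fun i => congrFun this i

variable {F : Type} [Field F] {Y : Type} [Ring Y] [Algebra F Y]

/-- `q`-antisymmetry of a function of index sequences. -/
def QAnti (q : F) (f : (Fin t → Fin N) → Y) : Prop :=
  ∀ k k' : Fin t, k.1 + 1 = k'.1 → ∀ b, (b k = b k' → f b = 0) ∧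
    (b k' < b k → f b = (-q) • f (b ∘ Equiv.swap k k'))

lemma QAnti.eq_zero {q : F} {f : (Fin t → Fin N) → Y} (hf : QAnti q f) (b : Fin t → Fin N)
    (hb : ¬ Function.Injective b) : f b = 0 := by
  induction hn : invSeq b using Nat.strong_induction_on generalizing b with
  | _ n ih =>
    have h1 : ¬ StrictMono b := fun h => hb h.injective
    have h2 : ∃ k k' : Fin t, k.1 + 1 = k'.1 ∧ b k' ≤ b k := by
      by_contra h
      push Not at h
      exact h1 (strictMono_of_adjacent h)
    obtain ⟨k, k', hk, hle⟩ := h2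
    rcases hle.eq_or_lt with h | h
    · exact (hf k k' hk b).1 h.symm
    · rw [(hf k k' hk b).2 h, ih _ _ _ _ rfl, smul_zero]
      · have := invSeq_swap b hk h
        omega
      · intro h'
        exact hb ((Equiv.injective_comp (Equiv.swap k k') b).1 h')

lemma QAnti.comp_perm {q : F} {f : (Fin t → Fin N) → Y} (hf : QAnti q f) {B : Fin t → Fin N}
    (hB : StrictMono B) (σ : Equiv.Perm (Fin t)) : f (B ∘ σ) = (-q) ^ invCount σ • f B := by
  induction hn : invCount σ using Nat.strong_induction_on generalizing σ with
  | _ n ih =>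
    by_cases h2 : ∃ k k' : Fin t, k.1 + 1 = k'.1 ∧ σ k' < σ k
    · obtain ⟨k, k', hk, hlt⟩ := h2
      have h3 : invCount (σ * Equiv.swap k k') + 1 = invCount σ := invSeq_swap σ hk hlt
      have h4 := (hf k k' hk (B ∘ σ)).2 (hB hlt)
      rw [h4]
      have h5 := ih (invCount (σ * Equiv.swap k k')) (by omega) (σ * Equiv.swap k k') rfl
      rw [Equiv.Perm.coe_mul, ← Function.comp_assoc] at h5
      rw [h5, smul_smul, ← pow_succ', h3, hn]
    · push Not at h2
      have h3 : σ = 1 := by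
        apply perm_eq_one_of_strictMono
        apply strictMono_of_adjacent
        intro k k' hk
        refine lt_of_le_of_ne (h2 k k' hk) fun h => ?_
        have := σ.injective h
        rw [this] at hk
        omega
      subst h3
      have : invCount (1 : Equiv.Perm (Fin t)) = 0 := by
        rw [invCount, Finset.card_eq_zero, Finset.filter_eq_empty_iff]
        rintro p _ ⟨h, h'⟩
        exact absurd h h'.not_gt
      rw [← hn, this, pow_zero, one_smul]
      rfl

open Classical in
/-- The strictly increasing index sequences. -/
def incSeq (t N : ℕ) : Finset (Fin t → Fin N) := Finset.univ.filter StrictMono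

lemma mem_incSeq {b : Fin t → Fin N} : b ∈ incSeq t N ↔ StrictMono b := by
  simp [incSeq]

/-- Sums over all sequences reduce to sums over increasing ones and permutations. -/
lemma sum_eq_sum_incSeq {Z : Type} [AddCommMonoid Z] (h : (Fin t → Fin N) → Z)
    (hz : ∀ b, ¬ Function.Injective b → h b = 0) :
    ∑ b, h b = ∑ B ∈ incSeq t N, ∑ σ : Equiv.Perm (Fin t), h (B ∘ σ) := by
  classical
  rw [← Finset.sum_product']
  symm
  refine Finset.sum_of_injOn (fun p => p.1 ∘ p.2) ?_ (fun _ _ => Finset.mem_univ _) ?_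
    (fun _ _ => rfl)
  · rintro ⟨B, σ⟩ h1 ⟨B', σ'⟩ h2 heq
    simp only [Finset.coe_product, Set.mem_prod, Finset.mem_coe, mem_incSeq] at h1 h2 heq
    have h3 : B = B' := by
      apply (StrictMono.range_inj h1.1 h2.1).1
      rw [← σ.surjective.range_comp B, heq, σ'.surjective.range_comp]
    subst h3
    congr 1
    ext1 i
    exact h1.1.injective (congrFun heq i)
  · intro b _ hb
    apply hz
    intro hinj
    apply hb
    refine ⟨(b ∘ Tuple.sort b, (Tuple.sort b)⁻¹), ?_, ?_⟩
    · simp only [Finset.coe_product, Set.mem_prod, Finset.mem_coe, mem_incSeq]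
      exact ⟨(Tuple.monotone_sort b).strictMono_of_injective
        (hinj.comp (Tuple.sort b).injective), Finset.mem_univ _⟩
    · ext1 i
      simp

/-- The word with given row and column indices. -/
def word (y : Fin N → Fin N → Y) (b c : Fin t → Fin N) : Y :=
  ((List.finRange t).map fun k => y (b k) (c k)).prod

/-- The quantum minor with row sequence `b` and column sequence `c`. -/
def seqMinor (q : F) (y : Fin N → Fin N → Y) (b c : Fin t → Fin N) : Y :=
  ∑ σ : Equiv.Perm (Fin t), (-q) ^ invCount σ • word y b (c ∘ σ)

/-- The quantum matrix relations. -/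
structure IsQMat (q : F) (y : Fin N → Fin N → Y) : Prop where
  row : ∀ i j l : Fin N, j < l → y i j * y i l = q • (y i l * y i j)
  col : ∀ i k j : Fin N, i < k → y i j * y k j = q • (y k j * y i j)
  anti : ∀ i k j l : Fin N, i < k → j < l → y i l * y k j = y k j * y i l
  diag : ∀ i k j l : Fin N, i < k → j < l →
    y i j * y k l - y k l * y i j = (q - q⁻¹) • (y i l * y k j)

lemma exists_finRange_split {k k' : Fin t} (hk : k.1 + 1 = k'.1) :
    ∃ l r : List (Fin t), List.finRange t = l ++ (k :: k' :: r) ∧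
      (∀ i ∈ l, i ≠ k ∧ i ≠ k') ∧ ∀ i ∈ r, i ≠ k ∧ i ≠ k' := by
  have h1 : List.finRange t = (List.finRange t).take k.1 ++
      (k :: k' :: (List.finRange t).drop (k.1 + 2)) := by
    conv_lhs => rw [← List.take_append_drop k.1 (List.finRange t)]
    have hk1 : k.1 < (List.finRange t).length := by simp
    have hk2 : k.1 + 1 < (List.finRange t).length := by simp [hk]
    rw [List.drop_eq_getElem_cons hk1, List.drop_eq_getElem_cons hk2]
    congr 3
    · simp
    · apply Fin.ext
      simp [hk]
  have h2 := List.nodup_finRange t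
  rw [h1, List.nodup_append] at h2
  obtain ⟨-, h3, h4⟩ := h2
  rw [List.nodup_cons, List.nodup_cons] at h3
  refine ⟨_, _, h1, fun i hi => ⟨?_, ?_⟩, fun i hi => ⟨?_, ?_⟩⟩
  · exact h4 i hi k (by simp)
  · exact h4 i hi k' (by simp)
  · rintro rfl
    exact h3.1 (List.mem_cons_of_mem _ hi)
  · rintro rfl
    exact h3.2.1 hi

lemma exists_word_split (y : Fin N → Fin N → Y) {k k' : Fin t} (hk : k.1 + 1 = k'.1)
    (b c : Fin t → Fin N) : ∃ L R : Y, ∀ b' c' : Fin t → Fin N,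
      (∀ i, i ≠ k → i ≠ k' → b' i = b i ∧ c' i = c i) →
      word y b' c' = L * (y (b' k) (c' k) * y (b' k') (c' k')) * R := by
  obtain ⟨l, r, hlr, hl, hr⟩ := exists_finRange_split hk
  refine ⟨(l.map fun i => y (b i) (c i)).prod, (r.map fun i => y (b i) (c i)).prod,
    fun b' c' h => ?_⟩
  rw [word, hlr, List.map_append, List.prod_append, List.map_cons, List.map_cons,
    List.prod_cons, List.prod_cons]
  have h1 : (l.map fun i => y (b' i) (c' i)) = l.map fun i => y (b i) (c i) :=
    List.map_congr_left fun i hi => by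
      rw [(h i (hl i hi).1 (hl i hi).2).1, (h i (hl i hi).1 (hl i hi).2).2]
  have h2 : (r.map fun i => y (b' i) (c' i)) = r.map fun i => y (b i) (c i) :=
    List.map_congr_left fun i hi => by
      rw [(h i (hr i hi).1 (hr i hi).2).1, (h i (hr i hi).1 (hr i hi).2).2]
  rw [h1, h2]
  simp only [mul_assoc]

lemma sum_perm_pairs {Z : Type} [AddCommMonoid Z] {k k' : Fin t} (hkk : k ≠ k')
    (g : Equiv.Perm (Fin t) → Z) :
    ∑ σ, g σ = ∑ σ ∈ Finset.univ.filter (fun σ : Equiv.Perm (Fin t) => σ k < σ k'),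
      (g σ + g (σ * Equiv.swap k k')) := by
  rw [Finset.sum_add_distrib,
    ← Finset.sum_filter_add_sum_filter_not Finset.univ
      (fun σ : Equiv.Perm (Fin t) => σ k < σ k')]
  congr 1
  refine Finset.sum_nbij' (fun σ => σ * Equiv.swap k k') (fun σ => σ * Equiv.swap k k')
    ?_ ?_ ?_ ?_ ?_
  · intro σ h
    simp only [Finset.mem_filter, Finset.mem_univ, true_and, Equiv.Perm.mul_apply,
      Equiv.swap_apply_left, Equiv.swap_apply_right] at h ⊢
    exact lt_of_le_of_ne (not_lt.1 h) fun h' => hkk (σ.injective h').symm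
  · intro σ h
    simp only [Finset.mem_filter, Finset.mem_univ, true_and, Equiv.Perm.mul_apply,
      Equiv.swap_apply_left, Equiv.swap_apply_right] at h ⊢
    exact h.not_gt
  · intro σ _
    simp [mul_assoc]
  · intro σ _
    simp [mul_assoc]
  · intro σ _
    simp [mul_assoc]

lemma IsQMat.seqMinor_anti {q : F} (hq : q ≠ 0) {y : Fin N → Fin N → Y} (hy : IsQMat q y)
    {c : Fin t → Fin N} (hc : StrictMono c) : QAnti q (fun b => seqMinor q y b c) := by
  intro k k' hk b
  have hkk : k ≠ k' := fun h => by rw [h] at hk; omega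
  have hinv : ∀ σ : Equiv.Perm (Fin t), σ k < σ k' →
      invCount (σ * Equiv.swap k k') = invCount σ + 1 := by
    intro σ hσ
    have h : invCount (σ * Equiv.swap k k' * Equiv.swap k k') + 1
        = invCount (σ * Equiv.swap k k') := invSeq_swap (σ * Equiv.swap k k' : Equiv.Perm (Fin t)) hk
      (by simpa using hσ)
    rw [mul_assoc, Equiv.swap_mul_self, mul_one] at h
    exact h.symm
  have hD : ∀ b, seqMinor q y b c = ∑ σ ∈ Finset.univ.filter
      (fun σ : Equiv.Perm (Fin t) => σ k < σ k'), (-q) ^ invCount σ •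
      (word y b (c ∘ σ) - q • word y b ((c ∘ σ) ∘ Equiv.swap k k')) := by
    intro b
    rw [seqMinor, sum_perm_pairs hkk]
    refine Finset.sum_congr rfl fun σ hσ => ?_
    rw [hinv σ (Finset.mem_filter.1 hσ).2, Equiv.Perm.coe_mul, ← Function.comp_assoc]
    rw [pow_succ]
    module
  have hsw : ∀ i : Fin t, i ≠ k → i ≠ k' → Equiv.swap k k' i = i := fun i h1 h2 =>
    Equiv.swap_apply_of_ne_of_ne h1 h2
  refine ⟨fun hb => ?_, fun hb => ?_⟩
  · simp only [hD]
    refine Finset.sum_eq_zero fun σ hσ => ?_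
    have hσ' := hc (Finset.mem_filter.1 hσ).2
    obtain ⟨L, R, hLR⟩ := exists_word_split y hk b (c ∘ σ)
    rw [hLR b (c ∘ σ) (fun i _ _ => ⟨rfl, rfl⟩),
      hLR b ((c ∘ σ) ∘ Equiv.swap k k') (fun i h1 h2 => ⟨rfl, by simp [hsw i h1 h2]⟩)]
    simp only [Function.comp_apply, Equiv.swap_apply_left, Equiv.swap_apply_right]
    rw [hb, hy.row _ _ _ hσ']
    simp
  · simp only [hD]
    rw [Finset.smul_sum]
    refine Finset.sum_congr rfl fun σ hσ => ?_
    have hσ' := hc (Finset.mem_filter.1 hσ).2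
    obtain ⟨L, R, hLR⟩ := exists_word_split y hk b (c ∘ σ)
    rw [hLR b (c ∘ σ) (fun i _ _ => ⟨rfl, rfl⟩),
      hLR b ((c ∘ σ) ∘ Equiv.swap k k') (fun i h1 h2 => ⟨rfl, by simp [hsw i h1 h2]⟩),
      hLR (b ∘ Equiv.swap k k') (c ∘ σ) (fun i h1 h2 => ⟨by simp [hsw i h1 h2], rfl⟩),
      hLR (b ∘ Equiv.swap k k') ((c ∘ σ) ∘ Equiv.swap k k')
        (fun i h1 h2 => ⟨by simp [hsw i h1 h2], by simp [hsw i h1 h2]⟩)]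
    simp only [Function.comp_apply, Equiv.swap_apply_left, Equiv.swap_apply_right]
    have e1 := hy.anti _ _ _ _ hb hσ'
    have e2 := hy.diag _ _ _ _ hb hσ'
    rw [← e1]
    have e3 : y (b k) (c (σ k')) * y (b k') (c (σ k)) =
        y (b k') (c (σ k)) * y (b k) (c (σ k')) -
          (q - q⁻¹) • (y (b k') (c (σ k')) * y (b k) (c (σ k))) := by
      rw [← e2]
      abel
    rw [e3]
    simp only [mul_sub, sub_mul, mul_smul_comm, smul_mul_assoc, smul_sub, smul_smul]
    rw [mul_inv_cancel₀ hq]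
    module

end Antisymmetry

section Antipode

variable {N : ℕ} {F : Type} [Field F] {G : Type} [Ring G] [Algebra F G]

lemma antipode_mul_of_hopf (Δ : G →ₐ[F] G ⊗[F] G) (ε : G →ₐ[F] F) (S : G →ₗ[F] G)
    (hco : (Algebra.TensorProduct.assoc F F F G G G : (G ⊗[F] G) ⊗[F] G →ₐ[F] G ⊗[F] (G ⊗[F] G)).comp
      ((Algebra.TensorProduct.map Δ (AlgHom.id F G)).comp Δ) =
      (Algebra.TensorProduct.map (AlgHom.id F G) Δ).comp Δ)
    (hl : (Algebra.TensorProduct.map ε (AlgHom.id F G)).comp Δ =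
      (Algebra.TensorProduct.lid F G).symm)
    (hr : (Algebra.TensorProduct.map (AlgHom.id F G) ε).comp Δ =
      (Algebra.TensorProduct.rid F F G).symm)
    (hS1 : LinearMap.mul' F G ∘ₗ TensorProduct.map S LinearMap.id ∘ₗ Δ.toLinearMap
      = Algebra.linearMap F G ∘ₗ ε.toLinearMap)
    (hS2 : LinearMap.mul' F G ∘ₗ TensorProduct.map LinearMap.id S ∘ₗ Δ.toLinearMap
      = Algebra.linearMap F G ∘ₗ ε.toLinearMap) :
    (∀ a b, S (a * b) = S b * S a) ∧ S 1 = 1 := by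
  let _ : Bialgebra F G := Bialgebra.ofAlgHom Δ ε hco hl hr
  let _ : HopfAlgebra F G :=
    { antipode := S
      mul_antipode_rTensor_comul := hS1
      mul_antipode_lTensor_comul := hS2 }
  exact ⟨fun a b => HopfAlgebra.antipode_mul_antidistrib (R := F) a b,
    HopfAlgebra.antipode_one (R := F) (A := G)⟩

lemma IsQMat.map {q : F} {Y Y' : Type} [Ring Y] [Algebra F Y] [Ring Y'] [Algebra F Y']
    {y : Fin N → Fin N → Y} (hy : IsQMat q y) (f : Y →ₐ[F] Y') :
    IsQMat q (fun i j => f (y i j)) where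
  row i j l h := by rw [← map_mul, hy.row i j l h, map_smul, map_mul]
  col i k j h := by rw [← map_mul, hy.col i k j h, map_smul, map_mul]
  anti i k j l h h' := by rw [← map_mul, hy.anti i k j l h h', map_mul]
  diag i k j l h h' := by
    rw [← map_mul, ← map_mul, ← map_sub, hy.diag i k j l h h', map_smul, map_mul]

/-- The quantum matrix relations in uniform (R-matrix) form. -/
lemma IsQMat.rtt {q : F} (hq : q ≠ 0) {X : Fin N → Fin N → G} (hX : IsQMat q X)
    (i k j l : Fin N) :
    (if i = k then q else 1) • (X i j * X k l) +
      (if k < i then q - q⁻¹ else 0) • (X k j * X i l) =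
    (if j = l then q else 1) • (X k l * X i j) +
      (if j < l then q - q⁻¹ else 0) • (X k j * X i l) := by
  have hqq : ∀ z : G, q • (q⁻¹ • z) = z := fun z => smul_inv_smul₀ hq z
  have hqq' : q * q⁻¹ = 1 := mul_inv_cancel₀ hq
  rcases lt_trichotomy i k with hik | rfl | hik
  · rcases lt_trichotomy j l with hjl | rfl | hjl
    · simp only [hik.ne, hik.not_gt, hjl.ne, hjl, if_true, if_false, one_smul, zero_smul, add_zero]
      rw [← hX.anti i k j l hik hjl, ← hX.diag i k j l hik hjl]
      abel
    · simp only [hik.ne, hik.not_gt, lt_irrefl, if_true, if_false, one_smul, zero_smul, add_zero]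
      exact hX.col i k j hik
    · simp only [hik.ne, hik.not_gt, hjl.ne', hjl.not_gt, if_false, one_smul, zero_smul, add_zero]
      exact hX.anti i k l j hik hjl
  · rcases lt_trichotomy j l with hjl | rfl | hjl
    · simp only [lt_irrefl, hjl.ne, hjl, if_true, if_false, one_smul, zero_smul, add_zero]
      rw [hX.row i j l hjl, smul_smul, smul_smul, sub_mul, mul_comm q⁻¹, hqq', sub_smul, one_smul]
      abel
    · simp
    · simp only [lt_irrefl, hjl.ne', hjl.not_gt, if_true, if_false, one_smul, zero_smul, add_zero]
      exact (hX.row i l j hjl).symm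
  · rcases lt_trichotomy j l with hjl | rfl | hjl
    · simp only [hik.ne', hik, hjl.ne, hjl, if_true, if_false, one_smul]
      rw [hX.anti k i j l hik hjl]
    · simp only [hik.ne', hik, lt_irrefl, if_true, if_false, one_smul, zero_smul, add_zero]
      rw [hX.col k i j hik, smul_smul, smul_smul, sub_mul, mul_comm q⁻¹, hqq', sub_smul, one_smul]
      abel
    · simp only [hik.ne', hik, hjl.ne', hjl.not_gt, if_true, if_false, one_smul, zero_smul,
        add_zero]
      rw [hX.anti k i l j hik hjl, ← hX.anti k i l j hik hjl, ← hX.diag k i l j hik hjl]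
      abel

/-- The weights of the coinvariants telescope. -/
lemma weight_telescope {q : F} (hq : q ≠ 0) (l : Fin N) :
    q⁻¹ ^ (2 * (l.1 + 1)) * q +
      ∑ b : Fin N, (if b < l then q - q⁻¹ else 0) * q⁻¹ ^ (2 * (b.1 + 1)) = q⁻¹ := by
  have key : ∀ n : ℕ, q⁻¹ ^ (2 * (n + 1)) * q +
      ∑ b ∈ Finset.range n, (q - q⁻¹) * q⁻¹ ^ (2 * (b + 1)) = q⁻¹ := by
    intro n
    induction n with
    | zero => simp [pow_two, hq]
    | succ n ih =>
      rw [Finset.sum_range_succ]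
      have h : q⁻¹ ^ (2 * (n + 1 + 1)) * q + (q - q⁻¹) * q⁻¹ ^ (2 * (n + 1)) =
          q⁻¹ ^ (2 * (n + 1)) * q := by
        have h2 : 2 * (n + 1 + 1) = 2 * (n + 1) + 2 := by ring
        rw [h2, pow_add, pow_two]
        field_simp
        ring
      linear_combination h + ih
  have h1 : ∑ b : Fin N, (if b < l then q - q⁻¹ else 0) * q⁻¹ ^ (2 * (b.1 + 1)) =
      ∑ b ∈ Finset.range l.1, (q - q⁻¹) * q⁻¹ ^ (2 * (b + 1)) := by
    simp only [ite_mul, zero_mul, Fin.lt_def]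
    rw [Fin.sum_univ_eq_sum_range
      (fun b => if b < l.1 then (q - q⁻¹) * q⁻¹ ^ (2 * (b + 1)) else 0) N, ← Finset.sum_filter]
    refine Finset.sum_congr ?_ fun _ _ => rfl
    ext b
    simp only [Finset.mem_filter, Finset.mem_range]
    have := l.2
    omega
  rw [h1, key]

/-- Exchange relation between a quantum matrix and its inverse. -/
lemma exchange_antipode {q : F} (hq : q ≠ 0) {X s : Fin N → Fin N → G} (hX : IsQMat q X)
    (h1 : ∀ i j, ∑ k, s i k * X k j = if i = j then 1 else 0)
    (h2 : ∀ i j, ∑ k, X i k * s k j = if i = j then 1 else 0) (i j c d : Fin N) :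
    (if i = d then q else 1) • (s c d * X i j) +
      ∑ k, (if k < i then q - q⁻¹ else 0) • (s c k * X k j * if i = d then 1 else 0) =
    (if j = c then q else 1) • (X i j * s c d) +
      ∑ l, (if j < l then q - q⁻¹ else 0) • ((if c = j then 1 else 0) * (X i l * s l d)) := by
  have T1 : ∑ k, ∑ l, s c k * ((if i = k then q else 1) • (X i j * X k l)) * s l d =
      (if i = d then q else 1) • (s c d * X i j) := by
    have : ∀ k, ∑ l, s c k * ((if i = k then q else 1) • (X i j * X k l)) * s l d =
        (if i = k then q else 1) • (s c k * X i j * if k = d then 1 else 0) := by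
      intro k
      rw [← h2, Finset.mul_sum, Finset.smul_sum]
      refine Finset.sum_congr rfl fun l _ => ?_
      simp only [mul_smul_comm, smul_mul_assoc, mul_assoc]
    simp only [this, mul_ite, mul_one, mul_zero, smul_ite, smul_zero, Finset.sum_ite_eq',
      Finset.mem_univ, if_true]
  have T2 : ∑ k, ∑ l, s c k * ((if k < i then q - q⁻¹ else 0) • (X k j * X i l)) * s l d =
      ∑ k, (if k < i then q - q⁻¹ else 0) • (s c k * X k j * if i = d then 1 else 0) := by
    refine Finset.sum_congr rfl fun k _ => ?_
    rw [← h2, Finset.mul_sum, Finset.smul_sum]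
    refine Finset.sum_congr rfl fun l _ => ?_
    simp only [mul_smul_comm, smul_mul_assoc, mul_assoc]
  have T3 : ∑ k, ∑ l, s c k * ((if j = l then q else 1) • (X k l * X i j)) * s l d =
      (if j = c then q else 1) • (X i j * s c d) := by
    rw [Finset.sum_comm]
    have : ∀ l, ∑ k, s c k * ((if j = l then q else 1) • (X k l * X i j)) * s l d =
        (if j = l then q else 1) • ((if c = l then 1 else 0) * (X i j * s l d)) := by
      intro l
      rw [← h1, Finset.sum_mul, Finset.smul_sum]
      refine Finset.sum_congr rfl fun l _ => ?_
      simp only [mul_smul_comm, smul_mul_assoc, mul_assoc]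
    simp only [this, ite_mul, one_mul, zero_mul, smul_ite, smul_zero, Finset.sum_ite_eq,
      Finset.mem_univ, if_true]
  have T4 : ∑ k, ∑ l, s c k * ((if j < l then q - q⁻¹ else 0) • (X k j * X i l)) * s l d =
      ∑ l, (if j < l then q - q⁻¹ else 0) • ((if c = j then 1 else 0) * (X i l * s l d)) := by
    rw [Finset.sum_comm]
    refine Finset.sum_congr rfl fun l _ => ?_
    rw [← h1, Finset.sum_mul, Finset.smul_sum]
    refine Finset.sum_congr rfl fun k _ => ?_
    simp only [mul_smul_comm, smul_mul_assoc, mul_assoc]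
  rw [← T1, ← T2, ← T3, ← T4]
  simp only [← Finset.sum_add_distrib, ← add_mul, ← mul_add]
  refine Finset.sum_congr rfl fun k _ => Finset.sum_congr rfl fun l _ => ?_
  rw [hX.rtt hq i k j l]

/-- The weighted partial contraction of a quantum matrix with its inverse is diagonal. -/
lemma sum_weight_antipode {q : F} (hq : q ≠ 0) {X s : Fin N → Fin N → G} (hX : IsQMat q X)
    (h1 : ∀ i j, ∑ k, s i k * X k j = if i = j then 1 else 0)
    (h2 : ∀ i j, ∑ k, X i k * s k j = if i = j then 1 else 0) (a d : Fin N) :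
    ∑ b : Fin N, q⁻¹ ^ (2 * (b.1 + 1)) • (s b d * X a b) =
      if a = d then q⁻¹ ^ (2 * (a.1 + 1)) • (1 : G) else 0 := by
  let Φ : Fin N → Fin N → G := fun a d => ∑ b : Fin N, q⁻¹ ^ (2 * (b.1 + 1)) • (s b d * X a b)
  have key : ∀ i d, (if i = d then q else 1) • Φ i d +
      ∑ k, (if k < i then q - q⁻¹ else 0) • (Φ k k * if i = d then 1 else 0) =
      q⁻¹ • (if i = d then 1 else 0) := by
    intro i d
    have h : ∑ b : Fin N, q⁻¹ ^ (2 * (b.1 + 1)) • ((if i = d then q else 1) • (s b d * X i b) +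
        ∑ k, (if k < i then q - q⁻¹ else 0) • (s b k * X k b * if i = d then 1 else 0)) =
        ∑ b : Fin N, q⁻¹ ^ (2 * (b.1 + 1)) • (q • (X i b * s b d) +
        ∑ l, (if b < l then q - q⁻¹ else 0) • (X i l * s l d)) := by
      refine Finset.sum_congr rfl fun b _ => ?_
      have := exchange_antipode hq hX h1 h2 i b b d
      simp only [if_true, one_mul] at this
      rw [this]
    have hL : (if i = d then q else 1) • Φ i d +
        ∑ k, (if k < i then q - q⁻¹ else 0) • (Φ k k * if i = d then 1 else 0) =
        ∑ b : Fin N, q⁻¹ ^ (2 * (b.1 + 1)) • ((if i = d then q else 1) • (s b d * X i b) +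
        ∑ k, (if k < i then q - q⁻¹ else 0) • (s b k * X k b * if i = d then 1 else 0)) := by
      simp only [smul_add, Finset.sum_add_distrib, Finset.smul_sum, Φ, Finset.sum_mul]
      congr 1
      · exact Finset.sum_congr rfl fun b _ => smul_comm _ _ _
      · rw [Finset.sum_comm]
        refine Finset.sum_congr rfl fun b _ => Finset.sum_congr rfl fun k _ => ?_
        rw [smul_mul_assoc, smul_comm]
    have hR : ∑ b : Fin N, q⁻¹ ^ (2 * (b.1 + 1)) • (q • (X i b * s b d) +
        ∑ l, (if b < l then q - q⁻¹ else 0) • (X i l * s l d)) =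
        q⁻¹ • (if i = d then 1 else 0) := by
      rw [← h2, Finset.smul_sum]
      simp only [smul_add, Finset.sum_add_distrib, Finset.smul_sum]
      rw [Finset.sum_comm (f := fun b l => q⁻¹ ^ (2 * (b.1 + 1)) •
        ((if b < l then q - q⁻¹ else 0) • (X i l * s l d))), ← Finset.sum_add_distrib]
      refine Finset.sum_congr rfl fun l _ => ?_
      simp only [smul_smul]
      rw [← Finset.sum_smul, ← add_smul]
      congr 1
      conv_rhs => rw [← weight_telescope hq l]
      congr 1
      exact Finset.sum_congr rfl fun b _ => mul_comm _ _
    rw [hL, h, hR]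
  change Φ a d = _
  by_cases had : a = d
  · subst had
    rw [if_pos rfl]
    induction hn : a.1 using Nat.strong_induction_on generalizing a with
    | _ n ih =>
      have h := key a a
      simp only [if_true, mul_one] at h
      have h3 : ∑ k, (if k < a then q - q⁻¹ else 0) • Φ k k =
          (∑ k : Fin N, (if k < a then q - q⁻¹ else 0) * q⁻¹ ^ (2 * (k.1 + 1))) • (1 : G) := by
        rw [Finset.sum_smul]
        refine Finset.sum_congr rfl fun k _ => ?_
        by_cases hk : k < a
        · rw [ih k.1 (by rw [← hn]; exact hk) k rfl, smul_smul]
        · simp [hk]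
      have h4 : ∑ k : Fin N, (if k < a then q - q⁻¹ else 0) * q⁻¹ ^ (2 * (k.1 + 1)) =
          q⁻¹ - q⁻¹ ^ (2 * (a.1 + 1)) * q := by
        rw [eq_sub_iff_add_eq', weight_telescope hq a]
      rw [h3, h4, sub_smul] at h
      have h5 : q • Φ a a = q • (q⁻¹ ^ (2 * (a.1 + 1)) • (1 : G)) := by
        rw [smul_smul, mul_comm q]
        have := eq_sub_of_add_eq h
        rw [this]
        abel
      rw [← hn]
      exact smul_right_injective G hq h5
  · have h := key a d
    simpa [had] using h

end Antipode

section Coinvariance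

variable {N : ℕ} {F : Type} [Field F] {M G : Type} [Ring M] [Algebra F M] [Ring G] [Algebra F G]

/-- The linear map `(u ⊗ v) ⊗ w ↦ e(v) S(ι u) ι(w)`. -/
def conjEval (ι : M →ₐ[F] G) (St : G →ₗ[F] G) (e : M →ₐ[F] F) : (M ⊗[F] M) ⊗[F] M →ₗ[F] G :=
  (TensorProduct.lid F G).toLinearMap ∘ₗ TensorProduct.map e.toLinearMap LinearMap.id ∘ₗ
  TensorProduct.map LinearMap.id (LinearMap.mul' F G) ∘ₗ
  (TensorProduct.assoc F M G G).toLinearMap ∘ₗ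
  TensorProduct.map
    ((TensorProduct.comm F G M).toLinearMap ∘ₗ
      TensorProduct.map (St ∘ₗ ι.toLinearMap) LinearMap.id)
    ι.toLinearMap

lemma conjEval_tmul (ι : M →ₐ[F] G) (St : G →ₗ[F] G) (e : M →ₐ[F] F) (u v w : M) :
    conjEval ι St e ((u ⊗ₜ v) ⊗ₜ w) = e v • (St (ι u) * ι w) := by
  simp [conjEval]

lemma conjEval_mul (ι : M →ₐ[F] G) (St : G →ₗ[F] G) (e : M →ₐ[F] F)
    (hSt : ∀ a b, St (a * b) = St b * St a) (z : (M ⊗[F] M) ⊗[F] M) (u v w : M) :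
    conjEval ι St e (z * ((u ⊗ₜ v) ⊗ₜ w)) =
      e v • (St (ι u) * conjEval ι St e z * ι w) := by
  induction z using TensorProduct.induction_on with
  | zero => simp
  | add a b ha hb => simp only [add_mul, mul_add, map_add, ha, hb, smul_add]
  | tmul a c =>
    induction a using TensorProduct.induction_on with
    | zero => simp
    | add a b ha hb =>
      simp only [add_mul, mul_add, TensorProduct.add_tmul, map_add, ha, hb, smul_add]
    | tmul a b =>
      simp only [Algebra.TensorProduct.tmul_mul_tmul, conjEval_tmul, map_mul, hSt,
        mul_smul_comm, smul_mul_assoc, smul_smul, mul_assoc]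
      rw [mul_comm (e b)]

lemma coorbit_eq_conjEval (ΔM : M →ₐ[F] M ⊗[F] M) (ι : M →ₐ[F] G) (St : G →ₗ[F] G)
    (e : M →ₐ[F] F) (m : M) :
    coorbit e (adjBeta ΔM ι St) m =
      conjEval ι St e (((Algebra.TensorProduct.map ΔM (AlgHom.id F M)).comp ΔM) m) := rfl

lemma coorbit_one (ΔM : M →ₐ[F] M ⊗[F] M) (ι : M →ₐ[F] G) (St : G →ₗ[F] G)
    (e : M →ₐ[F] F) (h1 : St 1 = 1) : coorbit e (adjBeta ΔM ι St) 1 = 1 := by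
  rw [coorbit_eq_conjEval, map_one, Algebra.TensorProduct.one_def, Algebra.TensorProduct.one_def,
    conjEval_tmul]
  simp [h1]

lemma coorbit_mul_gen (ΔM : M →ₐ[F] M ⊗[F] M) (ι : M →ₐ[F] G) (St : G →ₗ[F] G)
    (e : M →ₐ[F] F) (hSt : ∀ a b, St (a * b) = St b * St a) {x : Fin N → Fin N → M}
    (hΔ : ∀ i j, ΔM (x i j) = ∑ k, x i k ⊗ₜ[F] x k j) (m : M) (i j : Fin N) :
    coorbit e (adjBeta ΔM ι St) (m * x i j) =
      ∑ a, ∑ b, e (x a b) •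
        (St (ι (x i a)) * coorbit e (adjBeta ΔM ι St) m * ι (x b j)) := by
  simp only [coorbit_eq_conjEval]
  rw [map_mul]
  have : ((Algebra.TensorProduct.map ΔM (AlgHom.id F M)).comp ΔM) (x i j) =
      ∑ b, ∑ a, (x i a ⊗ₜ[F] x a b) ⊗ₜ[F] x b j := by
    rw [AlgHom.comp_apply, hΔ, map_sum]
    simp only [Algebra.TensorProduct.map_tmul, hΔ, AlgHom.id_apply, TensorProduct.sum_tmul]
  rw [this, Finset.mul_sum, map_sum, Finset.sum_comm]
  refine Finset.sum_congr rfl fun b _ => ?_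
  rw [Finset.mul_sum, map_sum]
  exact Finset.sum_congr rfl fun a _ => conjEval_mul ι St e hSt _ _ _ _

section Words

variable {Y : Type} [Ring Y]

lemma word_zero (y : Fin N → Fin N → Y) (b c : Fin 0 → Fin N) : word y b c = 1 := rfl

lemma word_succ_last {t : ℕ} (y : Fin N → Fin N → Y) (b c : Fin (t + 1) → Fin N) :
    word y b c = word y (b ∘ Fin.castSucc) (c ∘ Fin.castSucc) *
      y (b (Fin.last t)) (c (Fin.last t)) := by
  simp [word, List.finRange_succ_last, Function.comp_def]

lemma word_succ_first {t : ℕ} (y : Fin N → Fin N → Y) (b c : Fin (t + 1) → Fin N) :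
    word y b c = y (b 0) (c 0) * word y (b ∘ Fin.succ) (c ∘ Fin.succ) := by
  simp [word, List.finRange_succ, Function.comp_def]

lemma sum_snoc {t : ℕ} {Z : Type} [AddCommMonoid Z] (f : (Fin (t + 1) → Fin N) → Z) :
    ∑ a, f a = ∑ l : Fin N, ∑ a : Fin t → Fin N, f (Fin.snoc a l) := by
  rw [← (Fin.snocEquiv fun _ : Fin (t + 1) => Fin N).sum_comp, Fintype.sum_prod_type]
  rfl

lemma sum_cons {t : ℕ} {Z : Type} [AddCommMonoid Z] (f : (Fin (t + 1) → Fin N) → Z) :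
    ∑ a, f a = ∑ l : Fin N, ∑ a : Fin t → Fin N, f (Fin.cons l a) := by
  rw [← (Fin.consEquiv fun _ : Fin (t + 1) => Fin N).sum_comp, Fintype.sum_prod_type]
  rfl

lemma snoc_comp_castSucc {t : ℕ} (a : Fin t → Fin N) (l : Fin N) :
    (Fin.snoc a l : Fin (t + 1) → Fin N) ∘ Fin.castSucc = a := by
  funext k
  simp

lemma cons_comp_succ {t : ℕ} (a : Fin t → Fin N) (l : Fin N) :
    (Fin.cons l a : Fin (t + 1) → Fin N) ∘ Fin.succ = a := by
  funext k
  simp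

/-- The reversed word in the entries of `s`. -/
def revWord {t : ℕ} (s : Fin N → Fin N → Y) (b c : Fin t → Fin N) : Y :=
  MulOpposite.unop (word (fun i j => MulOpposite.op (s i j)) b c)

lemma revWord_succ_last {t : ℕ} (s : Fin N → Fin N → Y) (b c : Fin (t + 1) → Fin N) :
    revWord s b c = s (b (Fin.last t)) (c (Fin.last t)) *
      revWord s (b ∘ Fin.castSucc) (c ∘ Fin.castSucc) := by
  simp [revWord, word_succ_last]

lemma revWord_succ_first {t : ℕ} (s : Fin N → Fin N → Y) (b c : Fin (t + 1) → Fin N) :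
    revWord s b c = revWord s (b ∘ Fin.succ) (c ∘ Fin.succ) * s (b 0) (c 0) := by
  simp [revWord, word_succ_first]

end Words

lemma coorbit_word (ΔM : M →ₐ[F] M ⊗[F] M) (ι : M →ₐ[F] G) (St : G →ₗ[F] G)
    (e : M →ₐ[F] F) (hSt : ∀ a b, St (a * b) = St b * St a) (h1 : St 1 = 1)
    {x : Fin N → Fin N → M} (hΔ : ∀ i j, ΔM (x i j) = ∑ k, x i k ⊗ₜ[F] x k j)
    {t : ℕ} (i j : Fin t → Fin N) :
    coorbit e (adjBeta ΔM ι St) (word x i j) =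
      ∑ a, ∑ b, word (fun k l => e (x k l)) a b •
        (revWord (fun k l => St (ι (x k l))) i a * word (fun k l => ι (x k l)) b j) := by
  induction t with
  | zero =>
    rw [word_zero, coorbit_one ΔM ι St e h1]
    simp [revWord, word_zero]
  | succ t ih =>
    rw [word_succ_last, coorbit_mul_gen ΔM ι St e hSt hΔ, ih, sum_snoc]
    refine Finset.sum_congr rfl fun a _ => ?_
    have : ∀ a' : Fin t → Fin N, ∑ b : Fin (t + 1) → Fin N,
        word (fun k l => e (x k l)) (Fin.snoc a' a) b •
        (revWord (fun k l => St (ι (x k l))) i (Fin.snoc a' a) *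
          word (fun k l => ι (x k l)) b j) =
        ∑ b, ∑ b' : Fin t → Fin N, e (x a b) • (St (ι (x (i (Fin.last t)) a)) *
          (word (fun k l => e (x k l)) a' b' •
          (revWord (fun k l => St (ι (x k l))) (i ∘ Fin.castSucc) a' *
          word (fun k l => ι (x k l)) b' (j ∘ Fin.castSucc))) * ι (x b (j (Fin.last t)))) := by
      intro a'
      rw [sum_snoc]
      refine Finset.sum_congr rfl fun b _ => Finset.sum_congr rfl fun b' _ => ?_
      rw [word_succ_last, word_succ_last, revWord_succ_last]
      simp only [snoc_comp_castSucc, Fin.snoc_last, mul_smul_comm, smul_mul_assoc, smul_smul,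
        mul_assoc]
      rw [mul_comm (e (x a b))]
    simp only [this]
    refine Eq.trans (Finset.sum_congr rfl fun b _ => ?_) Finset.sum_comm
    simp only [Finset.mul_sum, Finset.sum_mul, Finset.smul_sum]

/-- The weight of a sequence of indices. -/
def seqWt (q : F) {t : ℕ} (b : Fin t → Fin N) : F := ∏ k, q⁻¹ ^ (2 * ((b k).1 + 1))

lemma sum_revWord_word {q : F} (hq : q ≠ 0) {X s : Fin N → Fin N → G} (hX : IsQMat q X)
    (h1 : ∀ i j, ∑ k, s i k * X k j = if i = j then 1 else 0)
    (h2 : ∀ i j, ∑ k, X i k * s k j = if i = j then 1 else 0) {t : ℕ} (a c : Fin t → Fin N) :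
    ∑ b, seqWt q b • (revWord s b a * word X c b) = if a = c then seqWt q c • 1 else 0 := by
  induction t with
  | zero => simp [revWord, word_zero, Subsingleton.elim a c, seqWt]
  | succ t ih =>
    rw [sum_cons, Finset.sum_comm]
    have h : ∀ b : Fin t → Fin N, ∑ l : Fin N, seqWt q (Fin.cons l b : Fin (t + 1) → Fin N) •
        (revWord s (Fin.cons l b) a * word X c (Fin.cons l b)) =
        (if a 0 = c 0 then q⁻¹ ^ (2 * ((c 0).1 + 1)) else 0) •
          (seqWt q b • (revWord s b (a ∘ Fin.succ) * word X (c ∘ Fin.succ) b)) := by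
      intro b
      have h3 := sum_weight_antipode hq hX h1 h2 (c 0) (a 0)
      have h4 : (if a 0 = c 0 then q⁻¹ ^ (2 * ((c 0).1 + 1)) else 0) •
          (seqWt q b • (revWord s b (a ∘ Fin.succ) * word X (c ∘ Fin.succ) b)) =
          seqWt q b • (revWord s b (a ∘ Fin.succ) *
            (if c 0 = a 0 then q⁻¹ ^ (2 * ((c 0).1 + 1)) • (1 : G) else 0) *
              word X (c ∘ Fin.succ) b) := by
        by_cases hac : a 0 = c 0
        · simp only [hac, if_true, mul_smul_comm, smul_mul_assoc, mul_one]
          rw [smul_comm]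
        · simp [hac, Ne.symm hac]
      rw [h4, ← h3, Finset.mul_sum, Finset.sum_mul, Finset.smul_sum]
      refine Finset.sum_congr rfl fun l _ => ?_
      rw [revWord_succ_first, word_succ_first, cons_comp_succ]
      simp only [Fin.cons_zero, seqWt, Fin.prod_univ_succ, Fin.cons_succ, mul_smul_comm,
        smul_mul_assoc, smul_smul, mul_assoc]
      rw [mul_comm (∏ _, _)]
    simp only [h]
    rw [← Finset.smul_sum, ih]
    by_cases h0 : a 0 = c 0
    · by_cases hs : a ∘ Fin.succ = c ∘ Fin.succ
      · have hac : a = c := by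
          funext k
          refine Fin.cases h0 (fun k => congrFun hs k) k
        subst hac
        simp [smul_smul, seqWt, Fin.prod_univ_succ, mul_comm]
      · have hac : a ≠ c := fun h => hs (by rw [h])
        simp [hs, hac]
    · have hac : a ≠ c := fun h => h0 (by rw [h])
      simp [h0, hac]

lemma map_word {Y Y' : Type} [Ring Y] [Ring Y'] (f : Y →+* Y') (y : Fin N → Fin N → Y) {t : ℕ}
    (b c : Fin t → Fin N) : f (word y b c) = word (fun i j => f (y i j)) b c := by
  simp [word, map_list_prod, List.map_map, Function.comp_def]

lemma map_seqMinor {Y Y' : Type} [Ring Y] [Algebra F Y] [Ring Y'] [Algebra F Y'] (f : Y →ₐ[F] Y')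
    (q : F) (y : Fin N → Fin N → Y) {t : ℕ} (b c : Fin t → Fin N) :
    f (seqMinor q y b c) = seqMinor q (fun i j => f (y i j)) b c := by
  simp only [seqMinor, map_sum, map_smul]
  exact Finset.sum_congr rfl fun σ _ => congrArg _ (map_word (f : Y →+* Y') y b (c ∘ σ))

/-- `τ_t` as a sum over increasing sequences. -/
lemma tauCoinv_eq_sum_incSeq (q : F) (x : Fin N → Fin N → M) (t : ℕ) :
    tauCoinv q q⁻¹ x t = ∑ B ∈ incSeq t N, seqWt q B • seqMinor q x B B := by
  rw [tauCoinv]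
  refine Finset.sum_bij' (fun I hI k => nthElt I (Fin.cast (Finset.mem_filter.1 hI).2.symm k))
    (fun B _ => Finset.univ.image B) ?_ ?_ ?_ ?_ ?_
  · intro I hI
    exact mem_incSeq.2 fun k l hkl => nthElt_strictMono I (by simpa using hkl)
  · intro B hB
    rw [mem_incSeq] at hB
    simp [Finset.card_image_of_injective _ hB.injective]
  · intro I hI
    ext j
    simp only [Finset.mem_image, Finset.mem_univ, true_and]
    constructor
    · rintro ⟨k, rfl⟩
      exact nthElt_mem I _
    · intro hj
      obtain ⟨k, hk⟩ := exists_nthElt hj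
      exact ⟨Fin.cast (Finset.mem_filter.1 hI).2 k, by simpa using hk⟩
  · intro B hB
    have hB' := mem_incSeq.1 hB
    apply (StrictMono.range_inj _ hB').1
    · ext j
      simp only [Set.mem_range]
      constructor
      · rintro ⟨k, rfl⟩
        have := nthElt_mem (Finset.univ.image B) (Fin.cast (by
          simp [Finset.card_image_of_injective _ hB'.injective]) k)
        simpa using this
      · rintro ⟨k, rfl⟩
        obtain ⟨l, hl⟩ := exists_nthElt (I := Finset.univ.image B) (x := B k) (by simp)
        exact ⟨Fin.cast (by simp [Finset.card_image_of_injective _ hB'.injective]) l,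
          by simpa using hl⟩
    · intro k l hkl
      exact nthElt_strictMono _ (by simpa using hkl)
  · intro I hI
    obtain rfl := (Finset.mem_filter.1 hI).2
    congr 1
    rw [seqWt, wtSet, Finset.mul_sum, ← Finset.prod_pow_eq_pow_sum, ← Finset.prod_coe_sort,
      ← (I.orderIsoOfFin rfl).toEquiv.prod_comp]
    rfl

/-- `τ_t` is mapped to a scalar by the co-orbit map. -/
lemma coorbit_tauCoinv {q : F} (hq : q ≠ 0) (ΔM : M →ₐ[F] M ⊗[F] M) (ι : M →ₐ[F] G)
    (St : G →ₗ[F] G) (e : M →ₐ[F] F) (hSt : ∀ a b, St (a * b) = St b * St a) (h1 : St 1 = 1)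
    {x : Fin N → Fin N → M} (hx : IsQMat q x)
    (hΔ : ∀ i j, ΔM (x i j) = ∑ k, x i k ⊗ₜ[F] x k j)
    (hs1 : ∀ i j, ∑ k, St (ι (x i k)) * ι (x k j) = if i = j then 1 else 0)
    (hs2 : ∀ i j, ∑ k, ι (x i k) * St (ι (x k j)) = if i = j then 1 else 0) (t : ℕ) :
    coorbit e (adjBeta ΔM ι St) (tauCoinv q q⁻¹ x t) =
      algebraMap F G (e (tauCoinv q q⁻¹ x t)) := by
  let s : Fin N → Fin N → G := fun i j => St (ι (x i j))
  let X : Fin N → Fin N → G := fun i j => ι (x i j)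
  let E : Fin N → Fin N → F := fun i j => e (x i j)
  have hX : IsQMat q X := hx.map ι
  have hE : IsQMat q E := hx.map e
  let f : M →ₐ[F] Gᵐᵒᵖ := AlgHom.ofLinearMap
    ((MulOpposite.opLinearEquiv F).toLinearMap ∘ₗ St ∘ₗ ι.toLinearMap) (by simp [h1])
    (fun a b => by simp [hSt])
  have hs : IsQMat q (fun i j => MulOpposite.op (s i j)) := hx.map f
  let R : (Fin t → Fin N) → (Fin t → Fin N) → G := fun B A =>
    MulOpposite.unop (seqMinor q (fun i j => MulOpposite.op (s i j)) B A)
  have hR : ∀ B A, R B A = ∑ σ : Equiv.Perm (Fin t), (-q) ^ invCount σ • revWord s B (A ∘ σ) := by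
    intro B A
    simp [R, seqMinor, revWord]
  have hDX : ∀ B ∈ incSeq t N, QAnti q (fun b => seqMinor q X b B) := fun B hB =>
    hX.seqMinor_anti hq (mem_incSeq.1 hB)
  have hRanti : ∀ A ∈ incSeq t N, QAnti q (fun b => R b A) := by
    intro A hA k k' hk b
    obtain ⟨h3, h4⟩ := hs.seqMinor_anti hq (mem_incSeq.1 hA) k k' hk b
    exact ⟨fun h => congrArg MulOpposite.unop (h3 h), fun h => congrArg MulOpposite.unop (h4 h)⟩
  have inner : ∀ A ∈ incSeq t N, ∀ C ∈ incSeq t N,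
      ∑ B ∈ incSeq t N, seqWt q B • (R B A * seqMinor q X C B) =
        if A = C then seqWt q C • 1 else 0 := by
    intro A hA C hC
    have h3 : ∑ b, seqWt q b • (R b A * word X C b) =
        ∑ B ∈ incSeq t N, seqWt q B • (R B A * seqMinor q X C B) := by
      rw [sum_eq_sum_incSeq _ fun b hb => by
        rw [show R b A = 0 from (hRanti A hA).eq_zero b hb, zero_mul, smul_zero]]
      refine Finset.sum_congr rfl fun B hB => ?_
      rw [seqMinor, Finset.mul_sum, Finset.smul_sum]
      refine Finset.sum_congr rfl fun σ _ => ?_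
      have h5 : seqWt q (B ∘ σ) = seqWt q B :=
        Equiv.prod_comp σ fun k => q⁻¹ ^ (2 * ((B k).1 + 1))
      rw [show R (B ∘ σ) A = (-q) ^ invCount σ • R B A from
        (hRanti A hA).comp_perm (mem_incSeq.1 hB) σ, h5, smul_mul_assoc, mul_smul_comm]
    rw [← h3]
    simp only [hR, Finset.sum_mul, Finset.smul_sum]
    rw [Finset.sum_comm]
    have h4 : ∀ σ : Equiv.Perm (Fin t), ∑ b, seqWt q b •
        ((-q) ^ invCount σ • revWord s b (A ∘ σ) * word X C b) =
        (-q) ^ invCount σ • if A ∘ σ = C then seqWt q C • (1 : G) else 0 := by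
      intro σ
      rw [← sum_revWord_word hq hX hs1 hs2, Finset.smul_sum]
      refine Finset.sum_congr rfl fun b _ => ?_
      rw [smul_mul_assoc, smul_comm]
    simp only [h4]
    rw [Finset.sum_eq_single 1]
    · have h0 : invCount (1 : Equiv.Perm (Fin t)) = 0 := by
        rw [invCount, Finset.card_eq_zero, Finset.filter_eq_empty_iff]
        rintro p - ⟨h, h'⟩
        exact lt_asymm h h'
      rw [h0]
      simp
    · intro σ _ hσ
      rw [if_neg, smul_zero]
      intro h
      apply hσ
      have hA' := mem_incSeq.1 hA
      apply perm_eq_one_of_strictMono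
      intro k l hkl
      have : (A ∘ σ) k < (A ∘ σ) l := by rw [h]; exact mem_incSeq.1 hC hkl
      exact hA'.lt_iff_lt.1 this
    · simp
  have expand : ∀ B ∈ incSeq t N, coorbit e (adjBeta ΔM ι St) (seqMinor q x B B) =
      ∑ A ∈ incSeq t N, ∑ C ∈ incSeq t N, seqMinor q E A C • (R B A * seqMinor q X C B) := by
    intro B hB
    have h3 : coorbit e (adjBeta ΔM ι St) (seqMinor q x B B) =
        ∑ a, ∑ b, word E a b • (revWord s B a * seqMinor q X b B) := by
      simp only [seqMinor, map_sum, map_smul, coorbit_word ΔM ι St e hSt h1 hΔ, Finset.mul_sum,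
        Finset.smul_sum]
      rw [Finset.sum_comm]
      refine Finset.sum_congr rfl fun a _ => ?_
      rw [Finset.sum_comm]
      refine Finset.sum_congr rfl fun b _ => Finset.sum_congr rfl fun σ _ => ?_
      rw [mul_smul_comm, smul_comm]
    have h4 : ∀ a, ∑ b, word E a b • (revWord s B a * seqMinor q X b B) =
        ∑ C ∈ incSeq t N, seqMinor q E a C • (revWord s B a * seqMinor q X C B) := by
      intro a
      rw [sum_eq_sum_incSeq _ fun b hb => by
        rw [show seqMinor q X b B = 0 from (hDX B hB).eq_zero b hb, mul_zero, smul_zero]]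
      refine Finset.sum_congr rfl fun C hC => ?_
      rw [seqMinor, Finset.sum_smul]
      refine Finset.sum_congr rfl fun σ _ => ?_
      rw [show seqMinor q X (C ∘ σ) B = (-q) ^ invCount σ • seqMinor q X C B from
        (hDX B hB).comp_perm (mem_incSeq.1 hC) σ, mul_smul_comm, smul_smul, smul_eq_mul, mul_comm]
    rw [h3]
    simp only [h4]
    rw [Finset.sum_comm]
    refine Eq.trans (Finset.sum_congr rfl fun C hC => ?_) Finset.sum_comm
    have hEC := hE.seqMinor_anti hq (mem_incSeq.1 hC)
    rw [sum_eq_sum_incSeq _ fun b hb => by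
      rw [show seqMinor q E b C = 0 from hEC.eq_zero b hb, zero_smul]]
    refine Finset.sum_congr rfl fun A hA => ?_
    rw [hR, Finset.sum_mul, Finset.smul_sum]
    refine Finset.sum_congr rfl fun σ _ => ?_
    rw [show seqMinor q E (A ∘ σ) C = (-q) ^ invCount σ • seqMinor q E A C from
      hEC.comp_perm (mem_incSeq.1 hA) σ, smul_mul_assoc, smul_smul, smul_eq_mul, mul_comm]
  rw [tauCoinv_eq_sum_incSeq]
  simp only [map_sum, map_smul, map_seqMinor]
  have h3 : ∑ B ∈ incSeq t N, seqWt q B • coorbit e (adjBeta ΔM ι St) (seqMinor q x B B) =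
      ∑ A ∈ incSeq t N, ∑ C ∈ incSeq t N, seqMinor q E A C •
        ∑ B ∈ incSeq t N, seqWt q B • (R B A * seqMinor q X C B) := by
    rw [Finset.sum_congr rfl fun B hB => by rw [expand B hB]]
    simp only [Finset.smul_sum]
    rw [Finset.sum_comm]
    refine Finset.sum_congr rfl fun A _ => ?_
    rw [Finset.sum_comm]
    refine Finset.sum_congr rfl fun C _ => Finset.sum_congr rfl fun B _ => ?_
    rw [smul_comm]
  rw [h3]
  refine Finset.sum_congr rfl fun A hA => ?_
  rw [Finset.sum_congr rfl fun C hC => by rw [inner A hA C hC], Finset.sum_eq_single A]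
  · simp [Algebra.algebraMap_eq_smul_one, smul_smul, mul_comm, E]
  · intro C _ hC
    rw [if_neg (Ne.symm hC), smul_zero]
  · exact fun h => absurd hA h

end Coinvariance

section HopfData

variable {N : ℕ} {F : Type} [Field F] {M G : Type} [Ring M] [Algebra F M] [Ring G] [Algebra F G]

/-- Algebra maps out of the localisation are determined by the generators. -/
lemma algHom_ext_localization {q : F} {x : Fin N → Fin N → M} {ι : M →ₐ[F] G} {dInv : G}
    (hgenM : Algebra.adjoin F (Set.range fun p : Fin N × Fin N => x p.1 p.2) = ⊤)
    (hd1 : ι (qdet q x) * dInv = 1) (hd2 : dInv * ι (qdet q x) = 1)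
    (hgen : Algebra.adjoin F
      (Set.range (fun p : Fin N × Fin N => ι (x p.1 p.2)) ∪ {dInv}) = ⊤)
    {B : Type} [Ring B] [Algebra F B] {f g : G →ₐ[F] B}
    (h : ∀ i j, f (ι (x i j)) = g (ι (x i j))) : f = g := by
  have h1 : f.comp ι = g.comp ι := by
    refine AlgHom.ext_of_adjoin_eq_top hgenM ?_
    rintro _ ⟨p, rfl⟩
    exact h p.1 p.2
  refine AlgHom.ext_of_adjoin_eq_top hgen ?_
  rintro _ (⟨p, rfl⟩ | rfl)
  · exact h p.1 p.2
  · have h2 : f (ι (qdet q x)) = g (ι (qdet q x)) := DFunLike.congr_fun h1 _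
    refine left_inv_eq_right_inv (a := f (ι (qdet q x))) ?_ ?_
    · rw [← map_mul, hd2, map_one]
    · rw [h2, ← map_mul, hd1, map_one]

lemma antipode_mul {q : F} {x : Fin N → Fin N → M} {ι : M →ₐ[F] G} {dInv : G}
    (hgenM : Algebra.adjoin F (Set.range fun p : Fin N × Fin N => x p.1 p.2) = ⊤)
    (hd1 : ι (qdet q x) * dInv = 1) (hd2 : dInv * ι (qdet q x) = 1)
    (hgen : Algebra.adjoin F
      (Set.range (fun p : Fin N × Fin N => ι (x p.1 p.2)) ∪ {dInv}) = ⊤)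
    {Δ : G →ₐ[F] G ⊗[F] G} (hΔ : ∀ i j, Δ (ι (x i j)) = ∑ k, ι (x i k) ⊗ₜ[F] ι (x k j))
    {ε : G →ₐ[F] F} (hε : ∀ i j, ε (ι (x i j)) = if i = j then 1 else 0)
    {St : G →ₗ[F] G}
    (hS1 : LinearMap.mul' F G ∘ₗ TensorProduct.map St LinearMap.id ∘ₗ Δ.toLinearMap
      = Algebra.linearMap F G ∘ₗ ε.toLinearMap)
    (hS2 : LinearMap.mul' F G ∘ₗ TensorProduct.map LinearMap.id St ∘ₗ Δ.toLinearMap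
      = Algebra.linearMap F G ∘ₗ ε.toLinearMap) :
    (∀ a b, St (a * b) = St b * St a) ∧ St 1 = 1 := by
  refine antipode_mul_of_hopf Δ ε St ?_ ?_ ?_ hS1 hS2
  · refine algHom_ext_localization hgenM hd1 hd2 hgen fun i j => ?_
    simp only [AlgHom.comp_apply, hΔ, map_sum, Algebra.TensorProduct.map_tmul, AlgHom.id_apply,
      TensorProduct.sum_tmul, TensorProduct.tmul_sum]
    rw [Finset.sum_comm]
    rfl
  · refine algHom_ext_localization hgenM hd1 hd2 hgen fun i j => ?_
    simp [hΔ, hε, TensorProduct.ite_tmul]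
  · refine algHom_ext_localization hgenM hd1 hd2 hgen fun i j => ?_
    simp [hΔ, hε, TensorProduct.tmul_ite]

lemma antipode_mul_gen {x : Fin N → Fin N → M} {ι : M →ₐ[F] G}
    {Δ : G →ₐ[F] G ⊗[F] G} (hΔ : ∀ i j, Δ (ι (x i j)) = ∑ k, ι (x i k) ⊗ₜ[F] ι (x k j))
    {ε : G →ₐ[F] F} (hε : ∀ i j, ε (ι (x i j)) = if i = j then 1 else 0)
    {St : G →ₗ[F] G}
    (hS1 : LinearMap.mul' F G ∘ₗ TensorProduct.map St LinearMap.id ∘ₗ Δ.toLinearMap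
      = Algebra.linearMap F G ∘ₗ ε.toLinearMap) (i j : Fin N) :
    ∑ k, St (ι (x i k)) * ι (x k j) = if i = j then 1 else 0 := by
  have := LinearMap.congr_fun hS1 (ι (x i j))
  simpa [hΔ, hε, apply_ite (algebraMap F G)] using this

lemma mul_antipode_gen {x : Fin N → Fin N → M} {ι : M →ₐ[F] G}
    {Δ : G →ₐ[F] G ⊗[F] G} (hΔ : ∀ i j, Δ (ι (x i j)) = ∑ k, ι (x i k) ⊗ₜ[F] ι (x k j))
    {ε : G →ₐ[F] F} (hε : ∀ i j, ε (ι (x i j)) = if i = j then 1 else 0)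
    {St : G →ₗ[F] G}
    (hS2 : LinearMap.mul' F G ∘ₗ TensorProduct.map LinearMap.id St ∘ₗ Δ.toLinearMap
      = Algebra.linearMap F G ∘ₗ ε.toLinearMap) (i j : Fin N) :
    ∑ k, ι (x i k) * St (ι (x k j)) = if i = j then 1 else 0 := by
  have := LinearMap.congr_fun hS2 (ι (x i j))
  simpa [hΔ, hε, apply_ite (algebraMap F G)] using this

/-- Products of generators span the algebra. -/
lemma span_words_eq_top {x : Fin N → Fin N → M}
    (hgen : Algebra.adjoin F (Set.range fun p : Fin N × Fin N => x p.1 p.2) = ⊤) :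
    Submodule.span F (Set.range fun l : List (Fin N × Fin N) => (l.map fun p => x p.1 p.2).prod)
      = ⊤ := by
  rw [← top_le_iff, ← Algebra.top_toSubmodule, ← hgen, Algebra.adjoin_eq_span]
  refine Submodule.span_mono ?_
  intro m hm
  induction hm using Submonoid.closure_induction with
  | mem m hm =>
    obtain ⟨p, rfl⟩ := hm
    exact ⟨[p], by simp⟩
  | one => exact ⟨[], rfl⟩
  | mul a b _ _ ha hb =>
    obtain ⟨l, rfl⟩ := ha
    obtain ⟨l', rfl⟩ := hb
    exact ⟨l ++ l', by simp⟩

/-- The kernel of the co-orbit map is stable under right multiplication, in the following sense. -/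
lemma coorbit_mul_eq_zero (ΔM : M →ₐ[F] M ⊗[F] M) (ι : M →ₐ[F] G) (St : G →ₗ[F] G)
    (e : M →ₐ[F] F) (hSt : ∀ a b, St (a * b) = St b * St a) {x : Fin N → Fin N → M}
    (hgen : Algebra.adjoin F (Set.range fun p : Fin N × Fin N => x p.1 p.2) = ⊤)
    (hΔ : ∀ i j, ΔM (x i j) = ∑ k, x i k ⊗ₜ[F] x k j) {m : M}
    (hm : coorbit e (adjBeta ΔM ι St) m = 0) (h : M) :
    coorbit e (adjBeta ΔM ι St) (m * h) = 0 := by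
  have hh : h ∈ Submodule.span F
      (Set.range fun l : List (Fin N × Fin N) => (l.map fun p => x p.1 p.2).prod) := by
    rw [span_words_eq_top hgen]
    trivial
  induction hh using Submodule.span_induction with
  | mem h hh =>
    obtain ⟨l, rfl⟩ := hh
    induction l using List.reverseRecOn with
    | nil => simpa using hm
    | append_singleton l p ih =>
      simp only [List.map_append, List.prod_append, List.map_cons, List.map_nil,
        List.prod_singleton, ← mul_assoc] at ih ⊢
      rw [coorbit_mul_gen ΔM ι St e hSt hΔ, ih]
      simp
  | zero => simp
  | add a b _ _ ha hb => rw [mul_add, map_add, ha, hb, add_zero]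
  | smul c a _ ha => rw [mul_smul_comm, map_smul, ha, smul_zero]

end HopfData

section Spanning

variable {N : ℕ}

/-- The exponent vector of a list of cells. -/
def listMon (l : List (Fin N × Fin N)) : Fin N × Fin N →₀ ℕ :=
  (l.map fun p => Finsupp.single p 1).sum

/-- A list of cells with prescribed exponent vector. -/
def monList (s : Fin N × Fin N →₀ ℕ) : List (Fin N × Fin N) := (Finsupp.toMultiset s).toList

lemma toMultiset_listMon (l : List (Fin N × Fin N)) : Finsupp.toMultiset (listMon l) = l := by
  induction l with
  | nil => simp [listMon]
  | cons p l ih =>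
    have h : listMon (p :: l) = Finsupp.single p 1 + listMon l := by simp [listMon]
    rw [h, map_add, ih, Finsupp.toMultiset_single, one_smul, Multiset.singleton_add,
      Multiset.cons_coe]

lemma perm_of_listMon_eq {l l' : List (Fin N × Fin N)} (h : listMon l = listMon l') :
    l.Perm l' := by
  rw [← Multiset.coe_eq_coe, ← toMultiset_listMon, h, toMultiset_listMon]

lemma listMon_monList (s : Fin N × Fin N →₀ ℕ) : listMon (monList s) = s := by
  classical
  apply (Finsupp.orderIsoMultiset (ι := Fin N × Fin N)).injective
  simp only [Finsupp.coe_orderIsoMultiset]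
  rw [toMultiset_listMon, monList, Multiset.coe_toList]

lemma listMon_append (l l' : List (Fin N × Fin N)) :
    listMon (l ++ l') = listMon l + listMon l' := by
  simp [listMon]

/-- The list of cells in a term of a principal minor. -/
def minorList (I : Finset (Fin N)) (σ : Equiv.Perm (Fin I.card)) : List (Fin N × Fin N) :=
  (List.finRange I.card).map fun k => (nthElt I k, nthElt I (σ k))

lemma listMon_minorList (I : Finset (Fin N)) (σ : Equiv.Perm (Fin I.card)) :
    listMon (minorList I σ) = minorMon I σ := by
  rw [listMon, minorList, List.map_map, minorMon, Fin.sum_univ_def]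
  rfl

/-- The product of matrix entries along a list of cells. -/
def listProd {Y : Type} [Ring Y] (x : Fin N → Fin N → Y) (l : List (Fin N × Fin N)) : Y :=
  (l.map fun p => x p.1 p.2).prod

lemma listProd_append {Y : Type} [Ring Y] (x : Fin N → Fin N → Y) (l l' : List (Fin N × Fin N)) :
    listProd x (l ++ l') = listProd x l * listProd x l' := by
  simp [listProd]

lemma listProd_minorList {Y : Type} [Ring Y] (x : Fin N → Fin N → Y) (I : Finset (Fin N))
    (σ : Equiv.Perm (Fin I.card)) : listProd x (minorList I σ) = minorProd x I σ := by
  rw [listProd, minorList, List.map_map, minorProd]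
  rfl

variable {F : Type} [Field F] {M : Type} [Ring M] [Algebra F M]
variable {R : Type} [CommRing R]

/-- Generators commute modulo `q - 1`. -/
lemma IsQMat.exists_commutator {T : Rˣ} {θ : R →+* F} {x : Fin N → Fin N → M}
    (hx : IsQMat (θ T) x) (a b : Fin N × Fin N) :
    ∃ r ∈ Ideal.span {(T : R) - 1}, ∃ c d : Fin N × Fin N,
      x a.1 a.2 * x b.1 b.2 - x b.1 b.2 * x a.1 a.2 = θ r • (x c.1 c.2 * x d.1 d.2) := by
  have hmem : (T : R) - 1 ∈ Ideal.span {(T : R) - 1} := Ideal.subset_span rfl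
  have hinv : (θ T)⁻¹ = θ (T⁻¹ : Rˣ) := by
    refine inv_eq_of_mul_eq_one_right ?_
    rw [← map_mul, Units.mul_inv, map_one]
  have swap : ∀ a b : Fin N × Fin N, (∃ r ∈ Ideal.span {(T : R) - 1}, ∃ c d : Fin N × Fin N,
      x a.1 a.2 * x b.1 b.2 - x b.1 b.2 * x a.1 a.2 = θ r • (x c.1 c.2 * x d.1 d.2)) →
      ∃ r ∈ Ideal.span {(T : R) - 1}, ∃ c d : Fin N × Fin N,
      x b.1 b.2 * x a.1 a.2 - x a.1 a.2 * x b.1 b.2 = θ r • (x c.1 c.2 * x d.1 d.2) := by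
    rintro a b ⟨r, hr, c, d, h⟩
    exact ⟨-r, neg_mem hr, c, d, by rw [map_neg, neg_smul, ← h, neg_sub]⟩
  have main : ∀ a b : Fin N × Fin N, a.1 < b.1 ∨ (a.1 = b.1 ∧ a.2 < b.2) →
      ∃ r ∈ Ideal.span {(T : R) - 1}, ∃ c d : Fin N × Fin N,
      x a.1 a.2 * x b.1 b.2 - x b.1 b.2 * x a.1 a.2 = θ r • (x c.1 c.2 * x d.1 d.2) := by
    rintro ⟨i, j⟩ ⟨k, l⟩ (h | ⟨h, h'⟩)
    · rcases lt_trichotomy j l with hjl | hjl | hjl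
      · refine ⟨(T - 1) * (1 + (T⁻¹ : Rˣ)), Ideal.mul_mem_right _ _ hmem, (i, l), (k, j), ?_⟩
        have h1 : θ ((T - 1) * (1 + (T⁻¹ : Rˣ))) = θ T - (θ T)⁻¹ := by
          rw [hinv, ← map_sub]
          congr 1
          have := T.mul_inv
          linear_combination this
        rw [h1]
        exact hx.diag i k j l h hjl
      · subst hjl
        refine ⟨T - 1, hmem, (k, j), (i, j), ?_⟩
        simp only
        rw [hx.col i k j h, map_sub, map_one, sub_smul, one_smul]
      · refine ⟨0, zero_mem _, (i, l), (k, j), ?_⟩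
        simp only
        rw [hx.anti i k l j h hjl, map_zero, zero_smul, sub_self]
    · obtain rfl : i = k := h
      refine ⟨T - 1, hmem, (i, l), (i, j), ?_⟩
      simp only at h' ⊢
      rw [hx.row i j l h', map_sub, map_one, sub_smul, one_smul]
  obtain ⟨i, j⟩ := a
  obtain ⟨k, l⟩ := b
  rcases lt_trichotomy i k with h | rfl | h
  · exact main _ _ (Or.inl h)
  · rcases lt_trichotomy j l with h | rfl | h
    · exact main _ _ (Or.inr ⟨rfl, h⟩)
    · exact ⟨0, zero_mem _, (i, j), (i, j), by simp⟩
    · exact swap _ _ (main _ _ (Or.inr ⟨rfl, h⟩))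
  · exact swap _ _ (main _ _ (Or.inl h))

/-- Modulo the coinvariants, standard monomials span. -/
lemma eq_top_of_stdMon_mem {T : Rˣ} {θ : R →+* F} {x : Fin N → Fin N → M}
    (hx : IsQMat (θ T) x) (hθ : ∀ r, r - 1 ∈ Ideal.span {(T : R) - 1} → θ r ≠ 0)
    (hgen : Algebra.adjoin F (Set.range fun p : Fin N × Fin N => x p.1 p.2) = ⊤)
    (e : M →ₐ[F] F) (ξ : Fin N → Fin N → R) (he : ∀ i j, e (x i j) = θ (ξ i j))
    (V : Submodule F M)
    (hV1 : ∀ t, 1 ≤ t → t ≤ N → ∀ h : M, (tauCoinv (θ T) (θ T)⁻¹ x t -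
      algebraMap F M (e (tauCoinv (θ T) (θ T)⁻¹ x t))) * h ∈ V)
    (hV2 : ∀ s ∈ stdMon N, listProd x (monList s) ∈ V) : V = ⊤ := by
  classical
  have hinv : (θ T)⁻¹ = θ (T⁻¹ : Rˣ) := by
    refine inv_eq_of_mul_eq_one_right ?_
    rw [← map_mul, Units.mul_inv, map_one]
  let _ : Module R (M ⧸ V) := Module.compHom (M ⧸ V) θ
  have hsmul : ∀ (r : R) (z : M ⧸ V), r • z = θ r • z := fun _ _ => rfl
  let z : List (Fin N × Fin N) → M ⧸ V := fun l => V.mkQ (listProd x l)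
  let J : Ideal R := Ideal.span {(T : R) - 1}
  suffices hz : ∀ d : ℕ, ∀ l : List (Fin N × Fin N), l.length ≤ d → z l = 0 by
    rw [← top_le_iff, ← span_words_eq_top hgen, Submodule.span_le]
    rintro _ ⟨l, rfl⟩
    exact (Submodule.Quotient.mk_eq_zero V).1 (hz l.length l le_rfl)
  intro d
  let L : Set (List (Fin N × Fin N)) := {l | l.length ≤ d}
  let W : Submodule R (M ⧸ V) := Submodule.span R (z '' L)
  have hzW : ∀ l, l.length ≤ d → z l ∈ W := fun l hl => Submodule.subset_span ⟨l, hl, rfl⟩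
  have hperm : ∀ l l' : List (Fin N × Fin N), l.Perm l' → ∀ p : List (Fin N × Fin N),
      (p ++ l).length ≤ d → z (p ++ l) - z (p ++ l') ∈ J • W := by
    intro l l' h
    induction h with
    | nil =>
      intro p _
      rw [sub_self]
      exact zero_mem _
    | cons a h ih =>
      intro p hp
      have := ih (p ++ [a]) (by simpa [add_assoc, add_comm] using hp)
      simpa using this
    | swap a b l =>
      intro p hp
      obtain ⟨r, hr, c, c', hc⟩ := hx.exists_commutator b a
      have h1 : z (p ++ b :: a :: l) - z (p ++ a :: b :: l) = r • z (p ++ c :: c' :: l) := by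
        rw [hsmul]
        simp only [z]
        rw [← map_sub, ← map_smul]
        congr 1
        simp only [listProd, List.map_append, List.prod_append, List.map_cons, List.prod_cons]
        rw [← mul_sub, ← mul_assoc, ← mul_assoc, ← sub_mul, hc, smul_mul_assoc, mul_smul_comm,
          mul_assoc]
      rw [h1]
      exact Submodule.smul_mem_smul hr (hzW _ (by simpa using hp))
    | trans h1 h2 ih1 ih2 =>
      intro p hp
      have h3 := ih1 p hp
      have h4 := ih2 p (by simpa [h1.length_eq] using hp)
      simpa using add_mem h3 h4
  have hperm' : ∀ l l' : List (Fin N × Fin N), listMon l = listMon l' → l.length ≤ d →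
      z l' ∈ J • W → z l ∈ J • W := by
    intro l l' h hl h'
    have := hperm l l' (perm_of_listMon_eq h) [] hl
    simpa using add_mem this h'
  have hmain : ∀ n, ∀ l : List (Fin N × Fin N), l.length ≤ d → monWt (listMon l) = n →
      z l ∈ J • W := by
    intro n
    induction n using Nat.strong_induction_on with
    | _ n ih =>
      intro l hl hn
      by_cases hs : listMon l ∈ stdMon N
      · refine hperm' l (monList (listMon l)) (listMon_monList _).symm hl ?_
        have : z (monList (listMon l)) = 0 := (Submodule.Quotient.mk_eq_zero V).2 (hV2 _ hs)
        rw [this]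
        exact zero_mem _
      · obtain ⟨t, ht1, htN, hle⟩ : ∃ t, 1 ≤ t ∧ t ≤ N ∧ antiMon N t ≤ listMon l := by
          by_contra h
          push Not at h
          exact hs h
        obtain ⟨I₀, σ₀, hcard, hmon, hlead⟩ := exists_leading_term htN
        let m' := listMon l - antiMon N t
        let l' := monList m'
        have hml : antiMon N t + m' = listMon l := add_tsub_cancel_of_le hle
        have hmon' : ∀ I σ, listMon (minorList I σ ++ l') = minorMon I σ + m' := fun I σ => by
          rw [listMon_append, listMon_minorList, listMon_monList]
        have hP0 : listMon l = listMon (minorList I₀ σ₀ ++ l') := by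
          rw [hmon', hmon, hml]
        have hlen0 : l.length = t + l'.length := by
          rw [(perm_of_listMon_eq hP0).length_eq]
          simp [minorList, hcard]
        refine hperm' l _ hP0 hl ?_
        let P₀ : Σ I : Finset (Fin N), Equiv.Perm (Fin I.card) := ⟨I₀, σ₀⟩
        let cf : (Σ I : Finset (Fin N), Equiv.Perm (Fin I.card)) → Rˣ := fun P =>
          T⁻¹ ^ (2 * wtSet P.1) * (-T) ^ invCount P.2
        have hcf : ∀ P, (θ T)⁻¹ ^ (2 * wtSet P.1) * (-(θ T)) ^ invCount P.2 = θ (cf P) := by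
          intro P
          rw [hinv]
          simp [cf]
        have hτ : tauCoinv (θ T) (θ T)⁻¹ x t =
            ∑ P ∈ minorTerms N t, θ (cf P) • listProd x (minorList P.1 P.2) := by
          rw [tauCoinv_eq_sum]
          exact Finset.sum_congr rfl fun P _ => by rw [hcf, listProd_minorList]
        obtain ⟨r₀, hr₀⟩ : ∃ r₀, e (tauCoinv (θ T) (θ T)⁻¹ x t) = θ r₀ := by
          refine ⟨∑ P ∈ minorTerms N t, cf P * minorProd ξ P.1 P.2, ?_⟩
          rw [hτ, map_sum, map_sum]
          refine Finset.sum_congr rfl fun P _ => ?_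
          rw [map_smul, listProd_minorList, map_minorProd, map_mul, map_minorProd, smul_eq_mul]
          simp only [he]
        have hrel : ∑ P ∈ minorTerms N t, (cf P : R) • z (minorList P.1 P.2 ++ l') =
            r₀ • z l' := by
          have h1 := (Submodule.Quotient.mk_eq_zero V).2 (hV1 t ht1 htN (listProd x l'))
          rw [hr₀, hτ, sub_mul, Finset.sum_mul, Algebra.algebraMap_eq_smul_one, smul_mul_assoc,
            one_mul, Submodule.Quotient.mk_sub, sub_eq_zero, ← Submodule.mkQ_apply,
            map_sum] at h1
          rw [hsmul]
          refine Eq.trans (Finset.sum_congr rfl fun P _ => ?_) (h1.trans ?_)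
          · rw [hsmul, smul_mul_assoc, map_smul, ← listProd_append]
          · rw [← Submodule.mkQ_apply, map_smul]
        have hP₀mem : P₀ ∈ minorTerms N t := mem_minorTerms.2 hcard
        rw [← Finset.add_sum_erase _ _ hP₀mem] at hrel
        have hn' : monWt (antiMon N t) + monWt m' = n := by rw [← map_add, hml, hn]
        have h2 : (cf P₀ : R) • z (minorList I₀ σ₀ ++ l') ∈ J • W := by
          rw [eq_sub_of_add_eq hrel]
          refine sub_mem ?_ (sum_mem fun P hP => ?_)
          · refine Submodule.smul_mem _ _ (ih (monWt m') ?_ l' (by omega) ?_)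
            · have := monWt_pos (antiMon_ne_zero ht1 htN)
              omega
            · rw [listMon_monList]
          · rw [Finset.mem_erase, mem_minorTerms] at hP
            refine Submodule.smul_mem _ _ (ih (monWt (minorMon P.1 P.2 + m')) ?_ _ ?_ ?_)
            · have := hlead P.1 P.2 hP.2 hP.1
              rw [map_add]
              omega
            · simp only [List.length_append, minorList, List.length_map, List.length_finRange]
              omega
            · rw [hmon']
        have h3 := Submodule.smul_mem (J • W) (((cf P₀)⁻¹ : Rˣ) : R) h2
        rwa [smul_smul, Units.inv_mul, one_smul] at h3
  have hWJ : W ≤ J • W := by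
    rw [Submodule.span_le]
    rintro _ ⟨l, hl, rfl⟩
    exact hmain _ l hl rfl
  have hfg : W.FG := Submodule.fg_span ((List.finite_length_le _ d).image z)
  obtain ⟨r, hr, hr0⟩ := Submodule.exists_sub_one_mem_and_smul_eq_zero_of_fg_of_le_smul J W hfg hWJ
  intro l hl
  have := hr0 (z l) (hzW l hl)
  rw [hsmul] at this
  exact (smul_eq_zero.1 this).resolve_left (hθ r hr)

end Spanning

section Elementary

variable {N : ℕ} {B : Type} [Ring B]

/-- The matrix with diagonal entries `α` at `i`, `δ` at `k` and `1` elsewhere, and with `β` in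
position `(i, k)`. -/
def elemMat (i k : Fin N) (α β δ : B) : Matrix (Fin N) (Fin N) B :=
  fun r s => if r = s then (if r = i then α else if r = k then δ else 1) else
    if r = i ∧ s = k then β else 0

lemma elemMat_eq (i k : Fin N) (hik : i ≠ k) (α β δ : B) :
    elemMat i k α β δ =
      Matrix.diagonal (fun r => if r = i then α else if r = k then δ else 1) +
        Matrix.single i k β := by
  ext r s
  by_cases h : r = s
  · subst h
    have : ¬ (i = r ∧ k = r) := fun h => hik (h.1.trans h.2.symm)
    simp [elemMat, this]
  · simp [elemMat, h, Matrix.single_apply, eq_comm (a := i), eq_comm (a := k)]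

lemma elemMat_mul (i k : Fin N) (hik : i ≠ k) (α β δ α' β' δ' : B) :
    elemMat i k α β δ * elemMat i k α' β' δ' =
      elemMat i k (α * α') (α * β' + β * δ') (δ * δ') := by
  simp only [elemMat_eq i k hik, add_mul, mul_add, Matrix.diagonal_mul_diagonal]
  rw [Matrix.single_mul_single_of_ne _ _ _ _ hik.symm, add_zero]
  rw [add_assoc, add_comm (Matrix.single i k β * _), Matrix.single_add]
  congr 1
  · congr 1
    ext r
    split_ifs <;> simp
  · congr 1
    · ext r s
      simp only [Matrix.diagonal_mul, Matrix.single_apply]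
      by_cases h : i = r ∧ k = s
      · simp [h.1.symm, h.2.symm]
      · simp [h]
    · ext r s
      simp only [Matrix.mul_diagonal, Matrix.single_apply]
      by_cases h : i = r ∧ k = s
      · simp [h.1.symm, h.2.symm, hik.symm]
      · simp [h]

lemma elemMat_one (i k : Fin N) : elemMat i k (1 : B) 0 1 = 1 := by
  ext r s
  simp [elemMat, Matrix.one_apply]

lemma elemMat_inv (i k : Fin N) (hik : i ≠ k) {α β δ : B} (h1 : α * δ = 1) (h2 : δ * α = 1) :
    elemMat i k α β δ * elemMat i k δ (-(δ * β * α)) α = 1 ∧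
      elemMat i k δ (-(δ * β * α)) α * elemMat i k α β δ = 1 := by
  constructor
  · rw [elemMat_mul i k hik, h1, h2, ← elemMat_one i k]
    congr 1
    rw [mul_neg, ← mul_assoc, ← mul_assoc, h1, one_mul, neg_add_cancel]
  · rw [elemMat_mul i k hik, h1, h2, ← elemMat_one i k]
    congr 1
    rw [neg_mul, mul_assoc _ α δ, h1, mul_one, add_neg_cancel]

variable {F : Type} [Field F] [Algebra F B]

lemma IsQMat.transpose {q : F} {y : Fin N → Fin N → B} (hy : IsQMat q y) :
    IsQMat q (fun i j => y j i) where
  row i j l h := hy.col j l i h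
  col i k j h := hy.row j i k h
  anti i k j l h h' := (hy.anti j l i k h' h).symm
  diag i k j l h h' := by
    rw [hy.diag j l i k h' h, hy.anti j l i k h' h]

lemma isQMat_elemMat {q : F} {i k : Fin N} (hik : i.1 + 1 = k.1) {α β δ : B} (h1 : α * δ = 1)
    (h2 : δ * α = 1) (hab : α * β = q • (β * α)) : IsQMat q (elemMat i k α β δ) := by
  have hbd : β * δ = q • (δ * β) := by
    have h3 : δ * (α * β) * δ = q • (δ * (β * α) * δ) := by
      rw [hab, mul_smul_comm, smul_mul_assoc]
    rwa [← mul_assoc, h2, one_mul, mul_assoc δ, mul_assoc β, h1, mul_one] at h3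
  have hcomm : ∀ r s, elemMat i k α β δ r r * elemMat i k α β δ s s =
      elemMat i k α β δ s s * elemMat i k α β δ r r := by
    intro r s
    simp only [elemMat, if_true]
    split_ifs <;> simp [h1, h2]
  have hoff : ∀ r s, elemMat i k α β δ r s ≠ 0 → r = s ∨ (r = i ∧ s = k) := by
    intro r s h
    by_contra hc
    push Not at hc
    apply h
    simp only [elemMat, if_neg hc.1]
    exact if_neg fun h => hc.2 h.1 h.2
  have hone : ∀ r, r ≠ i → r ≠ k → elemMat i k α β δ r r = 1 := by
    intro r h h'
    simp [elemMat, h, h']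
  have hii : elemMat i k α β δ i i = α := by simp [elemMat]
  have hne : k ≠ i := fun h => by rw [h] at hik; omega
  have hkk : elemMat i k α β δ k k = δ := by simp [elemMat, hne]
  have hik' : elemMat i k α β δ i k = β := by simp [elemMat, hne.symm]
  have hanti : ∀ r r' s s' : Fin N, r < r' → s < s' →
      elemMat i k α β δ r s' = 0 ∨ elemMat i k α β δ r' s = 0 := by
    intro r r' s s' hr hs
    by_contra hc
    push Not at hc
    rcases hoff _ _ hc.1 with h | h <;> rcases hoff _ _ hc.2 with h' | h' <;>
      simp only [Fin.ext_iff, Fin.lt_def] at * <;> omega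
  refine ⟨?_, ?_, ?_, ?_⟩
  · intro r s s' hs
    by_cases h : elemMat i k α β δ r s = 0
    · simp [h]
    by_cases h' : elemMat i k α β δ r s' = 0
    · simp [h']
    rcases hoff _ _ h with rfl | ⟨rfl, rfl⟩
    · rcases hoff _ _ h' with rfl | ⟨rfl, rfl⟩
      · exact absurd hs (lt_irrefl _)
      · rw [hii, hik', hab]
    · rcases hoff _ _ h' with rfl | ⟨_, rfl⟩
      · simp only [Fin.lt_def] at hs
        omega
      · exact absurd hs (lt_irrefl _)
  · intro r r' s hr
    by_cases h : elemMat i k α β δ r s = 0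
    · simp [h]
    by_cases h' : elemMat i k α β δ r' s = 0
    · simp [h']
    rcases hoff _ _ h with rfl | ⟨rfl, rfl⟩
    · rcases hoff _ _ h' with rfl | ⟨rfl, rfl⟩
      · exact absurd hr (lt_irrefl _)
      · simp only [Fin.lt_def] at hr
        omega
    · rcases hoff _ _ h' with rfl | ⟨rfl, _⟩
      · rw [hik', hkk, hbd]
      · exact absurd hr (lt_irrefl _)
  · intro r r' s s' hr hs
    rcases hanti r r' s s' hr hs with h | h <;> simp [h]
  · intro r r' s s' hr hs
    have hz : elemMat i k α β δ r s' * elemMat i k α β δ r' s = 0 := by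
      rcases hanti r r' s s' hr hs with h | h <;> simp [h]
    rw [hz, smul_zero, sub_eq_zero]
    by_cases h : elemMat i k α β δ r s = 0
    · simp [h]
    by_cases h' : elemMat i k α β δ r' s' = 0
    · simp [h']
    rcases hoff _ _ h with rfl | ⟨rfl, rfl⟩
    · rcases hoff _ _ h' with rfl | ⟨rfl, rfl⟩
      · exact hcomm _ _
      · rw [hone r, mul_one, one_mul]
        · exact hr.ne
        · intro hc
          simp only [Fin.ext_iff, Fin.lt_def] at *
          omega
    · rcases hoff _ _ h' with rfl | ⟨rfl, rfl⟩
      · rw [hone r', mul_one, one_mul]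
        · exact hr.ne'
        · exact hs.ne'
      · exact absurd hr (lt_irrefl _)

lemma isQMat_diagonal {q : F} (d : Fin N → F) :
    IsQMat q (fun i j => algebraMap F B (Matrix.diagonal d i j)) := by
  have hoff : ∀ r s, r ≠ s → algebraMap F B (Matrix.diagonal d r s) = 0 := by
    intro r s h
    simp [Matrix.diagonal_apply_ne _ h]
  refine ⟨?_, ?_, ?_, ?_⟩
  · intro i j l h
    by_cases hij : i = j
    · rw [hoff i l (by rw [hij]; exact h.ne)]
      simp
    · rw [hoff i j hij]
      simp
  · intro i k j h
    by_cases hij : i = j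
    · rw [hoff k j (by rw [← hij]; exact h.ne')]
      simp
    · rw [hoff i j hij]
      simp
  · intro i k j l _ _
    exact (Algebra.commutes _ _)
  · intro i k j l h h'
    rw [Algebra.commutes, sub_self]
    by_cases hil : i = l
    · rw [hoff k j (by rintro rfl; rw [hil] at h; exact lt_asymm h h')]
      simp
    · rw [hoff i l hil]
      simp

lemma exists_lt_of_perm_ne_one {t : ℕ} {σ : Equiv.Perm (Fin t)} (h : σ ≠ 1) : ∃ k, σ k < k := by
  by_contra hc
  push Not at hc
  apply h
  have hsum : ∑ k, (σ k).1 = ∑ k : Fin t, k.1 := Equiv.sum_comp σ fun k => k.1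
  have := (Finset.sum_eq_sum_iff_of_le (s := Finset.univ) (f := fun k : Fin t => k.1)
    (g := fun k => (σ k).1) fun k _ => hc k).1 hsum.symm
  ext k
  exact (this k (Finset.mem_univ _)).symm

lemma qdet_eq_of_upper {q : F} {y : Fin N → Fin N → B} (hy : ∀ i j, j < i → y i j = 0) :
    qdet q y = minorProd y Finset.univ 1 := by
  rw [qdet, qMinor, Finset.sum_eq_single 1]
  · have h0 : invCount (1 : Equiv.Perm (Fin (Finset.univ : Finset (Fin N)).card)) = 0 := by
      rw [invCount, Finset.card_eq_zero, Finset.filter_eq_empty_iff]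
      rintro p - ⟨h, h'⟩
      exact lt_asymm h h'
    rw [h0, pow_zero, one_smul]
    rfl
  · intro σ _ hσ
    obtain ⟨k, hk⟩ := exists_lt_of_perm_ne_one hσ
    rw [List.prod_eq_zero, smul_zero]
    rw [List.mem_map]
    exact ⟨k, List.mem_finRange k, hy _ _ (nthElt_strictMono Finset.univ hk)⟩
  · exact fun h => absurd (Finset.mem_univ _) h

lemma qdet_eq_of_lower {q : F} {y : Fin N → Fin N → B} (hy : ∀ i j, i < j → y i j = 0) :
    qdet q y = minorProd y Finset.univ 1 := by
  rw [qdet, qMinor, Finset.sum_eq_single 1]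
  · have h0 : invCount (1 : Equiv.Perm (Fin (Finset.univ : Finset (Fin N)).card)) = 0 := by
      rw [invCount, Finset.card_eq_zero, Finset.filter_eq_empty_iff]
      rintro p - ⟨h, h'⟩
      exact lt_asymm h h'
    rw [h0, pow_zero, one_smul]
    rfl
  · intro σ _ hσ
    obtain ⟨k, hk⟩ := exists_lt_of_perm_ne_one (inv_ne_one.2 hσ)
    rw [List.prod_eq_zero, smul_zero]
    rw [List.mem_map]
    refine ⟨σ⁻¹ k, List.mem_finRange _, hy _ _ ?_⟩
    rw [show σ (σ⁻¹ k) = k from σ.apply_symm_apply k]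
    exact nthElt_strictMono Finset.univ hk
  · exact fun h => absurd (Finset.mem_univ _) h

lemma isUnit_minorProd_one {y : Fin N → Fin N → B} (hy : ∀ i, IsUnit (y i i)) :
    IsUnit (minorProd y Finset.univ 1) := by
  rw [minorProd]
  refine List.prod_isUnit fun m hm => ?_
  rw [List.mem_map] at hm
  obtain ⟨k, -, rfl⟩ := hm
  exact hy _

end Elementary

section Specialization

variable {F : Type} [Field F] {P : Type} [AddCommGroup P] [Module F P] {k : Type} [Field k]

/-- Pairs of an operator and a scalar preserving a lattice `E` of `P × k`; the scalar is the
specialization of the operator. -/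
def intRing (E : AddSubgroup (P × k)) : Subring (Module.End F P × k) where
  carrier := {z | ∀ w ∈ E, (z.1 w.1, z.2 * w.2) ∈ E}
  mul_mem' {a b} ha hb w hw := by
    have := ha _ (hb w hw)
    simpa [mul_assoc] using this
  one_mem' w hw := by simpa using hw
  add_mem' {a b} ha hb w hw := by
    have := E.add_mem (ha w hw) (hb w hw)
    simpa [add_mul] using this
  zero_mem' w _ := by
    have h : ((0 : Module.End F P × k).1 w.1, (0 : Module.End F P × k).2 * w.2) = 0 := by simp
    rw [h]
    exact E.zero_mem
  neg_mem' {a} ha w hw := by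
    have := E.neg_mem (ha w hw)
    simpa using this

lemma sum_mul_mem_intRing {ι : Type} {s : Finset ι} {E : AddSubgroup (P × k)}
    {a b : ι → Module.End F P} {c d : ι → k} (ha : ∀ i, (a i, c i) ∈ intRing E)
    (hb : ∀ i, (b i, d i) ∈ intRing E) :
    (∑ i ∈ s, a i * b i, ∑ i ∈ s, c i * d i) ∈ intRing E := by
  have h : (∑ i ∈ s, a i * b i, ∑ i ∈ s, c i * d i) = ∑ i ∈ s, (a i, c i) * (b i, d i) := by
    ext <;> simp [Prod.fst_sum, Prod.snd_sum]
  rw [h]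
  exact Subring.sum_mem _ fun i _ => Subring.mul_mem _ (ha i) (hb i)

/-- The lattice of sequences with entries in `E` having a common specialization. -/
def seqLattice (E : AddSubgroup (P × k)) : AddSubgroup ((ℤ → P) × k) where
  carrier := {w | ∀ n, (w.1 n, w.2) ∈ E}
  add_mem' ha hb n := E.add_mem (ha n) (hb n)
  zero_mem' _ := E.zero_mem
  neg_mem' ha n := E.neg_mem (ha n)

/-- Operators acting on sequences entrywise. -/
def pointwise (F P : Type) [Field F] [AddCommGroup P] [Module F P] :
    Module.End F P →ₐ[F] Module.End F (ℤ → P) where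
  toFun a := a.compLeft ℤ
  map_one' := rfl
  map_mul' _ _ := rfl
  map_zero' := rfl
  map_add' _ _ := rfl
  commutes' _ := rfl

/-- Entrywise multiplication by a sequence of scalars. -/
def scaleOp (P : Type) [AddCommGroup P] [Module F P] (c : ℤ → F) : Module.End F (ℤ → P) where
  toFun f n := c n • f n
  map_add' f g := by
    ext n
    simp
  map_smul' a f := by
    ext n
    exact smul_comm (c n) a (f n)

/-- The shift of sequences. -/
def shiftOp (F P : Type) [Field F] [AddCommGroup P] [Module F P] : Module.End F (ℤ → P) where
  toFun f n := f (n - 1)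
  map_add' _ _ := rfl
  map_smul' _ _ := rfl

lemma scaleOp_mul (c d : ℤ → F) : scaleOp P c * scaleOp P d = scaleOp P (c * d) := by
  ext f n
  simp [scaleOp, mul_smul]

lemma scaleOp_one : scaleOp P (1 : ℤ → F) = 1 := by
  ext f n
  simp [scaleOp]

lemma scaleOp_const (c : F) : scaleOp P (fun _ => c) = algebraMap F (Module.End F (ℤ → P)) c := by
  ext f n
  simp [scaleOp]

lemma commute_scaleOp (a : Module.End F P) (c : ℤ → F) :
    Commute (pointwise F P a) (scaleOp P c) := by
  ext f n
  exact map_smul a (c n) (f n)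

lemma commute_shiftOp (a : Module.End F P) : Commute (pointwise F P a) (shiftOp F P) := rfl

lemma scaleOp_mul_shiftOp {q : F} (hq : q ≠ 0) (c : F) :
    scaleOp P (fun n => q ^ n) * (c • shiftOp F P) =
      q • (c • shiftOp F P * scaleOp P (fun n => q ^ n)) := by
  ext f n
  simp only [scaleOp, shiftOp, Module.End.mul_apply, LinearMap.smul_apply, LinearMap.coe_mk,
    AddHom.coe_mk, Pi.smul_apply, smul_smul]
  congr 1
  rw [zpow_sub_one₀ hq]
  field_simp

variable {E : AddSubgroup (P × k)}

lemma pointwise_mem_intRing {a : Module.End F P} {c : k} (h : (a, c) ∈ intRing E) :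
    (pointwise F P a, c) ∈ intRing (seqLattice E) := fun _ hw n => h _ (hw n)

lemma scaleOp_mem_intRing {c : ℤ → F} {d : k}
    (h : ∀ n, (algebraMap F (Module.End F P) (c n), d) ∈ intRing E) :
    (scaleOp P c, d) ∈ intRing (seqLattice E) := fun _ hw n => h n _ (hw n)

lemma shiftOp_mem_intRing : (shiftOp F P, (1 : k)) ∈ intRing (seqLattice E) := by
  intro w hw n
  have := hw (n - 1)
  simpa [shiftOp] using this

end Specialization

section QGroup

variable {N : ℕ} {F : Type} [Field F] {G : Type} [Ring G] [Algebra F G]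

/-- The properties of the coordinate algebra of the quantum general linear group used to
construct representations: `X` is the matrix of generators and `Y` its inverse. -/
structure IsQGroup (q : F) (X Y : Fin N → Fin N → G) (Δ : G →ₐ[F] G ⊗[F] G) (ε : G →ₐ[F] F) :
    Prop where
  comul : ∀ i j, Δ (X i j) = ∑ m, X i m ⊗ₜ[F] X m j
  counit : ∀ i j, ε (X i j) = if i = j then 1 else 0
  inv_mul : Matrix.of Y * Matrix.of X = 1
  mul_inv : Matrix.of X * Matrix.of Y = 1
  lift : ∀ (B : Type) [Ring B] [Algebra F B] (y : Fin N → Fin N → B), IsQMat q y →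
    IsUnit (qdet q y) → ∃ ψ : G →ₐ[F] B, ∀ i j, ψ (X i j) = y i j
  commute : ∀ (B : Type) [Ring B] [Algebra F B] (ψ : G →ₐ[F] B) (b : B),
    (∀ i j, Commute b (ψ (X i j))) → ∀ g, Commute b (ψ g)

/-- The matrix `g` is the specialization of a representation of the quantum group preserving a
lattice. -/
def IsSpecialization {R k : Type} [CommRing R] [Field k] (θ : R →+* F) (η : R →+* k)
    (X Y : Fin N → Fin N → G) (g : Matrix (Fin N) (Fin N) k) : Prop :=
  ∃ (P : Type) (_ : AddCommGroup P) (_ : Module F P) (E : AddSubgroup (P × k)) (p : P)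
    (ψ : G →ₐ[F] Module.End F P),
    (∀ c, ((0 : P), c) ∈ E → c = 0) ∧ (p, 1) ∈ E ∧
    (∀ r, (algebraMap F (Module.End F P) (θ r), η r) ∈ intRing E) ∧
    (∀ i j, (ψ (X i j), g i j) ∈ intRing E) ∧ (∀ i j, (ψ (Y i j), g⁻¹ i j) ∈ intRing E)

variable {R k : Type} [CommRing R] [Field k] {θ : R →+* F} {η : R →+* k}
  {q : F} {X Y : Fin N → Fin N → G} {Δ : G →ₐ[F] G ⊗[F] G} {ε : G →ₐ[F] F}

lemma IsQGroup.map_inv (hG : IsQGroup q X Y Δ ε) {B : Type} [Ring B] [Algebra F B]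
    (ψ : G →ₐ[F] B) {W : Matrix (Fin N) (Fin N) B}
    (hW : W * (Matrix.of fun i j => ψ (X i j)) = 1) (i j : Fin N) : ψ (Y i j) = W i j := by
  have h : (Matrix.of fun i j => ψ (X i j)) * (Matrix.of fun i j => ψ (Y i j)) = 1 := by
    have := congrArg (fun A => A.map ψ) hG.mul_inv
    simp only [Matrix.map_mul, Matrix.map_one _ (map_zero ψ) (map_one ψ)] at this
    exact this
  rw [left_inv_eq_right_inv hW h]
  rfl

lemma IsQGroup.isSpecialization_one (hG : IsQGroup q X Y Δ ε)
    (hθ : Function.Injective θ) : IsSpecialization θ η X Y (1 : Matrix (Fin N) (Fin N) k) := by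
  let E : AddSubgroup (F × k) := (θ.prod η).range.toAddSubgroup
  have hE : ∀ r, (algebraMap F (Module.End F F) (θ r), η r) ∈ intRing E := by
    rintro r _ ⟨s, rfl⟩
    exact ⟨r * s, by simp⟩
  let ψ : G →ₐ[F] Module.End F F := (Algebra.ofId F (Module.End F F)).comp ε
  have h1 : ∀ i j, ψ (X i j) = (1 : Matrix (Fin N) (Fin N) (Module.End F F)) i j := by
    intro i j
    have : ψ (X i j) = algebraMap F (Module.End F F) (ε (X i j)) := rfl
    rw [this, hG.counit, Matrix.one_apply]
    split_ifs <;> simp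
  have h2 : ∀ i j, ((1 : Matrix (Fin N) (Fin N) (Module.End F F)) i j,
      (1 : Matrix (Fin N) (Fin N) k) i j) ∈ intRing E := by
    intro i j
    rw [Matrix.one_apply, Matrix.one_apply]
    split_ifs
    · exact Subring.one_mem _
    · exact Subring.zero_mem _
  refine ⟨F, inferInstance, inferInstance, E, 1, ψ, ?_, ⟨1, by simp⟩, hE, ?_, ?_⟩
  · rintro c ⟨r, hr⟩
    rw [RingHom.prod_apply, Prod.mk.injEq] at hr
    rw [← hr.2, (map_eq_zero_iff θ hθ).1 hr.1, map_zero]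
  · intro i j
    rw [h1]
    exact h2 i j
  · intro i j
    rw [hG.map_inv ψ (W := 1), inv_one]
    · exact h2 i j
    · rw [one_mul]
      ext1 i j
      exact h1 i j

/-- Convolution with a representation on sequences. -/
lemma IsQGroup.isSpecialization_mul (hG : IsQGroup q X Y Δ ε) {g h : Matrix (Fin N) (Fin N) k}
    (hg : IsSpecialization θ η X Y g)
    (hh : ∀ (P : Type) [AddCommGroup P] [Module F P] (E : AddSubgroup (P × k)),
      (∀ r, (algebraMap F (Module.End F P) (θ r), η r) ∈ intRing E) →
      ∃ y z : Matrix (Fin N) (Fin N) (Module.End F (ℤ → P)),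
        IsQMat q y ∧ IsUnit (qdet q y) ∧ z * y = 1 ∧
        (∀ a i j, Commute (pointwise F P a) (y i j)) ∧
        (∀ i j, (y i j, h i j) ∈ intRing (seqLattice E)) ∧
        (∀ i j, (z i j, h⁻¹ i j) ∈ intRing (seqLattice E))) :
    IsSpecialization θ η X Y (g * h) := by
  obtain ⟨P, _, _, E, p, ψ, hE, hp, hs, hX, hY⟩ := hg
  obtain ⟨y, z, hy, hdet, hzy, hcomm, hyh, hzh⟩ := hh P E hs
  obtain ⟨ψ₂, hψ₂⟩ := hG.lift _ y hy hdet
  let ψ' : G →ₐ[F] Module.End F (ℤ → P) :=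
    (Algebra.TensorProduct.lift ((pointwise F P).comp ψ) ψ₂ (fun a b =>
      hG.commute _ ψ₂ _ (fun i j => by rw [hψ₂]; exact hcomm _ i j) b)).comp Δ
  have h1 : ∀ i j, ψ' (X i j) = ∑ m, pointwise F P (ψ (X i m)) * y m j := by
    intro i j
    simp [ψ', hG.comul, hψ₂]
  have h2 : ∀ i j, ψ' (Y i j) = ∑ m, z i m * pointwise F P (ψ (Y m j)) := by
    intro i j
    rw [hG.map_inv ψ' (W := z * (Matrix.of Y).map fun a => pointwise F P (ψ a)), Matrix.mul_apply]
    · rfl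
    · have h3 : (Matrix.of fun i j => ψ' (X i j)) =
          ((Matrix.of X).map fun a => pointwise F P (ψ a)) * y := by
        ext1 i j
        exact h1 i j
      have h4 := congrArg (fun A => A.map ((pointwise F P).comp ψ)) hG.inv_mul
      simp only [Matrix.map_mul, Matrix.map_one _ (map_zero _) (map_one _)] at h4
      rw [h3, mul_assoc, ← mul_assoc _ _ y]
      have h5 : ((Matrix.of Y).map fun a => pointwise F P (ψ a)) *
          ((Matrix.of X).map fun a => pointwise F P (ψ a)) = 1 := h4
      rw [h5, one_mul, hzy]
  refine ⟨ℤ → P, inferInstance, inferInstance, seqLattice E, fun _ => p, ψ', ?_, fun _ => hp, ?_,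
    ?_, ?_⟩
  · intro c hc
    exact hE c (hc 0)
  · intro r
    rw [← scaleOp_const]
    exact scaleOp_mem_intRing fun _ => hs r
  · intro i j
    rw [h1, Matrix.mul_apply]
    exact sum_mul_mem_intRing (fun m => pointwise_mem_intRing (hX i m)) fun m => hyh m j
  · intro i j
    rw [h2, Matrix.mul_inv_rev, Matrix.mul_apply]
    exact sum_mul_mem_intRing (fun m => hzh i m) fun m => pointwise_mem_intRing (hY m j)

end QGroup

section Elementary

variable {N : ℕ}

lemma elemMat_transpose {B : Type} [Ring B] {i j : Fin N} (hij : i ≠ j) (α β δ : B) :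
    (elemMat i j α β δ).transpose = elemMat j i δ β α := by
  ext r s
  by_cases h : r = s
  · subst h
    by_cases h1 : r = i
    · subst h1
      simp [elemMat, hij]
    · simp [elemMat, h1]
  · simp [elemMat, h, Ne.symm h, and_comm]

lemma elemMat_mem {B k : Type} [Ring B] [Ring k] {S : Subring (B × k)} {i j : Fin N}
    {α β δ : B} {a b d : k} (hα : (α, a) ∈ S) (hβ : (β, b) ∈ S) (hδ : (δ, d) ∈ S) (r s : Fin N) :
    (elemMat i j α β δ r s, elemMat i j a b d r s) ∈ S := by
  simp only [elemMat]
  split_ifs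
  exacts [hα, hδ, S.one_mem, hβ, S.zero_mem]

lemma isUnit_elemMat_diag {B : Type} [Ring B] {i j : Fin N} {α β δ : B} (hα : IsUnit α)
    (hδ : IsUnit δ) (r : Fin N) : IsUnit (elemMat i j α β δ r r) := by
  simp only [elemMat, if_true]
  split_ifs
  exacts [hα, hδ, isUnit_one]

lemma isUnit_qdet_of_upper {F B : Type} [Field F] [Ring B] [Algebra F B] {q : F}
    {y : Fin N → Fin N → B} (hy : ∀ i j, j < i → y i j = 0) (hu : ∀ i, IsUnit (y i i)) :
    IsUnit (qdet q y) := by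
  rw [qdet_eq_of_upper hy]
  exact isUnit_minorProd_one hu

lemma isUnit_qdet_of_lower {F B : Type} [Field F] [Ring B] [Algebra F B] {q : F}
    {y : Fin N → Fin N → B} (hy : ∀ i j, i < j → y i j = 0) (hu : ∀ i, IsUnit (y i i)) :
    IsUnit (qdet q y) := by
  rw [qdet_eq_of_lower hy]
  exact isUnit_minorProd_one hu

lemma isUnit_qdet_elemMat {F B : Type} [Field F] [Ring B] [Algebra F B] {q : F} {i j : Fin N}
    (hij : i ≠ j) {α β δ : B} (hα : IsUnit α) (hδ : IsUnit δ) :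
    IsUnit (qdet q (elemMat i j α β δ)) := by
  rcases lt_or_gt_of_ne hij with h | h
  · refine isUnit_qdet_of_upper (fun r s hrs => ?_) (isUnit_elemMat_diag hα hδ)
    have : ¬ (r = i ∧ s = j) := fun hc => lt_asymm h (hc.1 ▸ hc.2 ▸ hrs)
    simp [elemMat, hrs.ne', this]
  · refine isUnit_qdet_of_lower (fun r s hrs => ?_) (isUnit_elemMat_diag hα hδ)
    have : ¬ (r = i ∧ s = j) := fun hc => lt_asymm h (hc.1 ▸ hc.2 ▸ hrs)
    simp [elemMat, hrs.ne, this]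

lemma elemMat_eq_transvection {k : Type} [Field k] (i j : Fin N) (hij : i ≠ j) (c : k) :
    elemMat i j 1 c 1 = Matrix.transvection i j c := by
  rw [elemMat_eq i j hij, Matrix.transvection]
  congr 1
  rw [← Matrix.diagonal_one]
  congr 1
  ext r
  simp

end Elementary

section GeneralLinear

variable {N : ℕ} {F : Type} [Field F] {G : Type} [Ring G] [Algebra F G]
variable {R k : Type} [CommRing R] [Field k] {θ : R →+* F} {η : R →+* k} {T : Rˣ} {s : k →+* R}
  {X Y : Fin N → Fin N → G} {Δ : G →ₐ[F] G ⊗[F] G} {ε : G →ₐ[F] F}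

/-- Right multiplication by an adjacent transvection preserves specializations. -/
lemma IsQGroup.isSpecialization_mul_transvection (hG : IsQGroup (θ T) X Y Δ ε)
    (hT : η T = 1) (hs : ∀ c, η (s c) = c) {i j : Fin N}
    (hij : i.1 + 1 = j.1 ∨ j.1 + 1 = i.1) (c : k) {g : Matrix (Fin N) (Fin N) k}
    (hg : IsSpecialization θ η X Y g) :
    IsSpecialization θ η X Y (g * Matrix.transvection i j c) := by
  have hne : i ≠ j := by
    rintro rfl
    omega
  rw [← elemMat_eq_transvection i j hne]
  refine hG.isSpecialization_mul hg fun P _ _ E hE => ?_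
  have hq : θ T ≠ 0 := (T.isUnit.map θ).ne_zero
  have hTn : ∀ n : ℤ, η ↑(T ^ n) = 1 := by
    intro n
    have h1 : Units.map (η : R →* k) T = 1 := Units.ext hT
    have h2 : Units.map (η : R →* k) (T ^ n) = 1 := by rw [map_zpow, h1, one_zpow]
    exact congrArg Units.val h2
  have hθT : ∀ n : ℤ, θ ↑(T ^ n) = θ T ^ n := by
    intro n
    have h2 : Units.map (θ : R →* F) (T ^ n) = Units.map (θ : R →* F) T ^ n := map_zpow _ _ _
    have h3 := congrArg Units.val h2
    rw [Units.val_zpow_eq_zpow_val] at h3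
    exact h3
  let a : Module.End F (ℤ → P) := scaleOp P fun n => θ T ^ n
  let d : Module.End F (ℤ → P) := scaleOp P fun n => θ T ^ (-n)
  let b : Module.End F (ℤ → P) := θ (s c) • shiftOp F P
  have had : a * d = 1 := by
    rw [scaleOp_mul, ← scaleOp_one]
    congr 1
    ext n
    simp [zpow_ne_zero n hq]
  have hda : d * a = 1 := by
    rw [scaleOp_mul, ← scaleOp_one]
    congr 1
    ext n
    simp [zpow_ne_zero n hq]
  have hab : a * b = θ T • (b * a) := scaleOp_mul_shiftOp hq _
  have ha : (a, (1 : k)) ∈ intRing (seqLattice E) := by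
    refine scaleOp_mem_intRing fun n => ?_
    rw [← hθT, ← hTn n]
    exact hE _
  have hd : (d, (1 : k)) ∈ intRing (seqLattice E) := by
    refine scaleOp_mem_intRing fun n => ?_
    rw [← hθT, ← hTn (-n)]
    exact hE _
  have hb : (b, c) ∈ intRing (seqLattice E) := by
    have h1 : (scaleOp P fun _ => θ (s c), η (s c)) ∈ intRing (seqLattice E) :=
      scaleOp_mem_intRing fun _ => hE _
    have h2 := Subring.mul_mem _ h1 shiftOp_mem_intRing
    rw [hs, scaleOp_const, Prod.mk_mul_mk, mul_one, ← Algebra.smul_def] at h2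
    exact h2
  have hinv : (elemMat i j 1 c 1)⁻¹ = elemMat i j 1 (-(1 * c * 1)) 1 :=
    Matrix.inv_eq_right_inv (elemMat_inv i j hne (one_mul 1) (one_mul 1)).1
  have hua : IsUnit a := ⟨⟨a, d, had, hda⟩, rfl⟩
  have hud : IsUnit d := ⟨⟨d, a, hda, had⟩, rfl⟩
  have hcomm : ∀ (α δ : Module.End F (ℤ → P)), (∀ t, Commute (pointwise F P t) α) →
      (∀ t, Commute (pointwise F P t) δ) →
      ∀ t r r', Commute (pointwise F P t) (elemMat i j α b δ r r') := by
    intro α δ hα hδ t r r'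
    simp only [elemMat]
    split_ifs
    exacts [hα t, hδ t, Commute.one_right _, (commute_shiftOp t).smul_right _,
      Commute.zero_right _]
  rcases hij with h | h
  · refine ⟨elemMat i j a b d, _, isQMat_elemMat h had hda hab, isUnit_qdet_elemMat hne hua hud,
      (elemMat_inv i j hne had hda).2,
      hcomm a d (fun t => commute_scaleOp t _) (fun t => commute_scaleOp t _),
      elemMat_mem ha hb hd, ?_⟩
    rw [hinv]
    exact elemMat_mem hd (Subring.neg_mem _ (Subring.mul_mem _ (Subring.mul_mem _ hd hb) ha)) ha
  · refine ⟨elemMat i j d b a, _, ?_, isUnit_qdet_elemMat hne hud hua,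
      (elemMat_inv i j hne hda had).2,
      hcomm d a (fun t => commute_scaleOp t _) (fun t => commute_scaleOp t _),
      elemMat_mem hd hb ha, ?_⟩
    · rw [← elemMat_transpose hne.symm]
      exact (isQMat_elemMat h had hda hab).transpose
    rw [hinv]
    exact elemMat_mem ha (Subring.neg_mem _ (Subring.mul_mem _ (Subring.mul_mem _ ha hb) hd)) hd

/-- Right multiplication by an invertible diagonal matrix preserves specializations. -/
lemma IsQGroup.isSpecialization_mul_diagonal {q : F} (hG : IsQGroup q X Y Δ ε)
    (hs : ∀ c, η (s c) = c) {D : Fin N → k} (hD : ∀ i, D i ≠ 0) {g : Matrix (Fin N) (Fin N) k}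
    (hg : IsSpecialization θ η X Y g) :
    IsSpecialization θ η X Y (g * Matrix.diagonal D) := by
  refine hG.isSpecialization_mul hg fun P _ _ E hE => ?_
  let A : (Fin N → k) → Matrix (Fin N) (Fin N) (Module.End F (ℤ → P)) := fun D i j =>
    algebraMap F (Module.End F (ℤ → P)) (Matrix.diagonal (fun i => θ (s (D i))) i j)
  have hA : ∀ D i j, (A D i j, Matrix.diagonal D i j) ∈ intRing (seqLattice E) := by
    intro D i j
    have h1 : Matrix.diagonal (fun i => θ (s (D i))) i j = θ (s (Matrix.diagonal D i j)) := by
      simp only [Matrix.diagonal_apply]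
      split_ifs <;> simp
    have h2 := hE (s (Matrix.diagonal D i j))
    rw [hs] at h2
    simp only [A]
    rw [h1, ← scaleOp_const]
    exact scaleOp_mem_intRing fun _ => h2
  have hmul : A (fun i => (D i)⁻¹) * A D = 1 := by
    have h1 : ∀ D, A D = (algebraMap F (Module.End F (ℤ → P))).mapMatrix
      (Matrix.diagonal (fun i => θ (s (D i)))) := fun D => rfl
    rw [h1, h1, ← map_mul, Matrix.diagonal_mul_diagonal]
    simp [← map_mul, hD]
  refine ⟨A D, A fun i => (D i)⁻¹, isQMat_diagonal _, ?_, hmul,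
    fun a i j => (Algebra.commutes _ _).symm, hA D, ?_⟩
  · refine isUnit_qdet_of_upper (fun i j h => ?_) fun i => ?_
    · simp [A, Matrix.diagonal_apply_ne _ h.ne']
    · simp only [A, Matrix.diagonal_apply_eq]
      exact (((IsUnit.mk0 _ (hD i)).map s).map θ).map _
  · rw [show (Matrix.diagonal D)⁻¹ = Matrix.diagonal fun i => (D i)⁻¹ from
      Matrix.inv_eq_right_inv (by simp [Matrix.diagonal_mul_diagonal, hD])]
    exact hA _

lemma transvection_commutator {i m j : Fin N} (him : i ≠ m) (hmj : m ≠ j) (hij : i ≠ j) (c : k) :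
    Matrix.transvection i m c * Matrix.transvection m j 1 * Matrix.transvection i m (-c) *
      Matrix.transvection m j (-1) = Matrix.transvection i j c := by
  have hneg : ∀ (a b : Fin N) (x : k), Matrix.single a b (-x) = -Matrix.single a b x :=
    fun a b => map_neg (Matrix.singleAddMonoidHom a b)
  simp [Matrix.transvection, add_mul, mul_add, him.symm, hmj.symm, hij.symm, hneg,
    Matrix.single_mul_single_of_ne]
  abel

/-- Every invertible matrix is the specialization of a representation. -/
theorem IsQGroup.isSpecialization (hG : IsQGroup (θ T) X Y Δ ε) (hθ : Function.Injective θ)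
    (hT : η T = 1) (hs : ∀ c, η (s c) = c) {g : Matrix (Fin N) (Fin N) k} (hg : g.det ≠ 0) :
    IsSpecialization θ η X Y g := by
  let H : Submonoid (Matrix (Fin N) (Fin N) k) :=
    { carrier := {h | ∀ g, IsSpecialization θ η X Y g → IsSpecialization θ η X Y (g * h)}
      one_mem' := fun g hg => by rwa [mul_one]
      mul_mem' := fun {a b} ha hb g hg => by
        rw [← mul_assoc]
        exact hb _ (ha _ hg) }
  have hadj : ∀ i j : Fin N, i.1 + 1 = j.1 ∨ j.1 + 1 = i.1 → ∀ c,
      Matrix.transvection i j c ∈ H := fun i j h c g hg =>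
    hG.isSpecialization_mul_transvection hT hs h c hg
  have htv : ∀ (n : ℕ) (i j : Fin N), (i.1 + (n + 1) = j.1 ∨ j.1 + (n + 1) = i.1) → ∀ c,
      Matrix.transvection i j c ∈ H := by
    intro n
    induction n with
    | zero => exact hadj
    | succ n ih =>
      intro i j h c
      obtain ⟨m, hm⟩ : ∃ m : Fin N, (i.1 + (n + 1) = m.1 ∧ m.1 + 1 = j.1) ∨
          (m.1 + (n + 1) = i.1 ∧ j.1 + 1 = m.1) := by
        rcases h with h | h
        · exact ⟨⟨i.1 + (n + 1), by omega⟩, Or.inl ⟨rfl, by simp only; omega⟩⟩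
        · exact ⟨⟨j.1 + 1, by omega⟩, Or.inr ⟨by simp only; omega, rfl⟩⟩
      have him : i ≠ m := fun hc => by rw [hc] at hm; omega
      have hmj : m ≠ j := fun hc => by rw [hc] at hm; omega
      have hij : i ≠ j := fun hc => by rw [hc] at h; omega
      rw [← transvection_commutator him hmj hij]
      have h1 : ∀ c, Matrix.transvection i m c ∈ H := ih i m (by omega)
      have h2 : ∀ c, Matrix.transvection m j c ∈ H := hadj m j (by omega)
      exact H.mul_mem (H.mul_mem (H.mul_mem (h1 _) (h2 _)) (h1 _)) (h2 _)
  have hH : g ∈ H := by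
    refine Matrix.diagonal_transvection_induction_of_det_ne_zero (· ∈ H) g hg ?_ ?_ ?_
    · intro D hD g hg
      rw [Matrix.det_diagonal, Finset.prod_ne_zero_iff] at hD
      exact hG.isSpecialization_mul_diagonal hs (fun i => hD i (Finset.mem_univ i)) hg
    · rintro ⟨i, j, hij, c⟩
      have hij' : i.1 ≠ j.1 := fun h => hij (Fin.ext h)
      rcases lt_or_gt_of_ne hij' with h | h
      · exact htv (j.1 - i.1 - 1) i j (by omega) c
      · exact htv (i.1 - j.1 - 1) i j (by omega) c
    · exact fun A B _ _ hA hB => H.mul_mem hA hB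
  simpa using hH 1 (hG.isSpecialization_one hθ)

end GeneralLinear

section Independence

variable {N : ℕ}

lemma aeval_monomial_listMon {k : Type} [Field k] (y : Fin N → Fin N → k)
    (l : List (Fin N × Fin N)) (c : k) :
    MvPolynomial.aeval (fun p : Fin N × Fin N => y p.1 p.2) (MvPolynomial.monomial (listMon l) c) =
      c * listProd y l := by
  induction l with
  | nil => simp [listMon, listProd]
  | cons p l ih =>
    have h1 : listMon (p :: l) = Finsupp.single p 1 + listMon l := by simp [listMon]
    have h2 : listProd y (p :: l) = y p.1 p.2 * listProd y l := by simp [listProd]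
    rw [h1, h2, ← one_mul c, ← MvPolynomial.monomial_mul, map_mul, ih, one_mul,
      MvPolynomial.aeval_monomial]
    simp only [map_one, one_mul, Finsupp.prod_single_index, pow_zero, pow_one]
    ring

variable {F : Type} [Field F] {M G : Type} [Ring M] [Algebra F M] [Ring G] [Algebra F G]
variable {R : Type} [CommRing R]

lemma coorbit_listProd_mem {k : Type} [Field k] {θ : R →+* F} {η : R →+* k}
    (ΔM : M →ₐ[F] M ⊗[F] M) (ι : M →ₐ[F] G) (St : G →ₗ[F] G)
    (e : M →ₐ[F] F) (hSt : ∀ a b, St (a * b) = St b * St a) (hSt1 : St 1 = 1)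
    {x : Fin N → Fin N → M} (hΔ : ∀ i j, ΔM (x i j) = ∑ m, x i m ⊗ₜ[F] x m j)
    {ξ : Fin N → Fin N → R} (he : ∀ i j, e (x i j) = θ (ξ i j))
    {P : Type} [AddCommGroup P] [Module F P] {E : AddSubgroup (P × k)}
    {ψ : G →ₐ[F] Module.End F P} {g : Matrix (Fin N) (Fin N) k}
    (hs : ∀ r, (algebraMap F (Module.End F P) (θ r), η r) ∈ intRing E)
    (hX : ∀ i j, (ψ (ι (x i j)), g i j) ∈ intRing E)
    (hY : ∀ i j, (ψ (St (ι (x i j))), g⁻¹ i j) ∈ intRing E) {y : Fin N → Fin N → k}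
    (hy : ∀ i j, y i j = ∑ a, ∑ b, η (ξ a b) * (g⁻¹ i a * g b j)) (l : List (Fin N × Fin N)) :
    (ψ (coorbit e (adjBeta ΔM ι St) (listProd x l)),
      listProd y l) ∈ intRing E := by
  induction l using List.reverseRecOn with
  | nil =>
    have h1 : listProd x [] = 1 := rfl
    have h2 : listProd y [] = 1 := rfl
    rw [h1, h2, coorbit_one ΔM ι St e hSt1, map_one]
    exact Subring.one_mem _
  | append_singleton l p ih =>
    have h1 : ∀ {B : Type} [Ring B] (y : Fin N → Fin N → B), listProd y [p] = y p.1 p.2 := by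
      intro B _ y
      simp [listProd]
    rw [listProd_append, listProd_append, h1, h1, coorbit_mul_gen ΔM ι St e hSt hΔ]
    set C := coorbit e (adjBeta ΔM ι St) (listProd x l)
    set c := listProd y l
    have h4 : (ψ (∑ a, ∑ b, e (x a b) • (St (ι (x p.1 a)) * C * ι (x b p.2))),
        c * y p.1 p.2) =
        ∑ a, ∑ b, (algebraMap F (Module.End F P) (θ (ξ a b)), η (ξ a b)) *
          ((ψ (St (ι (x p.1 a))), g⁻¹ p.1 a) * (ψ C, c) * (ψ (ι (x b p.2)), g b p.2)) := by
      ext1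
      · simp [Prod.fst_sum, he, Algebra.smul_def]
      · rw [hy, Finset.mul_sum]
        simp only [Prod.snd_sum, Finset.mul_sum]
        refine Finset.sum_congr rfl fun a _ => Finset.sum_congr rfl fun b _ => ?_
        simp only [Prod.snd_mul]
        ring
    rw [h4]
    exact Subring.sum_mem _ fun a _ => Subring.sum_mem _ fun b _ => Subring.mul_mem _ (hs _)
      (Subring.mul_mem _ (Subring.mul_mem _ (hY _ _) ih) (hX _ _))

/-- The specialization of a linear relation between the images of standard monomials under the
co-orbit map is trivial. -/
theorem specialization_eq_zero {K : Subfield ℂ} {θ : R →+* F} {η : R →+* K}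
    (ΔM : M →ₐ[F] M ⊗[F] M) (ι : M →ₐ[F] G) (St : G →ₗ[F] G)
    (e : M →ₐ[F] F) (hSt : ∀ a b, St (a * b) = St b * St a) (hSt1 : St 1 = 1)
    {x : Fin N → Fin N → M} (hΔ : ∀ i j, ΔM (x i j) = ∑ m, x i m ⊗ₜ[F] x m j)
    {ξ : Fin N → Fin N → R} (he : ∀ i j, e (x i j) = θ (ξ i j))
    (hspec : ∀ g : Matrix (Fin N) (Fin N) K, g.det ≠ 0 →
      IsSpecialization θ η (fun i j => ι (x i j)) (fun i j => St (ι (x i j))) g)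
    (hcent : Module.finrank K (LinearMap.ker
      (LinearMap.mulLeft K (Matrix.of fun i j => η (ξ i j) : Matrix (Fin N) (Fin N) K) -
        LinearMap.mulRight K (Matrix.of fun i j => η (ξ i j)))) = N)
    {S : Finset (Fin N × Fin N →₀ ℕ)} (hS : ∀ s ∈ S, s ∈ stdMon N)
    {r : (Fin N × Fin N →₀ ℕ) → R}
    (hr : ∑ s ∈ S, θ (r s) • coorbit e (adjBeta ΔM ι St) (listProd x (monList s)) = 0) :
    ∀ s ∈ S, η (r s) = 0 := by
  classical
  let f : MvPolynomial (Fin N × Fin N) K := ∑ s ∈ S, MvPolynomial.monomial s (η (r s))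
  have hcoeff : ∀ m, f.coeff m = if m ∈ S then η (r m) else 0 := by
    intro m
    simp only [f, MvPolynomial.coeff_sum, MvPolynomial.coeff_monomial, Finset.sum_ite_eq']
  have hf : f = 0 := by
    refine eq_zero_of_vanishing_on_orbit K _ hcent f ?_ ?_
    · intro m hm
      rw [MvPolynomial.mem_support_iff, hcoeff] at hm
      by_contra hc
      rw [if_neg fun h => hc (hS m h)] at hm
      exact hm rfl
    · intro g hg
      obtain ⟨P, _, _, E, p, ψ, hE, hp, hs, hX, hY⟩ := hspec g hg
      let y : Fin N → Fin N → K := fun i j => (g⁻¹ * (Matrix.of fun i j => η (ξ i j)) * g) i j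
      have hy : ∀ i j, y i j = ∑ a, ∑ b, η (ξ a b) * (g⁻¹ i a * g b j) := by
        intro i j
        simp only [y]
        rw [Matrix.mul_apply, Finset.sum_comm]
        refine Finset.sum_congr rfl fun b _ => ?_
        rw [Matrix.mul_apply, Finset.sum_mul]
        refine Finset.sum_congr rfl fun a _ => ?_
        rw [Matrix.of_apply]
        ring
      have h1 : ∀ s, (algebraMap F (Module.End F P) (θ (r s)), η (r s)) *
          (ψ (coorbit e (adjBeta ΔM ι St) (listProd x (monList s))),
            listProd y (monList s)) ∈ intRing E :=
        fun s => Subring.mul_mem _ (hs _)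
          (coorbit_listProd_mem ΔM ι St e hSt hSt1 hΔ he hs hX hY hy (monList s))
      have h2 := Subring.sum_mem _ fun s (_ : s ∈ S) => h1 s
      have h3 := congrArg ψ hr
      have h4 := h2 (p, 1) hp
      simp only [map_sum, map_smul, map_zero] at h3
      simp only [Prod.fst_sum, Prod.snd_sum, Prod.fst_mul, Prod.snd_mul, ← Algebra.smul_def, h3,
        LinearMap.zero_apply, mul_one] at h4
      rw [map_sum, ← hE _ h4]
      refine Finset.sum_congr rfl fun s _ => ?_
      have h5 := aeval_monomial_listMon y (monList s) (η (r s))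
      rw [listMon_monList] at h5
      exact h5
  intro s hs
  have := hcoeff s
  rw [hf, if_pos hs, MvPolynomial.coeff_zero] at this
  exact this.symm

/-- A finite family of nonzero rational functions is proportional to a family of polynomials, not
all of which vanish at `1`. -/
lemma exists_polynomial_multiples {K : Type} [Field K] {σ : Type} (S : Finset σ)
    (hS : S.Nonempty) (a : σ → RatFunc K) (ha : ∀ s ∈ S, a s ≠ 0) :
    ∃ (c : RatFunc K) (g : σ → Polynomial K),
      (∀ s ∈ S, c * a s = algebraMap (Polynomial K) (RatFunc K) (g s)) ∧
        ∃ s ∈ S, (g s).eval 1 ≠ 0 := by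
  obtain ⟨b, hb⟩ := IsLocalization.exist_integer_multiples (nonZeroDivisors (Polynomial K)) S a
  choose! p hp using hb
  have hinj := IsFractionRing.injective (Polynomial K) (RatFunc K)
  have hb0 : algebraMap (Polynomial K) (RatFunc K) b ≠ 0 := by
    rw [Ne, map_eq_zero_iff _ hinj]
    exact nonZeroDivisors.ne_zero b.2
  have hp' : ∀ s ∈ S, algebraMap (Polynomial K) (RatFunc K) (p s) =
      algebraMap (Polynomial K) (RatFunc K) b * a s := fun s hs => by
    rw [hp s hs, Algebra.smul_def]
  have hp0 : ∀ s ∈ S, p s ≠ 0 := by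
    intro s hs h
    have := hp' s hs
    rw [h, map_zero] at this
    exact mul_ne_zero hb0 (ha s hs) this.symm
  obtain ⟨s₀, hs₀, hmin⟩ := S.exists_min_image (fun s => (p s).rootMultiplicity 1) hS
  set m := (p s₀).rootMultiplicity 1
  have hdvd : ∀ s ∈ S, ∃ g, p s = (Polynomial.X - Polynomial.C 1) ^ m * g := fun s hs =>
    (pow_dvd_pow _ (hmin s hs)).trans ((p s).pow_rootMultiplicity_dvd 1)
  choose! g hg using hdvd
  have hX0 : algebraMap (Polynomial K) (RatFunc K) ((Polynomial.X - Polynomial.C 1) ^ m) ≠ 0 := by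
    rw [Ne, map_eq_zero_iff _ hinj]
    exact pow_ne_zero _ (Polynomial.X_sub_C_ne_zero 1)
  refine ⟨(algebraMap (Polynomial K) (RatFunc K) ((Polynomial.X - Polynomial.C 1) ^ m))⁻¹ *
    algebraMap (Polynomial K) (RatFunc K) b, g, ?_, s₀, hs₀, ?_⟩
  · intro s hs
    rw [mul_assoc, ← hp' s hs, hg s hs, map_mul, inv_mul_cancel_left₀ hX0]
  · intro h
    obtain ⟨g', hg', hnd⟩ := (p s₀).exists_eq_pow_rootMultiplicity_mul_and_not_dvd (hp0 s₀ hs₀) 1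
    have h1 := hg s₀ hs₀
    rw [hg'] at h1
    rw [mul_left_cancel₀ (pow_ne_zero _ (Polynomial.X_sub_C_ne_zero 1)) h1] at hnd
    exact hnd (Polynomial.dvd_iff_isRoot.2 h)

end Independence

section Kernel

variable {N : ℕ} {F : Type} [Field F] {M G : Type} [Ring M] [Algebra F M] [Ring G] [Algebra F G]
variable {R : Type} [CommRing R]

lemma isQGroup_of_hopf {q : F} {x : Fin N → Fin N → M} {ι : M →ₐ[F] G} {dInv : G}
    (hgenM : Algebra.adjoin F (Set.range fun p : Fin N × Fin N => x p.1 p.2) = ⊤)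
    (hfreeM : ∀ (B : Type) [Ring B] [Algebra F B] (y : Fin N → Fin N → B), IsQMat q y →
      ∃ φ : M →ₐ[F] B, ∀ i j, φ (x i j) = y i j)
    (hd1 : ι (qdet q x) * dInv = 1) (hd2 : dInv * ι (qdet q x) = 1)
    (hgen : Algebra.adjoin F
      (Set.range (fun p : Fin N × Fin N => ι (x p.1 p.2)) ∪ {dInv}) = ⊤)
    (hfreeG : ∀ (B : Type) [Ring B] [Algebra F B] (φ : M →ₐ[F] B) (u : B),
      φ (qdet q x) * u = 1 → u * φ (qdet q x) = 1 → ∃ ψ : G →ₐ[F] B, ψ.comp ι = φ)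
    {Δ : G →ₐ[F] G ⊗[F] G} (hΔ : ∀ i j, Δ (ι (x i j)) = ∑ k, ι (x i k) ⊗ₜ[F] ι (x k j))
    {ε : G →ₐ[F] F} (hε : ∀ i j, ε (ι (x i j)) = if i = j then 1 else 0)
    {St : G →ₗ[F] G}
    (hS1 : LinearMap.mul' F G ∘ₗ TensorProduct.map St LinearMap.id ∘ₗ Δ.toLinearMap
      = Algebra.linearMap F G ∘ₗ ε.toLinearMap)
    (hS2 : LinearMap.mul' F G ∘ₗ TensorProduct.map LinearMap.id St ∘ₗ Δ.toLinearMap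
      = Algebra.linearMap F G ∘ₗ ε.toLinearMap) :
    IsQGroup q (fun i j => ι (x i j)) (fun i j => St (ι (x i j))) Δ ε where
  comul := hΔ
  counit := hε
  inv_mul := by
    ext i j
    rw [Matrix.mul_apply, Matrix.one_apply]
    exact antipode_mul_gen hΔ hε hS1 i j
  mul_inv := by
    ext i j
    rw [Matrix.mul_apply, Matrix.one_apply]
    exact mul_antipode_gen hΔ hε hS2 i j
  lift B _ _ y hy hu := by
    obtain ⟨φ, hφ⟩ := hfreeM B y hy
    have h1 : φ (qdet q x) = qdet q y := by
      simp only [qdet, qMinor, map_sum, map_smul, map_list_prod, List.map_map]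
      refine Finset.sum_congr rfl fun σ _ => ?_
      congr 3
      ext1 m
      exact hφ _ _
    obtain ⟨u, hu⟩ := hu
    obtain ⟨ψ, hψ⟩ := hfreeG B φ ↑u⁻¹ (by rw [h1, ← hu, Units.mul_inv])
      (by rw [h1, ← hu, Units.inv_mul])
    exact ⟨ψ, fun i j => by rw [← hφ, ← hψ]; rfl⟩
  commute B _ _ ψ b hb g := by
    have hM : ∀ m, Commute b (ψ (ι m)) := by
      intro m
      have hm : m ∈ Algebra.adjoin F (Set.range fun p : Fin N × Fin N => x p.1 p.2) := by
        rw [hgenM]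
        trivial
      induction hm using Algebra.adjoin_induction with
      | mem m hm =>
        obtain ⟨p, rfl⟩ := hm
        exact hb _ _
      | algebraMap c =>
        rw [AlgHom.commutes, AlgHom.commutes]
        exact (Algebra.commutes c b).symm
      | add m m' _ _ h h' =>
        rw [map_add, map_add]
        exact h.add_right h'
      | mul m m' _ _ h h' =>
        rw [map_mul, map_mul]
        exact h.mul_right h'
    have hg : g ∈ Algebra.adjoin F
        (Set.range (fun p : Fin N × Fin N => ι (x p.1 p.2)) ∪ {dInv}) := by
      rw [hgen]
      trivial
    induction hg using Algebra.adjoin_induction with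
    | mem m hm =>
      rcases hm with ⟨p, rfl⟩ | rfl
      · exact hb _ _
      · have h1 : ψ (ι (qdet q x)) * ψ m = 1 := by rw [← map_mul, hd1, map_one]
        have h2 : ψ m * ψ (ι (qdet q x)) = 1 := by rw [← map_mul, hd2, map_one]
        let u : Bˣ := ⟨ψ (ι (qdet q x)), ψ m, h1, h2⟩
        exact Commute.units_inv_right (u := u) (hM _)
    | algebraMap c =>
      rw [AlgHom.commutes]
      exact (Algebra.commutes c b).symm
    | add m m' _ _ h h' =>
      rw [map_add]
      exact h.add_right h'
    | mul m m' _ _ hm hn =>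
      rw [map_mul]
      exact hm.mul_right hn

/-- The kernel of the co-orbit map of an integral point with regular specialization. -/
theorem ker_coorbit_eq_span {K : Subfield ℂ} {θ : R →+* F} {η : R →+* K} {T : Rˣ} {c : K →+* R}
    (hθ : Function.Injective θ) (hθ' : ∀ r, r - 1 ∈ Ideal.span {(T : R) - 1} → θ r ≠ 0)
    (hT : η T = 1) (hc : ∀ a, η (c a) = a)
    (hclear : ∀ (S : Finset (Fin N × Fin N →₀ ℕ)), S.Nonempty →
      ∀ a : (Fin N × Fin N →₀ ℕ) → F, (∀ s ∈ S, a s ≠ 0) →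
      ∃ (b : F) (r : (Fin N × Fin N →₀ ℕ) → R), (∀ s ∈ S, b * a s = θ (r s)) ∧
        ∃ s ∈ S, η (r s) ≠ 0)
    {q : F} (hq : θ T = q) {x : Fin N → Fin N → M} (hx : IsQMat q x)
    (hgenM : Algebra.adjoin F (Set.range fun p : Fin N × Fin N => x p.1 p.2) = ⊤)
    (ΔM : M →ₐ[F] M ⊗[F] M) (hΔM : ∀ i j, ΔM (x i j) = ∑ m, x i m ⊗ₜ[F] x m j)
    {ι : M →ₐ[F] G} {Δ : G →ₐ[F] G ⊗[F] G} {ε : G →ₐ[F] F} {St : G →ₗ[F] G}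
    (hSt : ∀ a b, St (a * b) = St b * St a) (hSt1 : St 1 = 1)
    (hG : IsQGroup q (fun i j => ι (x i j)) (fun i j => St (ι (x i j))) Δ ε)
    {ξ : Fin N → Fin N → R} (e : M →ₐ[F] F) (he : ∀ i j, e (x i j) = θ (ξ i j))
    (hcent : Module.finrank K (LinearMap.ker
      (LinearMap.mulLeft K (Matrix.of fun i j => η (ξ i j) : Matrix (Fin N) (Fin N) K) -
        LinearMap.mulRight K (Matrix.of fun i j => η (ξ i j)))) = N) :
    LinearMap.ker (coorbit e (adjBeta ΔM ι St)) = Submodule.span F {y : M | ∃ (i : Fin N) (h : M),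
      y = (tauCoinv q q⁻¹ x (i.1 + 1) - algebraMap F M (e (tauCoinv q q⁻¹ x (i.1 + 1)))) * h} := by
  have hq0 : q ≠ 0 := by
    rw [← hq]
    exact (T.isUnit.map θ).ne_zero
  set I := Submodule.span F {y : M | ∃ (i : Fin N) (h : M),
      y = (tauCoinv q q⁻¹ x (i.1 + 1) - algebraMap F M (e (tauCoinv q q⁻¹ x (i.1 + 1)))) * h}
  have hI : I ≤ LinearMap.ker (coorbit e (adjBeta ΔM ι St)) := by
    refine Submodule.span_le.2 ?_
    rintro _ ⟨i, h, rfl⟩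
    refine coorbit_mul_eq_zero ΔM ι St e hSt hgenM hΔM ?_ h
    rw [map_sub, coorbit_tauCoinv hq0 ΔM ι St e hSt hSt1 hx hΔM, Algebra.algebraMap_eq_smul_one,
      Algebra.algebraMap_eq_smul_one, map_smul, coorbit_one ΔM ι St e hSt1, sub_self]
    · intro i j
      have := congrFun (congrFun hG.inv_mul i) j
      rwa [Matrix.mul_apply, Matrix.one_apply] at this
    · intro i j
      have := congrFun (congrFun hG.mul_inv i) j
      rwa [Matrix.mul_apply, Matrix.one_apply] at this
  refine le_antisymm ?_ hI
  subst hq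
  have htop : I ⊔ Submodule.span F ((fun s => listProd x (monList s)) '' stdMon N) = ⊤ := by
    refine eq_top_of_stdMon_mem hx hθ' hgenM e ξ he _ ?_ ?_
    · intro t ht1 htN h
      refine Submodule.mem_sup_left (Submodule.subset_span ⟨⟨t - 1, by omega⟩, h, ?_⟩)
      simp only [Nat.sub_add_cancel ht1]
    · exact fun s hs => Submodule.mem_sup_right (Submodule.subset_span ⟨s, hs, rfl⟩)
  intro f hf
  have hf' : f ∈ I ⊔ Submodule.span F ((fun s => listProd x (monList s)) '' stdMon N) := by
    rw [htop]
    trivial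
  obtain ⟨y, hy, z, hz, rfl⟩ := Submodule.mem_sup.1 hf'
  rw [LinearMap.mem_ker, map_add, LinearMap.mem_ker.1 (hI hy), zero_add] at hf
  obtain ⟨a, ha, rfl⟩ := (Finsupp.mem_span_image_iff_linearCombination F).1 hz
  rw [Finsupp.mem_supported] at ha
  suffices h : a = 0 by
    rw [h, map_zero, add_zero]
    exact hy
  by_contra ha0
  obtain ⟨b, r, hr, s, hs, hrs⟩ := hclear a.support (Finsupp.support_nonempty_iff.2 ha0) a
    fun s hs => Finsupp.mem_support_iff.1 hs
  refine hrs (specialization_eq_zero ΔM ι St e hSt hSt1 hΔM he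
    (fun g hg => hG.isSpecialization hθ hT hc hg) hcent (fun s hs => ha hs) ?_ s hs)
  rw [Finsupp.linearCombination_apply, Finsupp.sum, map_sum] at hf
  rw [← smul_zero b, ← hf, Finset.smul_sum]
  refine Finset.sum_congr rfl fun s hs => ?_
  rw [map_smul, smul_smul, hr s hs]

end Kernel

section Laurent

variable {K : Type} [Field K] {η : LaurentPolynomial K →ₐ[K] K}
  {θ : LaurentPolynomial K →ₐ[K] RatFunc K}

lemma theta_toLaurent (hθ : θ (LaurentPolynomial.T 1) = RatFunc.X) (p : Polynomial K) :
    θ (Polynomial.toLaurent p) = algebraMap (Polynomial K) (RatFunc K) p := by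
  have h : θ.comp Polynomial.toLaurentAlg =
      IsScalarTower.toAlgHom K (Polynomial K) (RatFunc K) := by
    refine Polynomial.algHom_ext ?_
    simp [hθ, Polynomial.toLaurent_X]
  exact AlgHom.congr_fun h p

lemma eta_toLaurent (hη : η (LaurentPolynomial.T 1) = 1) (p : Polynomial K) :
    η (Polynomial.toLaurent p) = p.eval 1 := by
  have h : η.comp Polynomial.toLaurentAlg = Polynomial.aeval 1 := by
    refine Polynomial.algHom_ext ?_
    simp [hη, Polynomial.toLaurent_X]
  rw [← Polynomial.coe_aeval_eq_eval]
  exact AlgHom.congr_fun h p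

lemma theta_injective (hθ : θ (LaurentPolynomial.T 1) = RatFunc.X) :
    Function.Injective θ := by
  rw [injective_iff_map_eq_zero]
  intro r hr
  obtain ⟨n, p, hp⟩ := LaurentPolynomial.exists_T_pow r
  have h1 := theta_toLaurent hθ p
  rw [hp, map_mul, hr, zero_mul] at h1
  have h2 : p = 0 := (map_eq_zero_iff _ (IsFractionRing.injective _ (RatFunc K))).1 h1.symm
  rw [h2, map_zero] at hp
  exact (LaurentPolynomial.isUnit_T (n : ℤ)).mul_left_eq_zero.1 hp.symm

end Laurent

end QuantumOrbit

/-- Generic case: if the classical adjoint orbit of `η(ξ)` is maximal, the kernel of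
`β^ξ` over `K(q)` is the right ideal generated by the `τᵢ - τᵢ(ξ)`. -/
theorem ker_coorbit_generic
    (K : Subfield ℂ) {N : ℕ}
    (η : LaurentPolynomial ↥K →ₐ[↥K] ↥K)
    (hη : η (LaurentPolynomial.T 1) = 1)
    (θ : LaurentPolynomial ↥K →ₐ[↥K] RatFunc ↥K)
    (hθ : θ (LaurentPolynomial.T 1) = RatFunc.X)
    (Mq Gq : Type) [Ring Mq] [Algebra (RatFunc ↥K) Mq] [Ring Gq] [Algebra (RatFunc ↥K) Gq]
    (xq : Fin N → Fin N → Mq)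
    (hrowq : ∀ i j l : Fin N, j < l → xq i j * xq i l = ((RatFunc.X : RatFunc ↥K)) • (xq i l * xq i j))
    (hcolq : ∀ i k j : Fin N, i < k → xq i j * xq k j = ((RatFunc.X : RatFunc ↥K)) • (xq k j * xq i j))
    (hantiq : ∀ i k j l : Fin N, i < k → j < l → xq i l * xq k j = xq k j * xq i l)
    (hdiagq : ∀ i k j l : Fin N, i < k → j < l →
      xq i j * xq k l - xq k l * xq i j = (((RatFunc.X : RatFunc ↥K)) - ((RatFunc.X : RatFunc ↥K)⁻¹)) • (xq i l * xq k j))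
    (hgenq : Algebra.adjoin (RatFunc ↥K) (Set.range fun p : Fin N × Fin N => xq p.1 p.2) = ⊤)
    (hfreeq : ∀ (B : Type) [Ring B] [Algebra (RatFunc ↥K) B] (y : Fin N → Fin N → B),
      (∀ i j l : Fin N, j < l → y i j * y i l = ((RatFunc.X : RatFunc ↥K)) • (y i l * y i j)) →
      (∀ i k j : Fin N, i < k → y i j * y k j = ((RatFunc.X : RatFunc ↥K)) • (y k j * y i j)) →
      (∀ i k j l : Fin N, i < k → j < l → y i l * y k j = y k j * y i l) →
      (∀ i k j l : Fin N, i < k → j < l →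
        y i j * y k l - y k l * y i j = (((RatFunc.X : RatFunc ↥K)) - ((RatFunc.X : RatFunc ↥K)⁻¹)) • (y i l * y k j)) →
      ∃! φ : Mq →ₐ[(RatFunc ↥K)] B, ∀ i j, φ (xq i j) = y i j)
    (ιq : Mq →ₐ[(RatFunc ↥K)] Gq) (dInvq : Gq)
    (hd1q : ιq (qdet ((RatFunc.X : RatFunc ↥K)) xq) * dInvq = 1)
    (hd2q : dInvq * ιq (qdet ((RatFunc.X : RatFunc ↥K)) xq) = 1)
    (hgenGq : Algebra.adjoin (RatFunc ↥K)
      (Set.range (fun p : Fin N × Fin N => ιq (xq p.1 p.2)) ∪ {dInvq}) = ⊤)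
    (hfreeGq : ∀ (B : Type) [Ring B] [Algebra (RatFunc ↥K) B] (φ : Mq →ₐ[(RatFunc ↥K)] B) (u : B),
      φ (qdet ((RatFunc.X : RatFunc ↥K)) xq) * u = 1 → u * φ (qdet ((RatFunc.X : RatFunc ↥K)) xq) = 1 →
      ∃! ψ : Gq →ₐ[(RatFunc ↥K)] B, ψ.comp ιq = φ)
    (ΔMq : Mq →ₐ[(RatFunc ↥K)] Mq ⊗[(RatFunc ↥K)] Mq)
    (hΔMq : ∀ i j, ΔMq (xq i j) = ∑ k, xq i k ⊗ₜ[(RatFunc ↥K)] xq k j)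
    (ΔGq : Gq →ₐ[(RatFunc ↥K)] Gq ⊗[(RatFunc ↥K)] Gq)
    (hΔGq : ∀ m, ΔGq (ιq m) = Algebra.TensorProduct.map ιq ιq (ΔMq m))
    (εGq : Gq →ₐ[(RatFunc ↥K)] (RatFunc ↥K))
    (hεGq : ∀ i j, εGq (ιq (xq i j)) = if i = j then 1 else 0)
    (Stq : Gq →ₗ[(RatFunc ↥K)] Gq)
    (hS1q : LinearMap.mul' (RatFunc ↥K) Gq ∘ₗ TensorProduct.map Stq LinearMap.id ∘ₗ ΔGq.toLinearMap
      = Algebra.linearMap (RatFunc ↥K) Gq ∘ₗ εGq.toLinearMap)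
    (hS2q : LinearMap.mul' (RatFunc ↥K) Gq ∘ₗ TensorProduct.map LinearMap.id Stq ∘ₗ ΔGq.toLinearMap
      = Algebra.linearMap (RatFunc ↥K) Gq ∘ₗ εGq.toLinearMap)
    (ξ : Matrix (Fin N) (Fin N) (LaurentPolynomial ↥K))
    (eq : Mq →ₐ[RatFunc ↥K] RatFunc ↥K) (heq : ∀ i l, eq (xq i l) = θ (ξ i l))
    (hcent : Module.finrank ↥K
      ↥(LinearMap.ker
          (LinearMap.mulLeft ↥K ((Matrix.of fun i l => η (ξ i l)) : Matrix (Fin N) (Fin N) ↥K)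
            - LinearMap.mulRight ↥K ((Matrix.of fun i l => η (ξ i l)) : Matrix (Fin N) (Fin N) ↥K))) = N) :
    LinearMap.ker (coorbit eq (adjBeta ΔMq ιq Stq))
      = Submodule.span (RatFunc ↥K) {y : Mq | ∃ (i : Fin N) (h : Mq),
          y = (tauCoinv (RatFunc.X : RatFunc ↥K) (RatFunc.X : RatFunc ↥K)⁻¹ xq (i.1 + 1) - algebraMap (RatFunc ↥K) Mq (eq (tauCoinv (RatFunc.X : RatFunc ↥K) (RatFunc.X : RatFunc ↥K)⁻¹ xq (i.1 + 1)))) * h} := by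
  have hx : QuantumOrbit.IsQMat (RatFunc.X : RatFunc K) xq := ⟨hrowq, hcolq, hantiq, hdiagq⟩
  have hΔ : ∀ i j, ΔGq (ιq (xq i j)) = ∑ k, ιq (xq i k) ⊗ₜ[RatFunc K] ιq (xq k j) := by
    intro i j
    simp [hΔGq, hΔMq]
  obtain ⟨hSt, hSt1⟩ := QuantumOrbit.antipode_mul hgenq hd1q hd2q hgenGq hΔ hεGq hS1q hS2q
  have hG := QuantumOrbit.isQGroup_of_hopf hgenq
    (fun B _ _ y hy => (hfreeq B y hy.row hy.col hy.anti hy.diag).exists) hd1q hd2q hgenGq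
    (fun B _ _ φ u h1 h2 => (hfreeGq B φ u h1 h2).exists) hΔ hεGq hS1q hS2q
  let T : (LaurentPolynomial K)ˣ :=
    ⟨LaurentPolynomial.T 1, LaurentPolynomial.T (-1),
      by rw [← LaurentPolynomial.T_add, add_neg_cancel, LaurentPolynomial.T_zero],
      by rw [← LaurentPolynomial.T_add, neg_add_cancel, LaurentPolynomial.T_zero]⟩
  have hinj := QuantumOrbit.theta_injective hθ
  refine QuantumOrbit.ker_coorbit_eq_span (θ := (θ : LaurentPolynomial K →+* RatFunc K))
    (η := (η : LaurentPolynomial K →+* K)) (T := T) (c := algebraMap K (LaurentPolynomial K))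
    hinj ?_ hη (fun a => η.commutes a) ?_ hθ hx hgenq ΔMq hΔMq hSt hSt1 hG eq heq hcent
  · intro r hr h
    have h0 : r = 0 := hinj (h.trans (map_zero θ).symm)
    obtain ⟨s, hs⟩ := Ideal.mem_span_singleton'.1 hr
    have h1 := congrArg η hs
    have h2 : η (T : LaurentPolynomial K) = 1 := hη
    simp [h0, h2] at h1
  · intro S hS a ha
    obtain ⟨b, g, hg, s, hs, hgs⟩ := QuantumOrbit.exists_polynomial_multiples S hS a ha
    refine ⟨b, fun s => Polynomial.toLaurent (g s), fun s hs => ?_, s, hs, ?_⟩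
    · rw [hg s hs]
      exact (QuantumOrbit.theta_toLaurent hθ _).symm
    · exact fun h => hgs ((QuantumOrbit.eta_toLaurent hη _).symm.trans h)
end
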